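/- Let g, p, h ∈ ℝ[x] with deg g ≥ 2 and deg h ≥ 1, let f(x,y) = g(x + p(y)) + h(y), let A, B ⊆ ℝ be finite sets, and let t ∈ (0,1] satisfy t|A| ≥ 1 and t|B| ≥ 1. Define R_t = {(α_1, α_2, a_1′, a_2′, b_1, b_2) ∈ (A+A)² × A² × B² : f(α_1 − a_1′, b_1) = f(α_2 − a_2′, b_2), the pair (α_1, α_2) is t-close in A + A, (a_1′, a_2′) is t-close in A, (b_1, b_2) is t-close in B, and (b_1, b_2) is not bad}, and define S_t = {(b_1, b_2, c_1, c_2) ∈ B² × B² : h(b_1) + h(c_1) = h(b_2) + h(c_2), and both (b_1, b_2) and (c_1, c_2) are t-close in B and not bad}. Then for every η > 0 there exists a constant C > 0, depending only on deg f and η, such that |R_t| ≤ C·(I + II + III + IV), where I = t²|A|^{18/11 + 2η}|B|^{14/11 + 3η}|A+A|^{12/11}|S_t|^{2/11}, II = t^{5/3}|A|^{4/3}|B|^{2/3 + η}|A+A|^{4/3}|S_t|^{1/3}, III = t|A+A|²|B|, and IV = t²|A|²|B|². -/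

import Mathlib

open Polynomial Finset Pointwise

/-- The (1-based) index of `x` in the increasing enumeration of the finite set `X ⊆ ℝ`. -/
noncomputable def idx (X : Finset ℝ) (x : ℝ) : ℕ :=
  (X.filter (fun y => y ≤ x)).card

/-- A pair `(x₁, x₂)` is `t`-close with respect to `X` if their indices differ by at most
`t|X|`. -/
def tClose (X : Finset ℝ) (t x₁ x₂ : ℝ) : Prop :=
  |(idx X x₁ : ℝ) - (idx X x₂ : ℝ)| ≤ t * (X.card : ℝ)

/-- A bivariate real polynomial is reducible if it is a product of two nonconstant
polynomials. -/
def RedBiv (F : MvPolynomial (Fin 2) ℝ) : Prop :=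
  ∃ F₁ F₂ : MvPolynomial (Fin 2) ℝ, F = F₁ * F₂ ∧ 1 ≤ F₁.totalDegree ∧ 1 ≤ F₂.totalDegree

/-- The bivariate polynomial `q(x) - q(y)`. -/
noncomputable def bivDiff (q : Polynomial ℝ) : MvPolynomial (Fin 2) ℝ :=
  Polynomial.aeval (MvPolynomial.X 0) q - Polynomial.aeval (MvPolynomial.X 1) q

/-- The pair `(b₁, b₂)` is bad if `g(x) - g(y) + h(b₁) - h(b₂)` or
`h(x) - h(y) + h(b₁) - h(b₂)` is reducible in `ℝ[x, y]`. -/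
def Bad (g h : Polynomial ℝ) (b₁ b₂ : ℝ) : Prop :=
  RedBiv (bivDiff g + MvPolynomial.C (h.eval b₁ - h.eval b₂)) ∨
  RedBiv (bivDiff h + MvPolynomial.C (h.eval b₁ - h.eval b₂))

/-- `f(x, y) = g(x + p(y)) + h(y)`. -/
noncomputable def fval (g p h : Polynomial ℝ) (x y : ℝ) : ℝ :=
  g.eval (x + p.eval y) + h.eval y

/-- The proximity-restricted set `R_t`. -/
def Rtset (g p h : Polynomial ℝ) (A B : Finset ℝ) (t : ℝ) :
    Set (ℝ × ℝ × ℝ × ℝ × ℝ × ℝ) :=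
  {r | ∃ α₁ α₂ a₁' a₂' b₁ b₂ : ℝ, r = (α₁, α₂, a₁', a₂', b₁, b₂) ∧
    α₁ ∈ A + A ∧ α₂ ∈ A + A ∧ a₁' ∈ A ∧ a₂' ∈ A ∧ b₁ ∈ B ∧ b₂ ∈ B ∧
    fval g p h (α₁ - a₁') b₁ = fval g p h (α₂ - a₂') b₂ ∧
    tClose (A + A) t α₁ α₂ ∧ tClose A t a₁' a₂' ∧ tClose B t b₁ b₂ ∧
    ¬ Bad g h b₁ b₂}

/-- The proximity-restricted set `S_t`. -/
def Stset (g h : Polynomial ℝ) (B : Finset ℝ) (t : ℝ) : Set (ℝ × ℝ × ℝ × ℝ) :=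
  {s | ∃ b₁ b₂ c₁ c₂ : ℝ, s = (b₁, b₂, c₁, c₂) ∧
    b₁ ∈ B ∧ b₂ ∈ B ∧ c₁ ∈ B ∧ c₂ ∈ B ∧
    h.eval b₁ + h.eval c₁ = h.eval b₂ + h.eval c₂ ∧
    tClose B t b₁ b₂ ∧ tClose B t c₁ c₂ ∧ ¬ Bad g h b₁ b₂ ∧ ¬ Bad g h c₁ c₂}


set_option linter.unusedVariables false
set_option linter.unusedSimpArgs false


/-! ### Bezout by dimension counting -/

abbrev MP2 := MvPolynomial (Fin 2) ℝ

noncomputable def ev (F : MP2) (p : ℝ × ℝ) : ℝ := MvPolynomial.eval ![p.1, p.2] F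

@[simp] lemma ev_add (F G : MP2) (p) : ev (F + G) p = ev F p + ev G p := by simp [ev]
@[simp] lemma ev_sub (F G : MP2) (p) : ev (F - G) p = ev F p - ev G p := by simp [ev]
@[simp] lemma ev_mul (F G : MP2) (p) : ev (F * G) p = ev F p * ev G p := by simp [ev]
@[simp] lemma ev_zero (p) : ev 0 p = 0 := by simp [ev]
@[simp] lemma ev_one (p) : ev 1 p = 1 := by simp [ev]
@[simp] lemma ev_neg (F : MP2) (p) : ev (-F) p = - ev F p := by simp [ev]
@[simp] lemma ev_C (a : ℝ) (p) : ev (MvPolynomial.C a) p = a := by simp [ev]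
@[simp] lemma ev_X0 (p) : ev (MvPolynomial.X 0) p = p.1 := by simp [ev]
@[simp] lemma ev_X1 (p) : ev (MvPolynomial.X 1) p = p.2 := by simp [ev]
@[simp] lemma ev_smul (a : ℝ) (F : MP2) (p) : ev (a • F) p = a * ev F p := by
  simp [ev]
@[simp] lemma ev_pow (F : MP2) (n : ℕ) (p) : ev (F ^ n) p = ev F p ^ n := by simp [ev]
lemma ev_prod {ι : Type*} (s : Finset ι) (F : ι → MP2) (p) :
    ev (∏ i ∈ s, F i) p = ∏ i ∈ s, ev (F i) p := by simp [ev]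
lemma ev_sum {ι : Type*} (s : Finset ι) (F : ι → MP2) (p) :
    ev (∑ i ∈ s, F i) p = ∑ i ∈ s, ev (F i) p := by simp [ev]

noncomputable abbrev VN (N : ℕ) : Submodule ℝ MP2 := MvPolynomial.restrictTotalDegree (Fin 2) ℝ N

lemma finrank_VN (N : ℕ) : 2 * Module.finrank ℝ (VN N) = (N + 1) * (N + 2) := by
  have h1 : Module.finrank ℝ (VN N) = Nat.card {s : Fin 2 →₀ ℕ | (s.sum fun _ e => e) ≤ N} := by
    exact Module.finrank_eq_nat_card_basis (MvPolynomial.basisRestrictSupport ℝ _)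
  let e : {s : Fin 2 →₀ ℕ | (s.sum fun _ e => e) ≤ N} ≃
      ((Finset.range (N+1)).sigma (fun k => HasAntidiagonal.antidiagonal k) : Finset (Σ _ : ℕ, ℕ × ℕ)) :=
    { toFun := fun s => ⟨⟨s.1 0 + s.1 1, (s.1 0, s.1 1)⟩, by
        have := s.2
        rw [Set.mem_ofPred_eq, Finsupp.sum_fintype _ _ (by simp)] at this
        simp only [Fin.sum_univ_two] at this
        simp; omega⟩
      invFun := fun t => ⟨Finsupp.equivFunOnFinite.symm ![t.1.2.1, t.1.2.2], by
        have := t.2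
        rw [Set.mem_ofPred_eq, Finsupp.sum_fintype _ _ (by simp)]
        simp only [mem_sigma, mem_range, HasAntidiagonal.mem_antidiagonal] at this
        simp [Fin.sum_univ_two]; omega⟩
      left_inv := by
        intro s
        ext i
        fin_cases i <;> simp
      right_inv := by
        rintro ⟨⟨k, i, j⟩, h⟩
        simp only [mem_sigma, mem_range, HasAntidiagonal.mem_antidiagonal] at h
        obtain ⟨h1, h2⟩ := h
        subst h2
        simp }
  rw [h1, Nat.card_congr e, Nat.card_eq_fintype_card, Fintype.card_coe, Finset.card_sigma]
  simp only [Finset.Nat.card_antidiagonal]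
  clear e h1
  induction N with
  | zero => simp
  | succ n ih => rw [Finset.sum_range_succ, mul_add, ih]; ring

noncomputable def evL (S : Finset (ℝ × ℝ)) (N : ℕ) : VN N →ₗ[ℝ] (S → ℝ) where
  toFun F := fun s => ev F.1 s.1
  map_add' := by intro F G; ext s; simp
  map_smul' := by intro a F; ext s; simp

lemma sep_poly (s t : ℝ × ℝ) (h : s ≠ t) : ∃ F : MP2, F.totalDegree ≤ 1 ∧ ev F s = 1 ∧ ev F t = 0 := by
  by_cases h1 : s.1 = t.1
  · have h2 : s.2 ≠ t.2 := fun h2 => h (Prod.ext h1 h2)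
    refine ⟨MvPolynomial.C (s.2 - t.2)⁻¹ * (MvPolynomial.X 1 - MvPolynomial.C t.2), ?_, ?_, ?_⟩
    · refine (MvPolynomial.totalDegree_mul _ _).trans ?_
      simp only [MvPolynomial.totalDegree_C, zero_add]
      refine (MvPolynomial.totalDegree_sub _ _).trans ?_
      simp
    · have : s.2 - t.2 ≠ 0 := sub_ne_zero.2 h2
      simp [this]
    · simp
  · refine ⟨MvPolynomial.C (s.1 - t.1)⁻¹ * (MvPolynomial.X 0 - MvPolynomial.C t.1), ?_, ?_, ?_⟩
    · refine (MvPolynomial.totalDegree_mul _ _).trans ?_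
      simp only [MvPolynomial.totalDegree_C, zero_add]
      refine (MvPolynomial.totalDegree_sub _ _).trans ?_
      simp
    · have : s.1 - t.1 ≠ 0 := sub_ne_zero.2 h1
      simp [this]
    · simp

lemma interp_poly (S : Finset (ℝ × ℝ)) (s : ℝ × ℝ) : ∃ F : MP2, F.totalDegree ≤ S.card ∧
    ev F s = 1 ∧ ∀ t ∈ S, t ≠ s → ev F t = 0 := by
  classical
  have : ∀ t : ℝ × ℝ, ∃ F : MP2, F.totalDegree ≤ 1 ∧ ev F s = 1 ∧ (t ≠ s → ev F t = 0) := by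
    intro t
    by_cases h : t = s
    · exact ⟨1, by simp, by simp, fun h' => absurd h h'⟩
    · obtain ⟨F, h1, h2, h3⟩ := sep_poly s t (Ne.symm h)
      exact ⟨F, h1, h2, fun _ => h3⟩
  choose F hF1 hF2 hF3 using this
  refine ⟨∏ t ∈ S, F t, ?_, ?_, ?_⟩
  · refine (MvPolynomial.totalDegree_finsetProd _ _).trans ?_
    exact (Finset.sum_le_sum fun t _ => hF1 t).trans (by simp)
  · rw [ev_prod]; exact Finset.prod_eq_one fun t _ => hF2 t
  · intro t ht hts
    rw [ev_prod]; exact Finset.prod_eq_zero ht (hF3 t hts)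

lemma evL_surj (S : Finset (ℝ × ℝ)) (N : ℕ) (h : S.card ≤ N) : Function.Surjective (evL S N) := by
  classical
  intro v
  choose F hF1 hF2 hF3 using fun s : S => interp_poly S s.1
  refine ⟨∑ s : S, v s • ⟨F s, (MvPolynomial.mem_restrictTotalDegree _ _ _).2 ((hF1 s).trans h)⟩, ?_⟩
  ext t
  rw [map_sum, Finset.sum_apply, Finset.sum_eq_single t]
  · simp [evL, hF2 t]
  · intro s _ hst
    have := hF3 s t.1 t.2 (fun h => hst (Subtype.ext h.symm))
    simp [evL, this]
  · simp

noncomputable def comb (F G : MP2) (N a b : ℕ) (ha : a + F.totalDegree ≤ N) (hb : b + G.totalDegree ≤ N) :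
    (VN a × VN b) →ₗ[ℝ] VN N where
  toFun x := ⟨x.1.1 * F + x.2.1 * G, by
    have h1 := (MvPolynomial.mem_restrictTotalDegree _ _ _).1 x.1.2
    have h2 := (MvPolynomial.mem_restrictTotalDegree _ _ _).1 x.2.2
    refine (MvPolynomial.mem_restrictTotalDegree _ _ _).2 ?_
    refine (MvPolynomial.totalDegree_add _ _).trans (max_le ?_ ?_)
    · exact (MvPolynomial.totalDegree_mul _ _).trans (by omega)
    · exact (MvPolynomial.totalDegree_mul _ _).trans (by omega)⟩
  map_add' := by intro x y; ext1; simp; ring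
  map_smul' := by intro c x; ext1; simp

noncomputable def kerm (F G : MP2) (c a b : ℕ) (ha : c + G.totalDegree ≤ a) (hb : c + F.totalDegree ≤ b) :
    VN c →ₗ[ℝ] (VN a × VN b) where
  toFun x := (⟨-(x.1 * G), by
    have h1 := (MvPolynomial.mem_restrictTotalDegree _ _ _).1 x.2
    refine (MvPolynomial.mem_restrictTotalDegree _ _ _).2 ?_
    rw [MvPolynomial.totalDegree_neg]
    exact (MvPolynomial.totalDegree_mul _ _).trans (by omega)⟩,
    ⟨x.1 * F, by
    have h1 := (MvPolynomial.mem_restrictTotalDegree _ _ _).1 x.2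
    refine (MvPolynomial.mem_restrictTotalDegree _ _ _).2 ?_
    exact (MvPolynomial.totalDegree_mul _ _).trans (by omega)⟩)
  map_add' := by intro x y; ext1 <;> ext1 <;> simp <;> ring
  map_smul' := by intro c x; ext1 <;> ext1 <;> simp

theorem bezout (F G : MP2) (hF : F ≠ 0) (hG : G ≠ 0) (hrel : IsRelPrime F G) (S : Finset (ℝ × ℝ))
    (hS : ∀ p ∈ S, ev F p = 0 ∧ ev G p = 0) : S.card ≤ F.totalDegree * G.totalDegree := by
  classical
  set df := F.totalDegree with hdf
  set dg := G.totalDegree with hdg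
  set s := S.card with hs
  let N := df + dg + s
  let μ := comb F G N (dg + s) (df + s) (by omega) (by omega)
  let κ := kerm F G s (dg + s) (df + s) (by omega) (by omega)
  have hker : LinearMap.ker μ ≤ LinearMap.range κ := by
    rintro ⟨⟨a, ha⟩, ⟨b, hb⟩⟩ hx
    have hx' : a * F + b * G = 0 := by
      have := congrArg Subtype.val (LinearMap.mem_ker.1 hx)
      simpa [μ, comb] using this
    have hdvd : F ∣ b := by
      have : F ∣ b * G := ⟨-a, by linear_combination hx'⟩
      exact hrel.dvd_of_dvd_mul_right this
    obtain ⟨c, rfl⟩ := hdvd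
    have ha' : a = -(c * G) := by
      have : (a + c * G) * F = 0 := by linear_combination hx'
      rcases mul_eq_zero.1 this with h | h
      · linear_combination h
      · exact absurd h hF
    have hb' := (MvPolynomial.mem_restrictTotalDegree _ _ _).1 hb
    have hc : c.totalDegree ≤ s := by
      by_cases hc0 : c = 0
      · simp [hc0]
      · rw [MvPolynomial.totalDegree_mul_of_isDomain hF hc0] at hb'
        omega
    refine ⟨⟨c, (MvPolynomial.mem_restrictTotalDegree _ _ _).2 hc⟩, ?_⟩
    ext1
    · ext1; simp [κ, kerm, ha']
    · ext1; simp [κ, kerm, mul_comm]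
  have hrange : LinearMap.range μ ≤ LinearMap.ker (evL S N) := by
    rintro _ ⟨x, rfl⟩
    rw [LinearMap.mem_ker]
    ext t
    obtain ⟨h1, h2⟩ := hS t.1 t.2
    simp [evL, μ, comb, h1, h2]
  have hsurj := evL_surj S N (by omega)
  have e1 := LinearMap.finrank_range_add_finrank_ker (evL S N)
  rw [LinearMap.range_eq_top.2 hsurj, finrank_top, Module.finrank_fintype_fun_eq_card,
    Fintype.card_coe] at e1
  have e2 := LinearMap.finrank_range_add_finrank_ker μ
  rw [Module.finrank_prod] at e2
  have e3 := Submodule.finrank_mono hrange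
  have e4 := Submodule.finrank_mono hker
  have e5 := LinearMap.finrank_range_le κ
  have f1 := finrank_VN N
  have f2 := finrank_VN (dg + s)
  have f3 := finrank_VN (df + s)
  have f4 := finrank_VN s
  have key : Module.finrank ℝ (VN N) + Module.finrank ℝ (VN s) =
      Module.finrank ℝ (VN (dg + s)) + Module.finrank ℝ (VN (df + s)) + df * dg := by
    have : N = df + dg + s := rfl
    rw [this] at f1 ⊢
    nlinarith
  omega


/-! ### The tournament lemma -/

noncomputable def wL {N : ℕ} (r : Fin N → Fin (N+1) → ℝ) (v : Fin (N+1) → ℝ) : ℝ :=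
  Matrix.detRowAlternating (R := ℝ) (Fin.snoc (α := fun _ => Fin (N+1) → ℝ) r v)

lemma wL_linear {N : ℕ} (r : Fin N → Fin (N+1) → ℝ) :
    ∃ w : Fin (N+1) → ℝ, ∀ v, wL r v = ∑ j, w j * v j := by
  classical
  let L := (Matrix.detRowAlternating (R := ℝ) (n := Fin (N+1))).toMultilinearMap.toLinearMap
    (Fin.snoc (α := fun _ => Fin (N+1) → ℝ) r 0) (Fin.last N)
  have hL : ∀ v, wL r v = L v := by
    intro v
    simp only [L, wL, MultilinearMap.toLinearMap_apply]
    rw [Fin.update_snoc_last]; rfl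
  refine ⟨fun j => L (Pi.single j 1), fun v => ?_⟩
  rw [hL]
  conv_lhs => rw [pi_eq_sum_univ' v]
  rw [map_sum]
  refine Finset.sum_congr rfl fun j _ => ?_
  rw [map_smul, smul_eq_mul, mul_comm]

lemma wL_swap {N : ℕ} (r : Fin N → Fin (N+1) → ℝ) (i : Fin N) (a b : Fin (N+1) → ℝ) :
    wL (Function.update r i a) b = - wL (Function.update r i b) a := by
  classical
  unfold wL
  have hne : (i.castSucc : Fin (N+1)) ≠ Fin.last N := Fin.castSucc_lt_last i |>.ne
  rw [← AlternatingMap.map_swap _ _ hne]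
  congr 1
  funext k
  refine Fin.lastCases ?_ (fun k => ?_) k
  · simp [Function.comp]
  · by_cases hk : k = i
    · subst hk; simp [Function.update_of_ne hne.symm]
    · have h1 : (k.castSucc : Fin (N+1)) ≠ i.castSucc := by
        intro h; exact hk (Fin.castSucc_injective _ h)
      have h2 : (k.castSucc : Fin (N+1)) ≠ Fin.last N := (Fin.castSucc_lt_last k).ne
      simp [Function.comp, Equiv.swap_apply_of_ne_of_ne h1 h2, hk]

lemma tourn_aux (x y z : ℝ) : ((if 0 < x * y then 1 else 0) + (if 0 < z * (-x) then 1 else 0)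
    + (if 0 < (-y) * (-z) then 1 else 0) : ℕ) ≤ 2 := by
  by_cases h1 : 0 < x * y <;> by_cases h2 : 0 < z * (-x) <;> by_cases h3 : 0 < (-y) * (-z) <;>
    simp only [h1, h2, h3, if_true, if_false] <;> norm_num
  exfalso
  have := mul_pos (mul_pos h1 h2) h3
  nlinarith [sq_nonneg (x*y*z)]

/-- count of same side pairs, for functional values `f`. -/
noncomputable def cnt {ι : Type} (S : Finset ι) (f : ι → ℝ) : ℕ :=
  ((S ×ˢ S).filter (fun q => 0 < f q.1 * f q.2)).card

lemma tourn_slot {ι : Type} [DecidableEq ι] (N : ℕ) (φ : ι → Fin (N+1) → ℝ) (S : Fin N → Finset ι) (i : Fin N) :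
    3 * ∑ s ∈ Fintype.piFinset S, cnt (S i) (fun q => wL (fun k => φ (s k)) (φ q)) ≤
      2 * ((Fintype.piFinset S).card * (S i).card ^ 2) := by
  classical
  let Ω := Fintype.piFinset S ×ˢ (S i ×ˢ S i)
  let X : (Fin N → ι) × (ι × ι) → ℕ := fun x =>
    if 0 < wL (fun k => φ (x.1 k)) (φ x.2.1) * wL (fun k => φ (x.1 k)) (φ x.2.2) then 1 else 0
  let σ : (Fin N → ι) × (ι × ι) → (Fin N → ι) × (ι × ι) := fun x =>
    (Function.update x.1 i x.2.1, (x.2.2, x.1 i))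
  have hσ : ∀ x ∈ Ω, σ x ∈ Ω := by
    rintro ⟨s, b, c⟩ hx
    simp only [Ω, σ, mem_product, Fintype.mem_piFinset] at hx ⊢
    refine ⟨fun k => ?_, hx.2.2, hx.1 i⟩
    by_cases hk : k = i
    · subst hk; simpa using hx.2.1
    · simpa [hk] using hx.1 k
  have hσ3 : ∀ x, σ (σ (σ x)) = x := by
    rintro ⟨s, b, c⟩
    simp [σ]
  have hsum : ∀ Y : (Fin N → ι) × (ι × ι) → ℕ, ∑ x ∈ Ω, Y (σ x) = ∑ x ∈ Ω, Y x := by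
    intro Y
    refine Finset.sum_nbij' σ (fun x => σ (σ x)) hσ (fun x hx => hσ _ (hσ _ hx)) ?_ ?_ ?_
    · intro x _; exact hσ3 x
    · intro x _; exact hσ3 x
    · intro x _; rfl
  have hX : ∑ s ∈ Fintype.piFinset S, cnt (S i) (fun q => wL (fun k => φ (s k)) (φ q)) = ∑ x ∈ Ω, X x := by
    rw [Finset.sum_product]
    refine Finset.sum_congr rfl fun s _ => ?_
    rw [cnt, Finset.card_filter]
  rw [hX]
  have h3 : 3 * ∑ x ∈ Ω, X x = ∑ x ∈ Ω, (X x + X (σ x) + X (σ (σ x))) := by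
    rw [Finset.sum_add_distrib, Finset.sum_add_distrib, hsum X, hsum (fun x => X (σ x)), hsum X]; ring
  rw [h3]
  have h4 : ∀ x ∈ Ω, X x + X (σ x) + X (σ (σ x)) ≤ 2 := by
    rintro ⟨s, b, c⟩ _
    have hup : ∀ u : ι, (fun k => φ (Function.update s i u k)) =
        Function.update (fun k => φ (s k)) i (φ u) := by
      intro u; funext k
      by_cases hk : k = i
      · subst hk; simp
      · simp [hk]
    have h0 : (fun k => φ (s k)) = Function.update (fun k => φ (s k)) i (φ (s i)) := by
      simp
    have e1 : wL (fun k => φ (Function.update s i b k)) (φ (s i)) = - wL (fun k => φ (s k)) (φ b) := by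
      rw [hup, wL_swap]; rw [← h0]
    have e2 : wL (fun k => φ (Function.update s i c k)) (φ (s i)) = - wL (fun k => φ (s k)) (φ c) := by
      rw [hup, wL_swap]; rw [← h0]
    have e3 : wL (fun k => φ (Function.update s i c k)) (φ b) = - wL (fun k => φ (Function.update s i b k)) (φ c) := by
      rw [hup, wL_swap, hup]
    have := tourn_aux (wL (fun k => φ (s k)) (φ b)) (wL (fun k => φ (s k)) (φ c))
      (wL (fun k => φ (Function.update s i b k)) (φ c))
    simp only [X, σ, Function.update_self, Function.update_idem]
    rw [e1, e2, e3]
    exact this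
  refine (Finset.sum_le_sum h4).trans ?_
  simp only [Ω, Finset.sum_const, Finset.card_product, smul_eq_mul]
  apply le_of_eq; ring

lemma tourn_avg {ι : Type} [DecidableEq ι] (N : ℕ) (φ : ι → Fin (N+1) → ℝ) (S : Fin N → Finset ι)
    (hne : ∀ i, (S i).Nonempty) :
    ∃ s ∈ Fintype.piFinset S, 3 * ∑ i, cnt (S i) (fun q => wL (fun k => φ (s k)) (φ q)) ≤
      2 * ∑ i, (S i).card ^ 2 := by
  classical
  by_contra hcon
  push Not at hcon
  have hpne : (Fintype.piFinset S).Nonempty := Fintype.piFinset_nonempty.2 hne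
  have h1 := Finset.sum_lt_sum_of_nonempty hpne hcon
  have h2 := Finset.sum_le_sum (fun i (_ : i ∈ univ) => tourn_slot N φ S i)
  rw [← Finset.mul_sum, ← Finset.mul_sum, Finset.sum_comm, ← Finset.mul_sum] at h2
  rw [Finset.sum_const, smul_eq_mul, ← Finset.mul_sum] at h1
  have := h1.trans_le h2
  apply absurd this
  rw [not_lt]
  apply le_of_eq; ring

lemma exists_good_eps {N : ℕ} (A B : Matrix (Fin (N+1)) (Fin (N+1)) ℝ) (hB : B.det ≠ 0) :
    {ε : ℝ | (A + ε • B).det = 0}.Finite := by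
  classical
  let P : ℝ[X] := Matrix.det ((X : ℝ[X]) • B.map C + A.map C)
  have hP : P ≠ 0 := by
    intro h
    have := Polynomial.coeff_det_X_add_C_card B A
    apply hB
    rw [← this]
    change P.coeff _ = 0
    simp [h]
  refine (P.roots.toFinset.finite_toSet).subset ?_
  intro ε hε
  rw [Set.mem_ofPred_eq] at hε
  simp only [Finset.mem_coe, Multiset.mem_toFinset, Polynomial.mem_roots hP, Polynomial.IsRoot.def]
  have : Polynomial.evalRingHom ε P = 0 := by
    rw [RingHom.map_det, ← hε]
    congr 1
    ext i j
    simp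
    ring
  exact this

lemma tournament {ι : Type} [Fintype ι] [DecidableEq ι] (N : ℕ) (φ : ι → Fin (N+1) → ℝ) (S : Fin N → Finset ι)
    (hne : ∀ i, (S i).Nonempty) (hdis : ∀ i j, i ≠ j → Disjoint (S i) (S j)) :
    ∃ w : Fin (N+1) → ℝ, w ≠ 0 ∧ 3 * ∑ i, cnt (S i) (fun q => ∑ j, w j * φ q j) ≤
      2 * ∑ i, (S i).card ^ 2 := by
  classical
  let ν : ι → ℝ := fun q => ((Fintype.equivFin ι q : ℕ) : ℝ)
  have hν : Function.Injective ν := by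
    intro a b h
    simp only [ν, Nat.cast_inj] at h
    exact (Fintype.equivFin ι).injective (Fin.ext h)
  have hν' : ∀ q, ν q ≠ -1 := by
    intro q h
    have : (0:ℝ) ≤ ν q := Nat.cast_nonneg _
    linarith
  let ψ : ι → Fin (N+1) → ℝ := fun q j => ν q ^ (j : ℕ)
  let φe : ℝ → ι → Fin (N+1) → ℝ := fun ε q => φ q + ε • ψ q
  -- bad epsilon
  have hbad : ∀ s ∈ Fintype.piFinset S, {ε : ℝ | ∀ v, wL (fun k => φe ε (s k)) v = 0}.Finite := by
    intro s hs
    rw [Fintype.mem_piFinset] at hs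
    have hsinj : Function.Injective s := by
      intro i j hij
      by_contra hne'
      exact Finset.disjoint_left.1 (hdis i j hne') (hs i) (hij ▸ hs j)
    let nodes : Fin (N+1) → ℝ := Fin.snoc (α := fun _ => ℝ) (fun k => ν (s k)) (-1)
    have hnodes : Function.Injective nodes := by
      intro i j
      refine Fin.lastCases ?_ (fun i => ?_) i <;> refine Fin.lastCases ?_ (fun j => ?_) j
      · simp
      · simp only [nodes, Fin.snoc_last, Fin.snoc_castSucc]; intro h; exact absurd h.symm (hν' _)
      · simp only [nodes, Fin.snoc_last, Fin.snoc_castSucc]; intro h; exact absurd h (hν' _)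
      · simp only [nodes, Fin.snoc_castSucc]; intro h; rw [hsinj (hν h)]
    have hdet : (Matrix.vandermonde nodes).det ≠ 0 := Matrix.det_vandermonde_ne_zero_iff.2 hnodes
    refine (exists_good_eps (Matrix.of (Fin.snoc (α := fun _ => Fin (N+1) → ℝ) (fun k => φ (s k)) 0)) _ hdet).subset ?_
    intro ε hε
    rw [Set.mem_ofPred_eq] at hε ⊢
    rw [← hε (ε • (fun j : Fin (N+1) => (-1:ℝ) ^ (j:ℕ)))]
    unfold wL
    change _ = Matrix.det (Matrix.of (Fin.snoc (α := fun _ => Fin (N+1) → ℝ) (fun k => φe ε (s k)) (ε • (fun j : Fin (N+1) => (-1:ℝ) ^ (j:ℕ)))))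
    congr 1
    ext i j
    refine Fin.lastCases ?_ (fun i => ?_) i
    · simp [nodes, Matrix.vandermonde]
    · simp [nodes, φe, ψ, Matrix.vandermonde]
  have hbad2 : {ε : ℝ | ∃ s ∈ Fintype.piFinset S, ∀ v, wL (fun k => φe ε (s k)) v = 0}.Finite := by
    have : {ε : ℝ | ∃ s ∈ Fintype.piFinset S, ∀ v, wL (fun k => φe ε (s k)) v = 0} =
        ⋃ s ∈ (Fintype.piFinset S : Set (Fin N → ι)), {ε : ℝ | ∀ v, wL (fun k => φe ε (s k)) v = 0} := by
      ext ε; simp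
    rw [this]
    exact Set.Finite.biUnion (Finset.finite_toSet _) hbad
  have hgood : ∀ ε, ε ∉ {ε : ℝ | ∃ s ∈ Fintype.piFinset S, ∀ v, wL (fun k => φe ε (s k)) v = 0} →
      ∃ w : Fin (N+1) → ℝ, w ∈ Metric.sphere (0 : Fin (N+1) → ℝ) 1 ∧
        3 * ∑ i, cnt (S i) (fun q => ∑ j, w j * φe ε q j) ≤ 2 * ∑ i, (S i).card ^ 2 := by
    intro ε hε
    obtain ⟨s, hs, hcnt⟩ := tourn_avg N (φe ε) S hne
    obtain ⟨w, hw⟩ := wL_linear (fun k => φe ε (s k))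
    have hw0 : w ≠ 0 := by
      rintro rfl
      exact hε ⟨s, hs, fun v => by rw [hw]; simp⟩
    have hn : 0 < ‖w‖ := norm_pos_iff.2 hw0
    refine ⟨‖w‖⁻¹ • w, by simp [norm_smul, hn.ne'], ?_⟩
    have : ∀ i, cnt (S i) (fun q => ∑ j, (‖w‖⁻¹ • w) j * φe ε q j) =
        cnt (S i) (fun q => wL (fun k => φe ε (s k)) (φe ε q)) := by
      intro i
      unfold cnt
      congr 1
      apply Finset.filter_congr
      intro q _
      have : ∀ q, ∑ j, (‖w‖⁻¹ • w) j * φe ε q j = ‖w‖⁻¹ * wL (fun k => φe ε (s k)) (φe ε q) := by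
        intro q
        rw [hw, Finset.mul_sum]
        exact Finset.sum_congr rfl fun j _ => by simp [mul_assoc]
      simp only [this]
      have e : ∀ a b : ℝ, ‖w‖⁻¹ * a * (‖w‖⁻¹ * b) = (‖w‖⁻¹ * ‖w‖⁻¹) * (a * b) := fun a b => by ring
      rw [e]
      exact mul_pos_iff_of_pos_left (by positivity)
    simp only [this]
    exact hcnt
  -- sequence of good epsilons
  have hseq : ∃ ε : ℕ → ℝ, Filter.Tendsto ε Filter.atTop (nhds 0) ∧ ∀ n, ε n ∉
      {ε : ℝ | ∃ s ∈ Fintype.piFinset S, ∀ v, wL (fun k => φe ε (s k)) v = 0} := by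
    have : ∀ n : ℕ, ∃ ε ∈ Set.Ioo (0:ℝ) (1 / ((n:ℝ)+1)), ε ∉
        {ε : ℝ | ∃ s ∈ Fintype.piFinset S, ∀ v, wL (fun k => φe ε (s k)) v = 0} := by
      intro n
      have hpos : (0:ℝ) < 1 / ((n:ℝ)+1) := by positivity
      exact ((Set.Ioo_infinite hpos).sdiff hbad2).nonempty
    choose ε h1 h2 using this
    refine ⟨ε, ?_, h2⟩
    exact squeeze_zero (fun n => (h1 n).1.le) (fun n => (h1 n).2.le) tendsto_one_div_add_atTop_nhds_zero_nat
  obtain ⟨ε, hε0, hεg⟩ := hseq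
  choose w hw1 hw2 using fun n => hgood (ε n) (hεg n)
  obtain ⟨w0, hw0, θ, hθ, hlim⟩ := (isCompact_sphere (0 : Fin (N+1) → ℝ) 1).tendsto_subseq hw1
  refine ⟨w0, ?_, ?_⟩
  · rintro rfl
    simp at hw0
  have hlimq : ∀ q, Filter.Tendsto (fun n => ∑ j, w (θ n) j * φe (ε (θ n)) q j) Filter.atTop
      (nhds (∑ j, w0 j * φ q j)) := by
    intro q
    refine tendsto_finsetSum _ fun j _ => ?_
    refine Filter.Tendsto.mul ((tendsto_pi_nhds.1 hlim) j) ?_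
    have h1 : Filter.Tendsto (fun n => ε (θ n)) Filter.atTop (nhds 0) := hε0.comp hθ.tendsto_atTop
    have h2 : Filter.Tendsto (fun n => φ q j + ε (θ n) * ψ q j) Filter.atTop (nhds (φ q j + 0 * ψ q j)) :=
      tendsto_const_nhds.add (h1.mul_const _)
    simpa [φe] using h2
  have hev : ∀ᶠ n in Filter.atTop, ∀ q : ι × ι, 0 < (∑ j, w0 j * φ q.1 j) * (∑ j, w0 j * φ q.2 j) →
      0 < (∑ j, w (θ n) j * φe (ε (θ n)) q.1 j) * (∑ j, w (θ n) j * φe (ε (θ n)) q.2 j) := by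
    rw [Filter.eventually_all]
    intro q
    by_cases hq : 0 < (∑ j, w0 j * φ q.1 j) * (∑ j, w0 j * φ q.2 j)
    · have := ((hlimq q.1).mul (hlimq q.2)).eventually (lt_mem_nhds hq)
      filter_upwards [this] with n hn _ using hn
    · exact Filter.Eventually.of_forall fun n h => absurd h hq
  obtain ⟨n, hn⟩ := hev.exists
  refine le_trans ?_ (hw2 (θ n))
  refine Nat.mul_le_mul_left _ (Finset.sum_le_sum fun i _ => ?_)
  unfold cnt
  apply Finset.card_le_card
  intro q hq
  rw [Finset.mem_filter] at hq ⊢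
  exact ⟨hq.1, hn q hq.2⟩


/-! ### Abstract partitioning -/

def Same {ι 𝓟 : Type} (val : 𝓟 → ι → ℝ) (Ps : List 𝓟) (q q' : ι) : Prop :=
  ∀ P ∈ Ps, 0 < val P q * val P q'

lemma Same.symm {ι 𝓟 : Type} {val : 𝓟 → ι → ℝ} {Ps : List 𝓟} {q q' : ι} (h : Same val Ps q q') :
    Same val Ps q' q := fun P hP => by rw [mul_comm]; exact h P hP

lemma pos_trans {a b c : ℝ} (h : 0 < a * b) (h' : 0 < b * c) : 0 < a * c := by
  have hb : b ≠ 0 := by rintro rfl; simp at h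
  have : 0 < (a * c) * (b * b) := by nlinarith [mul_pos h h']
  exact (pos_iff_pos_of_mul_pos this).2 (mul_self_pos.2 hb)

lemma Same.trans {ι 𝓟 : Type} {val : 𝓟 → ι → ℝ} {Ps : List 𝓟} {q q' q'' : ι} (h : Same val Ps q q')
    (h' : Same val Ps q' q'') : Same val Ps q q'' := fun P hP => pos_trans (h P hP) (h' P hP)

open Classical in
noncomputable def pcl {ι 𝓟 : Type} [Fintype ι] (val : 𝓟 → ι → ℝ) (Ps : List 𝓟) (q : ι) : Finset ι :=
  univ.filter (Same val Ps q)

lemma mem_pcl {ι 𝓟 : Type} [Fintype ι] {val : 𝓟 → ι → ℝ} {Ps : List 𝓟} {q q' : ι} :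
    q' ∈ pcl val Ps q ↔ Same val Ps q q' := by simp [pcl]

open Classical in
noncomputable def heavy {ι 𝓟 : Type} [Fintype ι] (val : 𝓟 → ι → ℝ) (s : ℝ) (Ps : List 𝓟) : Finset ι :=
  univ.filter (fun q => s < ((pcl val Ps q).card : ℝ))

lemma mem_heavy {ι 𝓟 : Type} [Fintype ι] {val : 𝓟 → ι → ℝ} {s : ℝ} {Ps : List 𝓟} {q : ι} :
    q ∈ heavy val s Ps ↔ s < ((pcl val Ps q).card : ℝ) := by simp [heavy]

noncomputable def Psi {ι 𝓟 : Type} [Fintype ι] (val : 𝓟 → ι → ℝ) (s : ℝ) (Ps : List 𝓟) : ℕ :=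
  ∑ q ∈ heavy val s Ps, (pcl val Ps q).card

def HasFeat {ι 𝓟 : Type} (val : 𝓟 → ι → ℝ) (dg : 𝓟 → ℕ) (β C0 : ℝ) : Prop :=
  ∀ N : ℕ, 1 ≤ N → ∃ φ : ι → Fin (N+1) → ℝ, ∀ w : Fin (N+1) → ℝ, w ≠ 0 →
    ∃ P : 𝓟, (∀ q, val P q = ∑ j, w j * φ q j) ∧ (dg P : ℝ) ≤ C0 * (N:ℝ) ^ β

lemma pcl_eq {ι 𝓟 : Type} [Fintype ι] {val : 𝓟 → ι → ℝ} {Ps : List 𝓟} {q q' : ι}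
    (h : Same val Ps q q') : pcl val Ps q' = pcl val Ps q := by
  ext r
  rw [mem_pcl, mem_pcl]
  exact ⟨fun h' => h.trans h', fun h' => h.symm.trans h'⟩

lemma one_round {ι 𝓟 : Type} [Fintype ι] {val : 𝓟 → ι → ℝ} {dg : 𝓟 → ℕ} {β C0 : ℝ} (hβ : 0 < β) (hC0 : 0 ≤ C0)
    (hF : HasFeat val dg β C0) (s : ℝ) (hs : 0 < s) (Ps : List 𝓟) (hpos : 0 < Psi val s Ps) :
    ∃ P, (dg P : ℝ) ≤ C0 * ((Psi val s Ps : ℝ) / s ^ 2) ^ β ∧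
      3 * Psi val s (P :: Ps) ≤ 2 * Psi val s Ps := by
  classical
  let 𝒞 := (heavy val s Ps).image (pcl val Ps)
  let N := 𝒞.card
  have hself : ∀ q ∈ heavy val s Ps, Same val Ps q q := by
    intro q hq
    rw [mem_heavy] at hq
    have : 0 < (pcl val Ps q).card := by
      have : (0:ℝ) < ((pcl val Ps q).card : ℝ) := hs.trans hq
      exact_mod_cast this
    obtain ⟨q', hq'⟩ := Finset.card_pos.1 this
    rw [mem_pcl] at hq'
    exact hq'.trans hq'.symm
  have hfib : ∀ c ∈ 𝒞, (heavy val s Ps).filter (fun q => pcl val Ps q = c) = c := by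
    intro c hc
    obtain ⟨q, hq, rfl⟩ := Finset.mem_image.1 hc
    ext r
    rw [Finset.mem_filter, mem_pcl]
    constructor
    · rintro ⟨hr, hr'⟩
      rw [← mem_pcl, ← hr', mem_pcl]; exact hself r hr
    · intro h
      have := pcl_eq h
      refine ⟨?_, this⟩
      rw [mem_heavy] at hq ⊢
      rwa [this]
  have hmaps : ∀ q ∈ heavy val s Ps, pcl val Ps q ∈ 𝒞 := fun q hq => Finset.mem_image_of_mem _ hq
  have hPsi : Psi val s Ps = ∑ c ∈ 𝒞, c.card ^ 2 := by
    unfold Psi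
    rw [← Finset.sum_fiberwise_of_maps_to hmaps]
    refine Finset.sum_congr rfl fun c hc => ?_
    rw [Finset.sum_congr rfl (fun q hq => by rw [(Finset.mem_filter.1 hq).2])]
    rw [Finset.sum_const, hfib c hc, smul_eq_mul, sq]
  have hlarge : ∀ c ∈ 𝒞, s < (c.card : ℝ) := by
    intro c hc
    obtain ⟨q, hq, rfl⟩ := Finset.mem_image.1 hc
    exact mem_heavy.1 hq
  have hN1 : 1 ≤ N := by
    by_contra h
    have : 𝒞 = ∅ := Finset.card_eq_zero.1 (by omega : 𝒞.card = 0)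
    rw [hPsi, this] at hpos
    simp at hpos
  have hNle : (N : ℝ) ≤ (Psi val s Ps : ℝ) / s ^ 2 := by
    rw [le_div_iff₀ (by positivity), hPsi]
    push_cast
    calc (N : ℝ) * s ^ 2 = ∑ c ∈ 𝒞, s ^ 2 := by simp [N]
      _ ≤ _ := Finset.sum_le_sum fun c hc => by
          have := hlarge c hc
          gcongr
  let e := 𝒞.equivFin
  let S : Fin N → Finset ι := fun i => (e.symm i).1
  have hSmem : ∀ i, S i ∈ 𝒞 := fun i => (e.symm i).2
  obtain ⟨φ, hφ⟩ := hF N hN1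
  obtain ⟨w, hw0, hw⟩ := tournament N φ S (fun i => by
      rw [← Finset.card_pos]
      have : (0:ℝ) < ((S i).card : ℝ) := hs.trans (hlarge _ (hSmem i))
      exact_mod_cast this) (by
      intro i j hij
      rw [Finset.disjoint_left]
      intro r hri hrj
      rw [← hfib _ (hSmem i), Finset.mem_filter] at hri
      rw [← hfib _ (hSmem j), Finset.mem_filter] at hrj
      apply hij
      apply e.symm.injective
      apply Subtype.ext
      exact hri.2.symm.trans hrj.2)
  obtain ⟨P, hP, hdeg⟩ := hφ w hw0
  refine ⟨P, ?_, ?_⟩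
  · refine hdeg.trans ?_
    gcongr
  · have hsumS : ∀ f : Finset ι → ℕ, ∑ i, f (S i) = ∑ c ∈ 𝒞, f c := by
      intro f
      rw [← Finset.sum_coe_sort 𝒞 f]
      exact Equiv.sum_comp e.symm (fun c : 𝒞 => f c.1)
    rw [hsumS (fun c => cnt c _), hsumS (fun c => c.card ^ 2), ← hPsi] at hw
    refine le_trans (Nat.mul_le_mul_left 3 ?_) hw
    have hsubcl : ∀ q, pcl val (P :: Ps) q ⊆ (pcl val Ps q).filter (fun q' => 0 < val P q * val P q') := by
      intro q q' h
      rw [mem_pcl] at h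
      rw [Finset.mem_filter, mem_pcl]
      exact ⟨fun R hR => h R (List.mem_cons_of_mem _ hR), h P List.mem_cons_self⟩
    have hsubh : heavy val s (P :: Ps) ⊆ heavy val s Ps := by
      intro q hq
      rw [mem_heavy] at hq ⊢
      refine hq.trans_le ?_
      exact_mod_cast Finset.card_le_card ((hsubcl q).trans (Finset.filter_subset _ _))
    calc Psi val s (P :: Ps) ≤ ∑ q ∈ heavy val s Ps, ((pcl val Ps q).filter (fun q' => 0 < val P q * val P q')).card := by
          refine (Finset.sum_le_sum fun q _ => Finset.card_le_card (hsubcl q)).trans ?_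
          exact Finset.sum_le_sum_of_subset hsubh
      _ = ∑ c ∈ 𝒞, cnt c (fun q => ∑ j, w j * φ q j) := by
          rw [← Finset.sum_fiberwise_of_maps_to hmaps]
          refine Finset.sum_congr rfl fun c hc => ?_
          rw [Finset.sum_congr rfl (fun q hq => by rw [(Finset.mem_filter.1 hq).2]), hfib c hc]
          unfold cnt
          rw [Finset.card_filter, Finset.sum_product]
          refine Finset.sum_congr rfl fun q _ => ?_
          rw [Finset.card_filter]
          simp only [hP]

lemma inner_rounds {ι 𝓟 : Type} [Fintype ι] {val : 𝓟 → ι → ℝ} {dg : 𝓟 → ℕ} {β C0 : ℝ} (hβ : 0 < β) (hC0 : 0 ≤ C0)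
    (hF : HasFeat val dg β C0) (s : ℝ) (hs : 0 < s) (n : ℕ) : ∀ (Ps : List 𝓟) (y : ℝ),
      Psi val s Ps ≤ n → (Psi val s Ps : ℝ) ≤ y * s ^ 2 →
    ∃ Qs : List 𝓟, Psi val s (Qs ++ Ps) = 0 ∧
      (((Qs.map dg).sum : ℕ) : ℝ) ≤ C0 / (1 - (2/3 : ℝ) ^ β) * y ^ β := by
  have h23 : (2/3 : ℝ) ^ β < 1 := Real.rpow_lt_one (by norm_num) (by norm_num) hβ
  induction n using Nat.strong_induction_on with
  | _ n ih =>
    intro Ps y hn hy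
    have hy0 : 0 ≤ y := by
      by_contra h
      push Not at h
      have : y * s ^ 2 < 0 := mul_neg_of_neg_of_pos h (by positivity)
      have h2 : (0:ℝ) ≤ Psi val s Ps := Nat.cast_nonneg _
      linarith
    rcases Nat.eq_zero_or_pos (Psi val s Ps) with h0 | hpos
    · refine ⟨[], by simpa using h0, ?_⟩
      simp
      have : 0 < 1 - (2/3:ℝ) ^ β := by linarith
      positivity
    · obtain ⟨P, hP1, hP2⟩ := one_round hβ hC0 hF s hs Ps hpos
      obtain ⟨Qs, h1, h2⟩ := ih (Psi val s (P :: Ps)) (by omega) (P :: Ps) (2/3 * y) le_rfl (by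
        have : (3:ℝ) * Psi val s (P :: Ps) ≤ 2 * Psi val s Ps := by exact_mod_cast hP2
        nlinarith)
      refine ⟨Qs ++ [P], by simpa using h1, ?_⟩
      have h3 : (dg P : ℝ) ≤ C0 * y ^ β := by
        refine hP1.trans ?_
        gcongr
        rwa [div_le_iff₀ (by positivity)]
      rw [Real.mul_rpow (by norm_num) hy0] at h2
      simp only [List.map_append, List.map_cons, List.map_nil, List.sum_append, List.sum_cons, List.sum_nil, Nat.cast_add, Nat.cast_zero]
      have hpos1 : 0 < 1 - (2/3:ℝ) ^ β := by linarith
      have : C0 / (1 - (2/3:ℝ) ^ β) * ((2/3:ℝ) ^ β * y ^ β) + C0 * y ^ β = C0 / (1 - (2/3:ℝ) ^ β) * y ^ β := by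
        field_simp
        ring
      linarith

lemma outer_rounds {ι 𝓟 : Type} [Fintype ι] [Nonempty ι] {val : 𝓟 → ι → ℝ} {dg : 𝓟 → ℕ} {β C0 : ℝ} (hβ : 0 < β) (hC0 : 0 ≤ C0)
    (hF : HasFeat val dg β C0) (J : ℕ) : ∃ Ps : List 𝓟,
      (∀ q, ((pcl val Ps q).card : ℝ) ≤ (Fintype.card ι : ℝ) / 2 ^ J) ∧
      (((Ps.map dg).sum : ℕ) : ℝ) ≤ C0 / (1 - (2/3 : ℝ) ^ β) * (4 : ℝ) ^ β / ((2:ℝ) ^ β - 1) * ((2:ℝ) ^ J) ^ β := by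
  have h23 : (2/3 : ℝ) ^ β < 1 := Real.rpow_lt_one (by norm_num) (by norm_num) hβ
  have h2 : 1 < (2:ℝ) ^ β := Real.one_lt_rpow (by norm_num) hβ
  have hn : (0:ℝ) < Fintype.card ι := by exact_mod_cast Fintype.card_pos
  have hA : 0 ≤ C0 / (1 - (2/3 : ℝ) ^ β) := div_nonneg hC0 (by linarith)
  have hB : 0 < (2:ℝ) ^ β - 1 := by linarith
  induction J with
  | zero =>
    refine ⟨[], ?_, ?_⟩
    · intro q
      simp
      exact Finset.card_le_univ _
    · simp
      positivity
  | succ J ih =>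
    obtain ⟨Ps, h1, h3⟩ := ih
    set s : ℝ := (Fintype.card ι : ℝ) / 2 ^ (J+1) with hs
    have hspos : 0 < s := by positivity
    have hs2 : (Fintype.card ι : ℝ) / 2 ^ J = 2 * s := by rw [hs, pow_succ]; field_simp
    obtain ⟨Qs, hQ1, hQ2⟩ := inner_rounds hβ hC0 hF s hspos _ Ps (4 * 2 ^ J) le_rfl (by
      unfold Psi
      push_cast
      calc ∑ q ∈ heavy val s Ps, ((pcl val Ps q).card : ℝ) ≤ ∑ q ∈ heavy val s Ps, 2 * s :=
            Finset.sum_le_sum fun q _ => by rw [← hs2]; exact h1 q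
        _ = (heavy val s Ps).card * (2 * s) := by simp
        _ ≤ Fintype.card ι * (2 * s) := by
            gcongr
            exact Finset.card_le_univ _
        _ = 4 * 2 ^ J * s ^ 2 := by
            have : (Fintype.card ι : ℝ) = 2 ^ J * (2 * s) := by rw [← hs2]; field_simp
            rw [this]; ring)
    refine ⟨Qs ++ Ps, ?_, ?_⟩
    · intro q
      by_contra hq
      push Not at hq
      have hmem : q ∈ heavy val s (Qs ++ Ps) := mem_heavy.2 hq
      have : (pcl val (Qs ++ Ps) q).card ≤ 0 := by
        rw [← hQ1]
        exact Finset.single_le_sum (f := fun q => (pcl val (Qs ++ Ps) q).card) (fun _ _ => Nat.zero_le _) hmem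
      have h0 : (pcl val (Qs ++ Ps) q).card = 0 := by omega
      rw [h0] at hq
      simp at hq
      linarith
    · simp only [List.map_append, List.sum_append, Nat.cast_add]
      rw [Real.mul_rpow (by norm_num) (by positivity)] at hQ2
      have : ((2:ℝ) ^ (J+1)) ^ β = (2:ℝ) ^ β * ((2:ℝ) ^ J) ^ β := by
        rw [pow_succ, mul_comm, Real.mul_rpow (by norm_num) (by positivity)]
      rw [this]
      have e : C0 / (1 - (2/3 : ℝ) ^ β) * (4 : ℝ) ^ β / ((2:ℝ) ^ β - 1) * ((2:ℝ) ^ β * ((2:ℝ) ^ J) ^ β)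
        = C0 / (1 - (2/3 : ℝ) ^ β) * (4 : ℝ) ^ β / ((2:ℝ) ^ β - 1) * ((2:ℝ) ^ J) ^ β +
          C0 / (1 - (2/3 : ℝ) ^ β) * ((4 : ℝ) ^ β * ((2:ℝ) ^ J) ^ β) := by
        field_simp
        ring
      rw [e]
      linarith

theorem partition (β C0 : ℝ) (hβ : 0 < β) (hC0 : 0 ≤ C0) : ∃ C : ℝ, 0 < C ∧
    ∀ {ι 𝓟 : Type} [Fintype ι] (val : 𝓟 → ι → ℝ) (dg : 𝓟 → ℕ), HasFeat val dg β C0 →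
    ∀ T : ℝ, 1 ≤ T → ∃ Ps : List 𝓟,
      (∀ q, ((pcl val Ps q).card : ℝ) ≤ (Fintype.card ι : ℝ) / T) ∧
      (((Ps.map dg).sum : ℕ) : ℝ) ≤ C * T ^ β := by
  have h23 : (2/3 : ℝ) ^ β < 1 := Real.rpow_lt_one (by norm_num) (by norm_num) hβ
  have h2 : 1 < (2:ℝ) ^ β := Real.one_lt_rpow (by norm_num) hβ
  have hA : 0 ≤ C0 / (1 - (2/3 : ℝ) ^ β) := div_nonneg hC0 (by linarith)
  have hB : 0 < (2:ℝ) ^ β - 1 := by linarith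
  refine ⟨C0 / (1 - (2/3 : ℝ) ^ β) * (4 : ℝ) ^ β / ((2:ℝ) ^ β - 1) * 2 ^ β + 1, by positivity, ?_⟩
  intro ι 𝓟 _ val dg hF T hT
  rcases isEmpty_or_nonempty ι with he | hne
  · refine ⟨[], fun q => (he.false q).elim, ?_⟩
    simp
    positivity
  obtain ⟨J, hJ1, hJ2⟩ := exists_nat_pow_near (x := T) (y := 2) hT (by norm_num)
  obtain ⟨Ps, h1, h3⟩ := outer_rounds hβ hC0 hF (J+1)
  refine ⟨Ps, ?_, ?_⟩
  · intro q
    refine (h1 q).trans ?_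
    gcongr
  · refine h3.trans ?_
    have : ((2:ℝ) ^ (J+1)) ^ β ≤ 2 ^ β * T ^ β := by
      rw [pow_succ, mul_comm, Real.mul_rpow (by norm_num) (by positivity)]
      gcongr
    have hT0 : 0 ≤ T ^ β := by positivity
    calc _ ≤ C0 / (1 - (2/3 : ℝ) ^ β) * (4 : ℝ) ^ β / ((2:ℝ) ^ β - 1) * (2 ^ β * T ^ β) := by
          gcongr
      _ ≤ _ := by nlinarith

/-! ### Concrete feature systems -/

lemma exists_side (k : ℕ) (hk : 1 ≤ k) (N : ℕ) (hN : 1 ≤ N) : ∃ e : ℕ, 1 ≤ e ∧ N + 1 ≤ e ^ k ∧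
    (e : ℝ) ≤ 3 * (N:ℝ) ^ ((1:ℝ) / k) := by
  have hk0 : (0:ℝ) < k := by exact_mod_cast hk
  have hk1 : (1:ℝ) ≤ k := by exact_mod_cast hk
  have hb1 : (1:ℝ)/k ≤ 1 := by rw [div_le_one hk0]; exact hk1
  have hN' : (1:ℝ) ≤ N := by exact_mod_cast hN
  have h1N : (1:ℝ) ≤ (N:ℝ) ^ ((1:ℝ)/k) := Real.one_le_rpow hN' (by positivity)
  refine ⟨⌈((N:ℝ)+1) ^ ((1:ℝ)/k)⌉₊, ?_, ?_, ?_⟩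
  · rw [Nat.one_le_ceil_iff]; positivity
  · have h1 : ((N:ℝ)+1) ^ ((1:ℝ)/k) ≤ (⌈((N:ℝ)+1) ^ ((1:ℝ)/k)⌉₊ : ℝ) := Nat.le_ceil _
    have h2 : (((N:ℝ)+1) ^ ((1:ℝ)/k)) ^ k ≤ (⌈((N:ℝ)+1) ^ ((1:ℝ)/k)⌉₊ : ℝ) ^ k := by gcongr
    rw [one_div, Real.rpow_inv_natCast_pow (by positivity) (by omega), ← one_div] at h2
    exact_mod_cast h2
  · have h1 := (Nat.ceil_lt_add_one (a := ((N:ℝ)+1) ^ ((1:ℝ)/k)) (by positivity)).le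
    refine h1.trans ?_
    have h2 : ((N:ℝ)+1) ^ ((1:ℝ)/k) ≤ (2 * (N:ℝ)) ^ ((1:ℝ)/k) := by gcongr; linarith
    rw [Real.mul_rpow (by norm_num) (by positivity)] at h2
    have h3 : (2:ℝ) ^ ((1:ℝ)/k) ≤ 2 ^ (1:ℝ) := Real.rpow_le_rpow_of_exponent_le (by norm_num) hb1
    rw [Real.rpow_one] at h3
    nlinarith

noncomputable def mexp (i j : ℕ) : Fin 2 →₀ ℕ := Finsupp.single 0 i + Finsupp.single 1 j

lemma mexp_inj {i j i' j' : ℕ} (h : mexp i j = mexp i' j') : i = i' ∧ j = j' := by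
  have h0 := DFunLike.congr_fun h 0
  have h1 := DFunLike.congr_fun h 1
  simpa [mexp] using And.intro h0 h1

lemma ev_mono (i j : ℕ) (a : ℝ) (p : ℝ × ℝ) :
    ev (MvPolynomial.monomial (mexp i j) a) p = a * (p.1 ^ i * p.2 ^ j) := by
  simp [ev, mexp, MvPolynomial.eval_monomial, Finsupp.prod_fintype, Fin.prod_univ_two]

lemma deg_mono (i j : ℕ) (a : ℝ) : (MvPolynomial.monomial (mexp i j) a).totalDegree ≤ i + j := by
  refine (MvPolynomial.totalDegree_monomial_le _ _).trans ?_
  rw [Finsupp.sum_fintype _ _ (by simp)]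
  simp [mexp, Fin.sum_univ_two]

abbrev Poly2 := {P : MP2 // P ≠ 0}

lemma hasFeat2 {ι : Type} (pt : ι → ℝ × ℝ) :
    HasFeat (𝓟 := Poly2) (fun P q => ev P.1 (pt q)) (fun P => P.1.totalDegree) (1/2) 6 := by
  classical
  intro N hN
  obtain ⟨e, he1, he2, he3⟩ := exists_side 2 (by norm_num) N hN
  refine ⟨fun q j => (pt q).1 ^ (j.1 / e) * (pt q).2 ^ (j.1 % e), fun w hw => ?_⟩
  let P : MP2 := ∑ j : Fin (N+1), MvPolynomial.monomial (mexp (j.1 / e) (j.1 % e)) (w j)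
  have hP : P ≠ 0 := by
    intro h
    apply hw
    funext j
    have := congrArg (MvPolynomial.coeff (mexp (j.1 / e) (j.1 % e))) h
    simp only [P, MvPolynomial.coeff_sum, MvPolynomial.coeff_zero] at this
    rw [Finset.sum_eq_single j] at this
    · simpa using this
    · intro i _ hij
      rw [MvPolynomial.coeff_monomial, if_neg]
      intro h'
      obtain ⟨h1, h2⟩ := mexp_inj h'
      apply hij
      apply Fin.ext
      rw [← Nat.div_add_mod i.1 e, ← Nat.div_add_mod j.1 e, h1, h2]
    · simp
  refine ⟨⟨P, hP⟩, ?_, ?_⟩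
  · intro q
    simp only [P, ev_sum, ev_mono]
  · have hd : P.totalDegree ≤ 2 * e := by
      refine MvPolynomial.totalDegree_finsetSum_le fun j _ => ?_
      refine (deg_mono _ _ _).trans ?_
      have h1 : j.1 / e < e := by
        rw [Nat.div_lt_iff_lt_mul (by omega)]
        have := j.2
        nlinarith
      have h2 : j.1 % e < e := Nat.mod_lt _ (by omega)
      omega
    have hd' : (P.totalDegree : ℝ) ≤ 2 * e := by exact_mod_cast hd
    simp only [Nat.cast_ofNat] at he3
    linarith

structure Poly3 where
  P : Polynomial MP2
  e : ℕ
  ne : P ≠ 0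
  nd : P.natDegree ≤ e
  cd : ∀ k, (P.coeff k).totalDegree ≤ e

noncomputable def ev3 (P : Polynomial MP2) (p : ℝ × ℝ) (z : ℝ) : ℝ :=
  (P.map (MvPolynomial.eval ![p.1, p.2])).eval z

lemma ev3_add (P Q : Polynomial MP2) (p z) : ev3 (P + Q) p z = ev3 P p z + ev3 Q p z := by simp [ev3]
lemma ev3_mul (P Q : Polynomial MP2) (p z) : ev3 (P * Q) p z = ev3 P p z * ev3 Q p z := by simp [ev3]
lemma ev3_sum {ι : Type*} (s : Finset ι) (F : ι → Polynomial MP2) (p z) :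
    ev3 (∑ i ∈ s, F i) p z = ∑ i ∈ s, ev3 (F i) p z := by
  simp [ev3, Polynomial.eval_finsetSum, Polynomial.map_sum]
lemma ev3_monomial (k : ℕ) (F : MP2) (p z) : ev3 (Polynomial.monomial k F) p z = ev F p * z ^ k := by
  simp [ev3, ev]

lemma hasFeat3 {ι : Type} (pt : ι → ℝ × ℝ) (zt : ι → ℝ) :
    HasFeat (𝓟 := Poly3) (fun P q => ev3 P.P (pt q) (zt q)) (fun P => P.e) (1/3) 6 := by
  classical
  intro N hN
  obtain ⟨e, he1, he2, he3⟩ := exists_side 3 (by norm_num) N hN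
  refine ⟨fun q j => (pt q).1 ^ (j.1 / e / e) * (pt q).2 ^ (j.1 / e % e) * (zt q) ^ (j.1 % e), fun w hw => ?_⟩
  let P : Polynomial MP2 := ∑ j : Fin (N+1), Polynomial.monomial (j.1 % e)
    (MvPolynomial.monomial (mexp (j.1 / e / e) (j.1 / e % e)) (w j))
  have hP : P ≠ 0 := by
    intro h
    apply hw
    funext j
    have := congrArg (fun Q : Polynomial MP2 => MvPolynomial.coeff (mexp (j.1 / e / e) (j.1 / e % e)) (Q.coeff (j.1 % e))) h
    simp only [P, Polynomial.finsetSum_coeff, MvPolynomial.coeff_sum, Polynomial.coeff_zero, MvPolynomial.coeff_zero] at this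
    rw [Finset.sum_eq_single j] at this
    · simpa using this
    · intro i _ hij
      rw [Polynomial.coeff_monomial]
      by_cases h3 : i.1 % e = j.1 % e
      · rw [if_pos h3, MvPolynomial.coeff_monomial, if_neg]
        intro h'
        obtain ⟨h1, h2⟩ := mexp_inj h'
        apply hij
        apply Fin.ext
        rw [← Nat.div_add_mod i.1 e, ← Nat.div_add_mod j.1 e, ← Nat.div_add_mod (i.1/e) e, ← Nat.div_add_mod (j.1/e) e, h1, h2, h3]
      · rw [if_neg h3]; simp
    · simp
  have hb : ∀ j : Fin (N+1), j.1 / e / e < e := by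
    intro j
    rw [Nat.div_lt_iff_lt_mul (by omega), Nat.div_lt_iff_lt_mul (by omega)]
    have := j.2
    have h3 : e ^ 3 = e * e * e := by ring
    omega
  have hm : ∀ j : ℕ, j % e < e := fun j => Nat.mod_lt _ (by omega)
  refine ⟨⟨P, 2 * e, hP, ?_, ?_⟩, ?_, ?_⟩
  · refine Polynomial.natDegree_sum_le_of_forall_le _ _ fun j _ => ?_
    refine (Polynomial.natDegree_monomial_le _).trans ?_
    have := hm j.1
    omega
  · intro k
    simp only [P, Polynomial.finsetSum_coeff]
    refine MvPolynomial.totalDegree_finsetSum_le fun j _ => ?_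
    rw [Polynomial.coeff_monomial]
    split_ifs
    · refine (deg_mono _ _ _).trans ?_
      have := hb j
      have := hm (j.1/e)
      omega
    · simp
  · intro q
    simp only [P, ev3_sum, ev3_monomial, ev_mono]
    refine Finset.sum_congr rfl fun j _ => by ring
  · simp only [Nat.cast_mul, Nat.cast_ofNat] at he3 ⊢
    linarith


/-! ### Arcs of separable curves -/

noncomputable def win (a : ℝ[X]) (x : ℝ) : ℕ := (a.derivative.roots.toFinset.filter (fun r => r < x)).card

lemma win_le (a : ℝ[X]) (x : ℝ) (d : ℕ) (hd : a.natDegree ≤ d) (hd1 : 1 ≤ d) : win a x < d := by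
  have h1 : win a x ≤ a.derivative.roots.toFinset.card := Finset.card_le_card (Finset.filter_subset _ _)
  have h2 := Multiset.toFinset_card_le a.derivative.roots
  have h3 := Polynomial.card_roots' a.derivative
  have h4 := Polynomial.natDegree_derivative_le a
  omega

lemma win_mono (a : ℝ[X]) {x y : ℝ} (h : x ≤ y) : win a x ≤ win a y := by
  apply Finset.card_le_card
  intro r hr
  rw [Finset.mem_filter] at hr ⊢
  exact ⟨hr.1, hr.2.trans_le h⟩

lemma win_no_root (a : ℝ[X]) {x y : ℝ} (hx : a.derivative.eval x ≠ 0) (hy : a.derivative.eval y ≠ 0)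
    (hw : win a x = win a y) : ∀ r ∈ Set.uIcc x y, a.derivative.eval r ≠ 0 := by
  wlog hxy : x ≤ y generalizing x y
  · rw [Set.uIcc_comm]; exact this hy hx hw.symm (le_of_not_ge hxy)
  intro r hr h0
  rw [Set.uIcc_of_le hxy] at hr
  have hne : a.derivative ≠ 0 := by intro h; rw [h] at hx; simp at hx
  have hrx : x < r := lt_of_le_of_ne hr.1 (by rintro rfl; exact hx h0)
  have hry : r < y := lt_of_le_of_ne hr.2 (by rintro rfl; exact hy h0)
  have : win a x < win a y := by
    apply Finset.card_lt_card
    rw [Finset.ssubset_iff_of_subset]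
    · refine ⟨r, ?_, ?_⟩
      · simp [hne, h0, hry]
      · simp [hrx.le]
    · intro s hs
      rw [Finset.mem_filter] at hs ⊢
      exact ⟨hs.1, hs.2.trans_le hxy⟩
  omega

lemma win_const (a : ℝ[X]) {x y z : ℝ} (hx : a.derivative.eval x ≠ 0) (hy : a.derivative.eval y ≠ 0)
    (hw : win a x = win a y) (hz : z ∈ Set.uIcc x y) : win a z = win a x := by
  rcases le_total x y with h | h
  · rw [Set.uIcc_of_le h] at hz
    have := win_mono a hz.1; have := win_mono a hz.2; omega
  · rw [Set.uIcc_of_ge h] at hz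
    have := win_mono a hz.1; have := win_mono a hz.2; omega

lemma injOn_of_deriv (a : ℝ[X]) {x y : ℝ} (h : ∀ r ∈ Set.uIcc x y, a.derivative.eval r ≠ 0) :
    Set.InjOn (fun t => a.eval t) (Set.uIcc x y) := by
  intro s hs t ht hst
  by_contra hne
  wlog hlt : s < t generalizing s t
  · exact this ht hs hst.symm (Ne.symm hne) (lt_of_le_of_ne (le_of_not_gt hlt) (Ne.symm hne))
  obtain ⟨c, hc, hc0⟩ := exists_hasDerivAt_eq_zero hlt (a.continuousOn) hst
    (fun u _ => a.hasDerivAt u)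
  have : c ∈ Set.uIcc x y := by
    have := Set.uIcc_subset_uIcc hs ht
    rw [Set.uIcc_of_le hlt.le] at this
    exact this ⟨hc.1.le, hc.2.le⟩
  exact h c this hc0

lemma lower_lip (b : ℝ[X]) {y0 y1 : ℝ} (h : ∀ r ∈ Set.uIcc y0 y1, b.derivative.eval r ≠ 0) :
    ∃ κ > 0, ∀ s ∈ Set.uIcc y0 y1, ∀ t ∈ Set.uIcc y0 y1, κ * |s - t| ≤ |b.eval s - b.eval t| := by
  obtain ⟨m, hm, hmin⟩ := (isCompact_uIcc (a := y0) (b := y1)).exists_isMinOn Set.nonempty_uIcc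
    (f := fun r => |b.derivative.eval r|) (b.derivative.continuous.abs.continuousOn)
  refine ⟨|b.derivative.eval m|, abs_pos.2 (h m hm), ?_⟩
  intro s hs t ht
  wlog hlt : s < t generalizing s t
  · rcases eq_or_lt_of_le (le_of_not_gt hlt) with h' | h'
    · simp [h']
    · rw [abs_sub_comm, abs_sub_comm (b.eval s)]; exact this t ht s hs h'
  obtain ⟨c, hc, hc0⟩ := exists_hasDerivAt_eq_slope _ _ hlt (b.continuousOn)
    (fun u _ => b.hasDerivAt u)
  have hcm : c ∈ Set.uIcc y0 y1 := by
    have := Set.uIcc_subset_uIcc hs ht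
    rw [Set.uIcc_of_le hlt.le] at this
    exact this ⟨hc.1.le, hc.2.le⟩
  have h1 : |b.derivative.eval m| ≤ |b.derivative.eval c| := hmin hcm
  have h2 : b.eval s - b.eval t = b.derivative.eval c * (s - t) := by
    have : t - s ≠ 0 := sub_ne_zero.2 hlt.ne'
    field_simp at hc0
    linarith
  rw [h2, abs_mul]
  gcongr

lemma arc_exists (a b : ℝ[X]) {x0 x1 y0 y1 : ℝ} (hx : x0 < x1)
    (ha : ∀ r ∈ Set.Icc x0 x1, a.derivative.eval r ≠ 0)
    (hb : ∀ r ∈ Set.uIcc y0 y1, b.derivative.eval r ≠ 0)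
    (h0 : a.eval x0 = b.eval y0) (h1 : a.eval x1 = b.eval y1) :
    ∃ Y : ℝ → ℝ, Y x0 = y0 ∧ Y x1 = y1 ∧ ContinuousOn Y (Set.Icc x0 x1) ∧
      (∀ x ∈ Set.Icc x0 x1, Y x ∈ Set.uIcc y0 y1 ∧ a.eval x = b.eval (Y x)) ∧
      (∀ x ∈ Set.Ioo x0 x1, HasDerivAt Y (a.derivative.eval x / b.derivative.eval (Y x)) x) := by
  classical
  have hainj := injOn_of_deriv a (x := x0) (y := x1) (by rwa [Set.uIcc_of_le hx.le])
  have hbinj := injOn_of_deriv b hb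
  rw [Set.uIcc_of_le hx.le] at hainj
  have hmem : ∀ x ∈ Set.Icc x0 x1, a.eval x ∈ Set.uIcc (a.eval x0) (a.eval x1) := by
    intro x hx'
    rcases (a.continuousOn (s := Set.Icc x0 x1)).strictMonoOn_of_injOn_Icc' hx.le hainj with hm | hm
    · have e1 := hm.monotoneOn (Set.left_mem_Icc.2 hx.le) hx' hx'.1
      have e2 := hm.monotoneOn hx' (Set.right_mem_Icc.2 hx.le) hx'.2
      exact Set.mem_uIcc.2 (Or.inl ⟨e1, e2⟩)
    · have e1 := hm.antitoneOn (Set.left_mem_Icc.2 hx.le) hx' hx'.1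
      have e2 := hm.antitoneOn hx' (Set.right_mem_Icc.2 hx.le) hx'.2
      exact Set.mem_uIcc.2 (Or.inr ⟨e2, e1⟩)
  have hex : ∀ x, ∃ y, x ∈ Set.Icc x0 x1 → y ∈ Set.uIcc y0 y1 ∧ a.eval x = b.eval y := by
    intro x
    by_cases hx' : x ∈ Set.Icc x0 x1
    · have := hmem x hx'
      rw [h0, h1] at this
      obtain ⟨y, hy, hy'⟩ := intermediate_value_uIcc (b.continuousOn (s := Set.uIcc y0 y1)) this
      exact ⟨y, fun _ => ⟨hy, hy'.symm⟩⟩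
    · exact ⟨0, fun h => absurd h hx'⟩
  choose Y hY using hex
  have hcont : ContinuousOn Y (Set.Icc x0 x1) := by
    obtain ⟨κ, hκ, hlip⟩ := lower_lip b hb
    intro x hx'
    rw [ContinuousWithinAt, tendsto_iff_dist_tendsto_zero]
    have hlim : Filter.Tendsto (fun t => κ⁻¹ * |a.eval t - a.eval x|) (nhdsWithin x (Set.Icc x0 x1)) (nhds 0) := by
      have : Filter.Tendsto (fun t => κ⁻¹ * |a.eval t - a.eval x|) (nhds x) (nhds (κ⁻¹ * |a.eval x - a.eval x|)) := by
        have hc : Continuous (fun t => κ⁻¹ * |a.eval t - a.eval x|) := by fun_prop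
        exact hc.tendsto x
      simp only [sub_self, abs_zero, mul_zero] at this
      exact this.mono_left nhdsWithin_le_nhds
    refine squeeze_zero' (Filter.Eventually.of_forall fun t => dist_nonneg) ?_ hlim
    filter_upwards [self_mem_nhdsWithin] with t ht
    have e := hlip (Y t) (hY t ht).1 (Y x) (hY x hx').1
    rw [← (hY t ht).2, ← (hY x hx').2] at e
    rw [Real.dist_eq, ← div_eq_inv_mul, le_div_iff₀ hκ]
    linarith
  refine ⟨Y, ?_, ?_, hcont, fun x hx' => hY x hx', ?_⟩
  · have := hY x0 (Set.left_mem_Icc.2 hx.le)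
    exact hbinj this.1 Set.left_mem_uIcc (by simp only; rw [← this.2, h0])
  · have := hY x1 (Set.right_mem_Icc.2 hx.le)
    exact hbinj this.1 Set.right_mem_uIcc (by simp only; rw [← this.2, h1])
  · intro x hx'
    have hxI : x ∈ Set.Icc x0 x1 := ⟨hx'.1.le, hx'.2.le⟩
    have hcx : ContinuousAt Y x := hcont.continuousAt (Icc_mem_nhds hx'.1 hx'.2)
    have hb0 : b.derivative.eval (Y x) ≠ 0 := hb _ (hY x hxI).1
    -- slopes
    rw [hasDerivAt_iff_tendsto_slope]
    have hsb := (hasDerivAt_iff_tendsto_slope.1 (b.hasDerivAt (Y x)))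
    have hsa := (hasDerivAt_iff_tendsto_slope.1 (a.hasDerivAt x))
    have hYne : ∀ᶠ t in nhdsWithin x {x}ᶜ, Y t ≠ Y x := by
      have h1 : ∀ᶠ t in nhdsWithin x {x}ᶜ, t ∈ Set.Icc x0 x1 :=
        nhdsWithin_le_nhds (Icc_mem_nhds hx'.1 hx'.2)
      filter_upwards [h1, self_mem_nhdsWithin] with t ht htx hYt
      apply htx
      apply hainj ht hxI
      simp only
      rw [(hY t ht).2, (hY x hxI).2, hYt]
    have hYt : Filter.Tendsto Y (nhdsWithin x {x}ᶜ) (nhdsWithin (Y x) {Y x}ᶜ) := by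
      rw [tendsto_nhdsWithin_iff]
      exact ⟨hcx.tendsto.mono_left nhdsWithin_le_nhds, hYne⟩
    have := hsa.div (hsb.comp hYt) hb0
    refine this.congr' ?_
    have h1 : ∀ᶠ t in nhdsWithin x {x}ᶜ, t ∈ Set.Icc x0 x1 :=
        nhdsWithin_le_nhds (Icc_mem_nhds hx'.1 hx'.2)
    filter_upwards [h1, hYne, self_mem_nhdsWithin] with t ht htY htx
    have htx' : t - x ≠ 0 := sub_ne_zero.2 htx
    have hbn : b.eval (Y t) - b.eval (Y x) ≠ 0 := by
      rw [← (hY t ht).2, ← (hY x hxI).2, sub_ne_zero]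
      intro h; exact htx (hainj ht hxI h)
    have hYn : Y t - Y x ≠ 0 := sub_ne_zero.2 htY
    simp only [Pi.div_apply, Function.comp, slope_def_field]
    rw [(hY t ht).2, (hY x hxI).2]
    field_simp

/-- Regularity data for points of the curve `a(x) = b(y)`. -/
def RegAB (a b : ℝ[X]) (p : ℝ × ℝ) : Prop :=
  a.eval p.1 = b.eval p.2 ∧ a.derivative.eval p.1 ≠ 0 ∧ b.derivative.eval p.2 ≠ 0

noncomputable def arcAB (a b : ℝ[X]) (p : ℝ × ℝ) : ℕ × ℕ := (win a p.1, win b p.2)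

lemma arc_unique {a b : ℝ[X]} {p q : ℝ × ℝ} (hp : RegAB a b p) (hq : RegAB a b q)
    (h : arcAB a b p = arcAB a b q) (hx : p.1 = q.1) : p = q := by
  have hw : win b p.2 = win b q.2 := congrArg Prod.snd h
  have := injOn_of_deriv b (win_no_root b hp.2.2 hq.2.2 hw)
  refine Prod.ext hx (this Set.left_mem_uIcc Set.right_mem_uIcc ?_)
  simp only
  rw [← hp.1, ← hq.1, hx]

/-- An arc between two points of the same window. -/
lemma arc_between {a b : ℝ[X]} {p q : ℝ × ℝ} (hp : RegAB a b p) (hq : RegAB a b q)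
    (h : arcAB a b p = arcAB a b q) (hx : p.1 < q.1) :
    ∃ Y : ℝ → ℝ, Y p.1 = p.2 ∧ Y q.1 = q.2 ∧ ContinuousOn Y (Set.Icc p.1 q.1) ∧
      (∀ x ∈ Set.Icc p.1 q.1, RegAB a b (x, Y x) ∧ arcAB a b (x, Y x) = arcAB a b p) ∧
      (∀ x ∈ Set.Ioo p.1 q.1, HasDerivAt Y (a.derivative.eval x / b.derivative.eval (Y x)) x) := by
  have hw1 : win a p.1 = win a q.1 := congrArg Prod.fst h
  have hw2 : win b p.2 = win b q.2 := congrArg Prod.snd h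
  have hA := win_no_root a hp.2.1 hq.2.1 hw1
  have hB := win_no_root b hp.2.2 hq.2.2 hw2
  rw [Set.uIcc_of_le hx.le] at hA
  obtain ⟨Y, h0, h1, hc, hY, hd⟩ := arc_exists a b hx hA hB hp.1 hq.1
  refine ⟨Y, h0, h1, hc, ?_, hd⟩
  intro x hx'
  refine ⟨⟨(hY x hx').2, hA x hx', hB _ (hY x hx').1⟩, ?_⟩
  have e1 := win_const a hp.2.1 hq.2.1 hw1 (z := x) (by rwa [Set.uIcc_of_le hx.le])
  have e2 := win_const b hp.2.2 hq.2.2 hw2 (hY x hx').1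
  simp [arcAB, e1, e2]

lemma ev_continuous (F : MP2) : Continuous (ev F) := by
  have h : ev F = (fun v : Fin 2 → ℝ => MvPolynomial.eval v F) ∘ (fun p : ℝ × ℝ => ![p.1, p.2]) := rfl
  rw [h]
  refine (MvPolynomial.continuous_eval F).comp ?_
  refine continuous_pi fun i => ?_
  fin_cases i
  · exact continuous_fst
  · exact continuous_snd

/-- sign change along an arc produces a zero strictly between -/
lemma arc_zero {a b : ℝ[X]} {p q : ℝ × ℝ} (hp : RegAB a b p) (hq : RegAB a b q)
    (h : arcAB a b p = arcAB a b q) (hx : p.1 < q.1) (F : MP2) (hF : ev F p * ev F q < 0) :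
    ∃ r : ℝ × ℝ, RegAB a b r ∧ arcAB a b r = arcAB a b p ∧ p.1 < r.1 ∧ r.1 < q.1 ∧ ev F r = 0 := by
  obtain ⟨Y, h0, h1, hc, hY, _⟩ := arc_between hp hq h hx
  let f : ℝ → ℝ := fun x => ev F (x, Y x)
  have hf : ContinuousOn f (Set.Icc p.1 q.1) :=
    (ev_continuous F).comp_continuousOn (continuousOn_id.prodMk hc)
  have hfp : f p.1 = ev F p := by simp [f, h0]
  have hfq : f q.1 = ev F q := by simp [f, h1]
  have hmem : (0:ℝ) ∈ Set.uIcc (f p.1) (f q.1) := by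
    rw [hfp, hfq, Set.mem_uIcc]
    rcases mul_neg_iff.1 hF with ⟨h1, h2⟩ | ⟨h1, h2⟩
    · right; exact ⟨h2.le, h1.le⟩
    · left; exact ⟨h1.le, h2.le⟩
  rw [← Set.uIcc_of_le hx.le] at hf
  obtain ⟨x, hxm, hx0⟩ := intermediate_value_uIcc hf hmem
  rw [Set.uIcc_of_le hx.le] at hxm
  have hxp : x ≠ p.1 := by
    rintro rfl; rw [hfp] at hx0; rw [hx0] at hF; simp at hF
  have hxq : x ≠ q.1 := by
    rintro rfl; rw [hfq] at hx0; rw [hx0] at hF; simp at hF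
  refine ⟨(x, Y x), (hY x hxm).1, (hY x hxm).2, lt_of_le_of_ne hxm.1 (Ne.symm hxp), lt_of_le_of_ne hxm.2 hxq, hx0⟩

/-- counting labels on a line -/
lemma label_count {L : Type} [DecidableEq L] {V : Type} (X : Finset V) (co : V → ℝ) (lab : V → L) (Z : Finset ℝ)
    (h : ∀ x ∈ X, ∀ y ∈ X, lab x ≠ lab y → co x ≠ co y)
    (h' : ∀ x ∈ X, ∀ y ∈ X, lab x ≠ lab y → co x < co y → ∃ z ∈ Z, co x ≤ z ∧ z < co y) :
    (X.image lab).card ≤ Z.card + 1 := by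
  classical
  rcases isEmpty_or_nonempty V with hVe | hVne
  · rw [Finset.eq_empty_of_isEmpty X]; simp
  let c : V → ℕ := fun v => (Z.filter (fun z => z < co v)).card
  have hc : ∀ x ∈ X, ∀ y ∈ X, c x = c y → lab x = lab y := by
    intro x hx y hy hxy
    by_contra hne
    wlog hlt : co x < co y generalizing x y
    · exact this y hy x hx hxy.symm (Ne.symm hne) (lt_of_le_of_ne (le_of_not_gt hlt) (Ne.symm (h x hx y hy hne)))
    obtain ⟨z, hz, h1, h2⟩ := h' x hx y hy hne hlt
    have : c x < c y := by
      apply Finset.card_lt_card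
      rw [Finset.ssubset_iff_of_subset]
      · exact ⟨z, by simp [hz, h2], by simp [h1]⟩
      · intro w hw
        rw [Finset.mem_filter] at hw ⊢
        exact ⟨hw.1, hw.2.trans hlt⟩
    omega
  have h1 : (X.image lab).card ≤ (X.image c).card := by
    choose! g hg1 hg2 using fun l (hl : l ∈ X.image lab) => Finset.mem_image.1 hl
    refine Finset.card_le_card_of_injOn (fun l => c (g l)) ?_ ?_
    · intro l hl
      exact Finset.mem_coe.2 (Finset.mem_image_of_mem _ (hg1 l hl))
    · intro l hl l' hl' hll
      rw [← hg2 l hl, ← hg2 l' hl']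
      exact hc _ (hg1 l hl) _ (hg1 l' hl') hll
  refine h1.trans ?_
  have : X.image c ⊆ Finset.range (Z.card + 1) := by
    intro n hn
    obtain ⟨v, _, rfl⟩ := Finset.mem_image.1 hn
    rw [Finset.mem_range]
    exact Nat.lt_succ_of_le (Finset.card_le_card (Finset.filter_subset _ _))
  exact (Finset.card_le_card this).trans (by simp)

/-- The crossing count: labels changing only with a sign change of one of the `Fs`. -/
lemma crossing_count {L : Type} [DecidableEq L] {a b : ℝ[X]} {d : ℕ} (hd : 1 ≤ d) (ha : a.natDegree ≤ d) (hb : b.natDegree ≤ d)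
    {V : Type} (X : Finset V) (pt : V → ℝ × ℝ) (lab : V → L) (hreg : ∀ v ∈ X, RegAB a b (pt v)) (Fs : List MP2)
    (hlab : ∀ v ∈ X, ∀ w ∈ X, lab v ≠ lab w → ∃ F ∈ Fs, ev F (pt v) * ev F (pt w) < 0)
    (Z : Finset (ℝ × ℝ)) (hZ : ∀ F ∈ Fs, ∀ r, RegAB a b r → ev F r = 0 → r ∈ Z) :
    (X.image lab).card ≤ d ^ 2 * (Z.card + 1) := by
  classical
  let A : Finset (ℕ × ℕ) := Finset.range d ×ˢ Finset.range d
  have hA : ∀ v, arcAB a b (pt v) ∈ A := by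
    intro v
    simp only [A, arcAB, Finset.mem_product, Finset.mem_range]
    exact ⟨win_le _ _ _ ha hd, win_le _ _ _ hb hd⟩
  have hcov : X.image lab ⊆ A.biUnion (fun α => (X.filter (fun v => arcAB a b (pt v) = α)).image lab) := by
    intro l hl
    obtain ⟨v, hv, rfl⟩ := Finset.mem_image.1 hl
    rw [Finset.mem_biUnion]
    exact ⟨_, hA v, Finset.mem_image_of_mem _ (Finset.mem_filter.2 ⟨hv, rfl⟩)⟩
  refine (Finset.card_le_card hcov).trans ?_
  refine (Finset.card_biUnion_le_card_mul _ _ (Z.card + 1) ?_).trans (by simp [A, sq])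
  intro α _
  refine (label_count _ (fun v => (pt v).1) lab (Z.image Prod.fst) ?_ ?_).trans
    (Nat.succ_le_succ Finset.card_image_le)
  · intro v hv w hw hne hx
    rw [Finset.mem_filter] at hv hw
    obtain ⟨F, _, hF⟩ := hlab v hv.1 w hw.1 hne
    rw [arc_unique (hreg v hv.1) (hreg w hw.1) (hv.2.trans hw.2.symm) hx] at hF
    nlinarith [mul_self_nonneg (ev F (pt w))]
  · intro v hv w hw hne hx
    rw [Finset.mem_filter] at hv hw
    obtain ⟨F, hFm, hF⟩ := hlab v hv.1 w hw.1 hne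
    obtain ⟨r, hr, hr1, hr2, hr3, hr4⟩ := arc_zero (hreg v hv.1) (hreg w hw.1) (hv.2.trans hw.2.symm) hx F hF
    exact ⟨r.1, Finset.mem_image_of_mem _ (hZ F hFm r hr hr4), hr2.le, hr3⟩


/-! ### Separable curves and the family `H θ` -/

noncomputable def sepP (a b : ℝ[X]) : MP2 :=
  Polynomial.aeval (MvPolynomial.X 0) a - Polynomial.aeval (MvPolynomial.X 1) b

lemma ev_aeval (a : ℝ[X]) (F : MP2) (p : ℝ × ℝ) : ev (Polynomial.aeval F a) p = a.eval (ev F p) := by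
  unfold ev
  have := Polynomial.hom_eval₂ a (algebraMap ℝ MP2) (MvPolynomial.eval ![p.1, p.2]) F
  rw [Polynomial.aeval_def, this]
  have e : (MvPolynomial.eval ![p.1, p.2]).comp (algebraMap ℝ MP2) = RingHom.id ℝ := by
    ext x; simp
  rw [e, Polynomial.eval₂_id]

lemma ev_sepP (a b : ℝ[X]) (p : ℝ × ℝ) : ev (sepP a b) p = a.eval p.1 - b.eval p.2 := by
  simp [sepP, ev_aeval]

lemma deg_aeval_le (a : ℝ[X]) (F : MP2) (k : ℕ) (hF : F.totalDegree ≤ k) :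
    (Polynomial.aeval F a).totalDegree ≤ a.natDegree * k := by
  rw [Polynomial.aeval_eq_sum_range]
  refine MvPolynomial.totalDegree_finsetSum_le fun i hi => ?_
  refine (MvPolynomial.totalDegree_smul_le _ _).trans ?_
  refine (MvPolynomial.totalDegree_pow _ _).trans ?_
  rw [Finset.mem_range] at hi
  exact Nat.mul_le_mul (by omega) hF

lemma deg_sepP_le (a b : ℝ[X]) (d : ℕ) (ha : a.natDegree ≤ d) (hb : b.natDegree ≤ d) :
    (sepP a b).totalDegree ≤ d := by
  refine (MvPolynomial.totalDegree_sub _ _).trans (max_le ?_ ?_)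
  · exact (deg_aeval_le _ _ 1 (by simp)).trans (by simpa using ha)
  · exact (deg_aeval_le _ _ 1 (by simp)).trans (by simpa using hb)

lemma ev_ext {F G : MP2} (h : ∀ p, ev F p = ev G p) : F = G := by
  apply MvPolynomial.funext
  intro v
  have := h (v 0, v 1)
  unfold ev at this
  have e : v = ![v 0, v 1] := by ext i; fin_cases i <;> rfl
  rw [e]; exact this

/-- common zeros of an irreducible and a non-multiple -/
lemma common_zeros (F G : MP2) (hF : Irreducible F) (h : ¬ F ∣ G) :
    ∃ Z : Finset (ℝ × ℝ), (∀ p, ev F p = 0 → ev G p = 0 → p ∈ Z) ∧ Z.card ≤ F.totalDegree * G.totalDegree := by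
  have hG : G ≠ 0 := by rintro rfl; exact h (dvd_zero _)
  have hrel : IsRelPrime F G := (Irreducible.isRelPrime_iff_not_dvd hF).2 h
  have hb := bezout F G hF.ne_zero hG hrel
  have hfin : {p | ev F p = 0 ∧ ev G p = 0}.Finite := by
    by_contra hinf
    obtain ⟨S, hS, hc⟩ := Set.Infinite.exists_subset_card_eq hinf (F.totalDegree * G.totalDegree + 1)
    have := hb S (fun p hp => hS hp)
    omega
  refine ⟨hfin.toFinset, fun p h1 h2 => by simp [h1, h2], ?_⟩
  exact hb _ (fun p hp => by simpa using hp)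

lemma prod_dvd_count {κ : Type} (Γ : Finset κ) (H : κ → MP2) (hirr : ∀ θ ∈ Γ, Irreducible (H θ))
    (hdeg : ∀ θ ∈ Γ, 1 ≤ (H θ).totalDegree)
    (hna : ∀ θ ∈ Γ, ∀ θ' ∈ Γ, θ ≠ θ' → ¬ Associated (H θ) (H θ')) (a : MP2) (ha : a ≠ 0)
    (hdvd : ∀ θ ∈ Γ, H θ ∣ a) : Γ.card ≤ a.totalDegree := by
  classical
  have hprod : (∏ θ ∈ Γ, H θ) ∣ a := by
    refine Finset.prod_dvd_of_isRelPrime ?_ hdvd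
    intro θ hθ θ' hθ' hne
    simp only [Function.onFun]
    rw [Irreducible.isRelPrime_iff_not_dvd (hirr θ hθ)]
    intro hd
    exact hna θ hθ θ' hθ' hne ((hirr θ hθ).associated_of_dvd (hirr θ' hθ') hd)
  obtain ⟨c, rfl⟩ := hprod
  have hc : c ≠ 0 := right_ne_zero_of_mul ha
  have hp : (∏ θ ∈ Γ, H θ) ≠ 0 := left_ne_zero_of_mul ha
  rw [MvPolynomial.totalDegree_mul_of_isDomain hp hc]
  have : ∀ Δ : Finset κ, Δ ⊆ Γ → Δ.card ≤ (∏ θ ∈ Δ, H θ).totalDegree := by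
    intro Δ
    induction Δ using Finset.induction_on with
    | empty => simp
    | insert θ Δ hθ ih =>
      intro hsub
      have h1 := ih ((Finset.subset_insert _ _).trans hsub)
      have hθΓ := hsub (Finset.mem_insert_self _ _)
      have h2 := hdeg θ hθΓ
      rw [Finset.card_insert_of_notMem hθ, Finset.prod_insert hθ,
        MvPolynomial.totalDegree_mul_of_isDomain (hirr θ hθΓ).ne_zero
        (Finset.prod_ne_zero_iff.2 fun t ht => (hirr t (hsub (Finset.mem_insert_of_mem ht))).ne_zero)]
      omega
  have := this Γ subset_rfl
  omega

lemma irr_points (a b : ℝ[X]) (d : ℕ) (ha1 : 1 ≤ a.natDegree) (hb1 : 1 ≤ b.natDegree) (ha : a.natDegree ≤ d)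
    (hb : b.natDegree ≤ d) : ∃ Z : Finset (ℝ × ℝ), (∀ p : ℝ × ℝ, a.eval p.1 = b.eval p.2 → ¬ RegAB a b p → p ∈ Z) ∧
      Z.card ≤ 2 * d ^ 2 := by
  classical
  have hcr : ∀ q : ℝ[X], 1 ≤ q.natDegree → q.natDegree ≤ d → q.derivative ≠ 0 ∧ q.derivative.roots.toFinset.card ≤ d := by
    intro q h1 h2
    refine ⟨fun h => ?_, ?_⟩
    · have := Polynomial.natDegree_eq_zero_of_derivative_eq_zero h
      omega
    · have e2 := Multiset.toFinset_card_le q.derivative.roots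
      have e3 := Polynomial.card_roots' q.derivative
      have e4 := Polynomial.natDegree_derivative_le q
      omega
  have hlev : ∀ (q : ℝ[X]) (v : ℝ), 1 ≤ q.natDegree → q.natDegree ≤ d → q - C v ≠ 0 ∧ (q - C v).roots.toFinset.card ≤ d := by
    intro q v h1 h2
    have hn : (q - C v).natDegree = q.natDegree := Polynomial.natDegree_sub_C
    refine ⟨fun h => ?_, ?_⟩
    · rw [h] at hn; simp at hn; omega
    · have e2 := Multiset.toFinset_card_le (q - C v).roots
      have e3 := Polynomial.card_roots' (q - C v)
      omega
  let Z1 := a.derivative.roots.toFinset.biUnion (fun x => (b - C (a.eval x)).roots.toFinset.image (fun y => (x, y)))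
  let Z2 := b.derivative.roots.toFinset.biUnion (fun y => (a - C (b.eval y)).roots.toFinset.image (fun x => (x, y)))
  refine ⟨Z1 ∪ Z2, ?_, ?_⟩
  · rintro ⟨x, y⟩ hp hreg
    simp only at hp
    simp only [RegAB, not_and_or, not_not] at hreg
    rw [Finset.mem_union]
    rcases hreg with h | h | h
    · exact absurd hp h
    · left
      simp only [Z1, Finset.mem_biUnion, Finset.mem_image]
      refine ⟨x, by simp [(hcr a ha1 ha).1, h], y, ?_, rfl⟩
      rw [Multiset.mem_toFinset, Polynomial.mem_roots (hlev b _ hb1 hb).1]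
      simp [hp]
    · right
      simp only [Z2, Finset.mem_biUnion, Finset.mem_image]
      refine ⟨y, by simp [(hcr b hb1 hb).1, h], x, ?_, rfl⟩
      rw [Multiset.mem_toFinset, Polynomial.mem_roots (hlev a _ ha1 ha).1]
      simp [hp]
  · have h1 : Z1.card ≤ d * d := by
      refine (Finset.card_biUnion_le_card_mul _ _ d fun x _ => ?_).trans
        (Nat.mul_le_mul_right _ (hcr a ha1 ha).2)
      exact Finset.card_image_le.trans (hlev b _ hb1 hb).2
    have h2 : Z2.card ≤ d * d := by
      refine (Finset.card_biUnion_le_card_mul _ _ d fun x _ => ?_).trans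
        (Nat.mul_le_mul_right _ (hcr b hb1 hb).2)
      exact Finset.card_image_le.trans (hlev a _ ha1 ha).2
    have := Finset.card_union_le Z1 Z2
    nlinarith

/-! the family -/

abbrev Par := ℝ × ℝ × ℝ

noncomputable def pa (g : ℝ[X]) (θ : Par) : ℝ[X] := g.comp (X - C θ.1) + C θ.2.2
noncomputable def pb (g : ℝ[X]) (θ : Par) : ℝ[X] := g.comp (X - C θ.2.1)
noncomputable def HH (g : ℝ[X]) (θ : Par) : MP2 := sepP (pa g θ) (pb g θ)
def On (g : ℝ[X]) (θ : Par) (p : ℝ × ℝ) : Prop := (pa g θ).eval p.1 = (pb g θ).eval p.2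

lemma pa_eval (g θ x) : (pa g θ).eval x = g.eval (x - θ.1) + θ.2.2 := by simp [pa]
lemma pb_eval (g θ x) : (pb g θ).eval x = g.eval (x - θ.2.1) := by simp [pb]

lemma pa_deg (g θ) : (pa g θ).natDegree = g.natDegree := by
  simp [pa, Polynomial.natDegree_comp]
lemma pb_deg (g θ) : (pb g θ).natDegree = g.natDegree := by
  simp [pb, Polynomial.natDegree_comp]

lemma HH_deg (g θ) (d : ℕ) (hd : g.natDegree ≤ d) : (HH g θ).totalDegree ≤ d :=
  deg_sepP_le _ _ _ ((pa_deg g θ).le.trans hd) ((pb_deg g θ).le.trans hd)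

lemma on_iff (g θ p) : On g θ p ↔ ev (HH g θ) p = 0 := by
  rw [On, HH, ev_sepP, sub_eq_zero]

lemma periodic_const (g : ℝ[X]) (hg : 2 ≤ g.natDegree) (s κ : ℝ) (h : ∀ x, g.eval (x + s) - g.eval x = κ) : s = 0 := by
  by_contra hs
  have h1 : ∀ m : ℕ, g.eval (m * s) = g.eval 0 + m * κ := by
    intro m
    induction m with
    | zero => simp
    | succ m ih =>
      have := h (m * s)
      push_cast
      rw [show ((m:ℝ) + 1) * s = m * s + s by ring]
      linarith
  let q : ℝ[X] := C (g.eval 0) + C (κ / s) * X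
  have : g = q := by
    apply Polynomial.eq_of_infinite_eval_eq
    refine Set.infinite_of_injective_forall_mem (f := fun m : ℕ => (m:ℝ) * s) ?_ ?_
    · intro m n hmn
      have : (m:ℝ) = n := mul_right_cancel₀ hs hmn
      exact_mod_cast this
    · intro m
      simp only [Set.mem_ofPred_eq, q]
      rw [h1]
      simp
      field_simp
  have h2 : q.natDegree ≤ 1 := by
    refine (Polynomial.natDegree_add_le _ _).trans (max_le (by simp) ?_)
    exact (Polynomial.natDegree_C_mul_le _ _).trans Polynomial.natDegree_X_le
  rw [← this] at h2
  omega

lemma lead_shift (g : ℝ[X]) (hg : 1 ≤ g.natDegree) (u u' k κ : ℝ)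
    (h : ∀ x, g.eval (x - u) - k * g.eval (x - u') = κ) : k = 1 := by
  have hp : g.comp (X - C u) - C k * g.comp (X - C u') = C κ := by
    apply Polynomial.funext
    intro x
    simpa using h x
  have := congrArg (fun q : ℝ[X] => q.coeff g.natDegree) hp
  have hc : ∀ v : ℝ, (g.comp (X - C v)).coeff g.natDegree = g.leadingCoeff := by
    intro v
    have h1 : (g.comp (X - C v)).natDegree = g.natDegree := by simp [Polynomial.natDegree_comp]
    have h2 : (g.comp (X - C v)).leadingCoeff = g.leadingCoeff := by
      rw [Polynomial.leadingCoeff_comp (by simp)]; simp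
    rw [← h2, Polynomial.leadingCoeff, h1]
  simp only [Polynomial.coeff_sub, Polynomial.coeff_C_mul, hc, Polynomial.coeff_C, if_neg (by omega : ¬ g.natDegree = 0)] at this
  have hl : g.leadingCoeff ≠ 0 := by
    rw [Polynomial.leadingCoeff_ne_zero]; rintro rfl; simp at hg
  have e : (1 - k) * g.leadingCoeff = 0 := by linarith
  rcases mul_eq_zero.1 e with h | h
  · linarith
  · exact absurd h hl

lemma isUnit_mp2 {F : MP2} (h : IsUnit F) : ∃ k : ℝ, k ≠ 0 ∧ F = MvPolynomial.C k := by
  obtain ⟨k, hk, rfl⟩ := MvPolynomial.isUnit_iff_eq_C_of_isReduced.1 h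
  exact ⟨k, hk.ne_zero, rfl⟩

lemma HH_nonassoc (g : ℝ[X]) (hg : 2 ≤ g.natDegree) (θ θ' : Par) (hne : θ ≠ θ') :
    ¬ Associated (HH g θ) (HH g θ') := by
  rintro ⟨U, hU⟩
  obtain ⟨k, hk, hUk⟩ := isUnit_mp2 U.isUnit
  apply hne
  obtain ⟨u1, u2, c⟩ := θ
  obtain ⟨v1, v2, c'⟩ := θ'
  have hev : ∀ x y, (g.eval (x - u1) + c - g.eval (y - u2)) * k = g.eval (x - v1) + c' - g.eval (y - v2) := by
    intro x y
    have := congrArg (fun F => ev F (x, y)) hU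
    simpa [HH, ev_sepP, pa_eval, pb_eval, hUk] using this
  have hk1 : k = 1 := by
    refine lead_shift g (by omega) v1 u1 k (k * (c - g.eval (0 - u2)) - c' + g.eval (0 - v2)) fun x => ?_
    have := hev x 0
    linarith
  subst hk1
  have h1 : u1 = v1 := by
    have : v1 - u1 = 0 := periodic_const g hg (v1 - u1) (-(c - g.eval (0 - u2)) + c' - g.eval (0 - v2)) fun x => by
      have := hev (x + v1) 0
      rw [show x + v1 - v1 = x by ring, show x + v1 - u1 = x + (v1 - u1) by ring] at this
      linarith
    linarith
  have h2 : u2 = v2 := by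
    have : v2 - u2 = 0 := periodic_const g hg (v2 - u2) ((c + g.eval (0 - u1)) - c' - g.eval (0 - v1)) fun x => by
      have := hev 0 (x + v2)
      rw [show x + v2 - v2 = x by ring, show x + v2 - u2 = x + (v2 - u2) by ring] at this
      linarith
    linarith
  subst h1 h2
  have := hev 0 0
  simp only [Prod.mk.injEq, true_and]
  linarith

lemma HH_deg_pos {F : MP2} (h : Irreducible F) : 1 ≤ F.totalDegree := by
  by_contra h0
  have h0 : F.totalDegree = 0 := by omega
  rw [MvPolynomial.totalDegree_eq_zero_iff_eq_C] at h0
  apply h.not_isUnit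
  rw [h0]
  refine IsUnit.map _ ?_
  rw [isUnit_iff_ne_zero]
  intro h1
  rw [h1] at h0
  exact h.ne_zero (by rw [h0]; simp)

/-- at most `deg a` members divide `a`. -/
lemma HH_dvd_count (g : ℝ[X]) (hg : 2 ≤ g.natDegree) (Γ : Finset Par) (hirr : ∀ θ ∈ Γ, Irreducible (HH g θ))
    (a : MP2) (ha : a ≠ 0) (hdvd : ∀ θ ∈ Γ, HH g θ ∣ a) : Γ.card ≤ a.totalDegree :=
  prod_dvd_count Γ (HH g) hirr (fun θ h => HH_deg_pos (hirr θ h))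
    (fun θ _ θ' _ h => HH_nonassoc g hg θ θ' h) a ha hdvd

lemma HH_common (g : ℝ[X]) (hg : 2 ≤ g.natDegree) (d : ℕ) (hd : g.natDegree ≤ d) (θ θ' : Par) (hne : θ ≠ θ')
    (h : Irreducible (HH g θ)) (h' : Irreducible (HH g θ')) :
    ∃ Z : Finset (ℝ × ℝ), (∀ p, On g θ p → On g θ' p → p ∈ Z) ∧ Z.card ≤ d ^ 2 := by
  obtain ⟨Z, h1, h2⟩ := common_zeros (HH g θ) (HH g θ') h (fun hdv =>
    HH_nonassoc g hg θ θ' hne (h.associated_of_dvd h' hdv))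
  refine ⟨Z, fun p hp hp' => h1 p ((on_iff _ _ _).1 hp) ((on_iff _ _ _).1 hp'), h2.trans ?_⟩
  rw [sq]
  exact Nat.mul_le_mul (HH_deg g θ d hd) (HH_deg g θ' d hd)

/-! irreducibility from the frozen notion -/

lemma irreducible_of_not_red (F : MP2) (h : ¬ RedBiv F) (hd : 1 ≤ F.totalDegree) : Irreducible F := by
  constructor
  · intro hu
    obtain ⟨k, _, rfl⟩ := isUnit_mp2 hu
    simp at hd
  · intro A B hAB
    by_contra hcon
    push Not at hcon
    have key : ∀ G : MP2, G ≠ 0 → ¬ IsUnit G → 1 ≤ G.totalDegree := by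
      intro G hG hGu
      by_contra h0
      have h0 : G.totalDegree = 0 := by omega
      rw [MvPolynomial.totalDegree_eq_zero_iff_eq_C] at h0
      apply hGu
      rw [h0]
      refine IsUnit.map _ ?_
      rw [isUnit_iff_ne_zero]
      intro h1
      rw [h1] at h0
      exact hG (by rw [h0]; simp)
    have hF : F ≠ 0 := by rintro rfl; simp at hd
    rw [hAB] at hF
    exact h ⟨A, B, hAB, key A (left_ne_zero_of_mul hF) hcon.1, key B (right_ne_zero_of_mul hF) hcon.2⟩

noncomputable def shiftHom (u1 u2 : ℝ) : MP2 →ₐ[ℝ] MP2 :=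
  MvPolynomial.aeval ![MvPolynomial.X 0 - MvPolynomial.C u1, MvPolynomial.X 1 - MvPolynomial.C u2]

noncomputable def shiftEquiv (u1 u2 : ℝ) : MP2 ≃ₐ[ℝ] MP2 :=
  AlgEquiv.ofAlgHom (shiftHom u1 u2) (shiftHom (-u1) (-u2))
    (by
      apply MvPolynomial.algHom_ext
      intro i
      fin_cases i <;> simp [shiftHom, MvPolynomial.algebraMap_eq])
    (by
      apply MvPolynomial.algHom_ext
      intro i
      fin_cases i <;> simp [shiftHom, MvPolynomial.algebraMap_eq])

lemma ev_shift (u1 u2 : ℝ) (F : MP2) (p : ℝ × ℝ) : ev (shiftEquiv u1 u2 F) p = ev F (p.1 - u1, p.2 - u2) := by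
  change ev (shiftHom u1 u2 F) p = _
  unfold ev shiftHom
  induction F using MvPolynomial.induction_on with
  | C a => simp [MvPolynomial.algebraMap_eq]
  | add F G hF hG => simp only [map_add, hF, hG]
  | mul_X F i hF =>
    rw [map_mul, map_mul, map_mul, hF]
    congr 1
    fin_cases i <;> simp

lemma HH_irreducible (g h : ℝ[X]) (hg : 2 ≤ g.natDegree) (b1 b2 : ℝ) (hb : ¬ Bad g h b1 b2) (u1 u2 : ℝ) :
    Irreducible (HH g (u1, u2, h.eval b1 - h.eval b2)) := by
  have h1 : ¬ RedBiv (bivDiff g + MvPolynomial.C (h.eval b1 - h.eval b2)) := fun hh => hb (Or.inl hh)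
  set c := h.eval b1 - h.eval b2 with hc
  have hevF : ∀ p : ℝ × ℝ, ev (bivDiff g + MvPolynomial.C c) p = g.eval p.1 - g.eval p.2 + c := by
    intro p; simp [bivDiff, ev_aeval]
  have hdeg : 1 ≤ (bivDiff g + MvPolynomial.C c).totalDegree := by
    by_contra h0
    have h0 : (bivDiff g + MvPolynomial.C c).totalDegree = 0 := by omega
    rw [MvPolynomial.totalDegree_eq_zero_iff_eq_C] at h0
    set k := MvPolynomial.coeff 0 (bivDiff g + MvPolynomial.C c)
    have : ∀ x, g.eval (x + 1) - g.eval x = 0 := by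
      intro x
      have e1 := hevF (x + 1, 0)
      have e2 := hevF (x, 0)
      rw [h0] at e1 e2
      simp only [ev_C] at e1 e2
      linarith
    exact one_ne_zero (periodic_const g hg 1 0 this)
  have hirr := irreducible_of_not_red _ h1 hdeg
  have : HH g (u1, u2, c) = shiftEquiv u1 u2 (bivDiff g + MvPolynomial.C c) := by
    apply ev_ext
    intro p
    rw [ev_shift, hevF, HH, ev_sepP, pa_eval, pb_eval]
    ring
  rw [this]
  exact (MulEquiv.irreducible_iff (shiftEquiv u1 u2)).2 hirr


/-! ## D6 : edges and the Szemeredi-Trotter type lemma -/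
abbrev Pt := ℝ × ℝ
abbrev Edge := Par × Pt × Pt

def Reg (g : ℝ[X]) (θ : Par) (p : Pt) : Prop := RegAB (pa g θ) (pb g θ) p
noncomputable def arc (g : ℝ[X]) (θ : Par) (p : Pt) : ℕ × ℕ := arcAB (pa g θ) (pb g θ) p

lemma Reg.on {g : ℝ[X]} {θ : Par} {p : Pt} (h : Reg g θ p) : On g θ p := h.1

lemma hit_count {ε α ζ : Type} [DecidableEq ζ] (E : Finset ε) (ar : ε → α) (lo hi : ε → ℝ) (Z : Finset ζ) (az : ζ → α) (co : ζ → ℝ)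
    (hlt : ∀ e ∈ E, lo e < hi e)
    (hno : ∀ e ∈ E, ∀ e' ∈ E, e ≠ e' → ar e = ar e' → hi e ≤ lo e' ∨ hi e' ≤ lo e)
    (hz : ∀ e ∈ E, ∃ z ∈ Z, az z = ar e ∧ lo e ≤ co z ∧ co z ≤ hi e) : E.card ≤ 2 * Z.card := by
  classical
  rcases isEmpty_or_nonempty ζ with hζ | hζ
  · have : E = ∅ := by
      rw [Finset.eq_empty_iff_forall_notMem]
      intro e he
      obtain ⟨z, _⟩ := hz e he
      exact hζ.elim z
    simp [this]
  choose! f hf using hz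
  let F : ε → ζ × Bool := fun e => (f e, decide (co (f e) = hi e))
  have hc : E.card ≤ (Z ×ˢ (Finset.univ : Finset Bool)).card := by
    refine Finset.card_le_card_of_injOn F ?_ ?_
    · intro e he
      simp only [Finset.coe_product, Set.mem_prod, F]
      exact ⟨(hf e he).1, Finset.mem_coe.2 (Finset.mem_univ _)⟩
    · intro e he e' he' hFe
      by_contra hne
      simp only [F, Prod.mk.injEq] at hFe
      obtain ⟨h1, h2⟩ := hFe
      have a1 := hf e he
      have a2 := hf e' he'
      have l1 := hlt e he
      have l2 := hlt e' he'
      have har : ar e = ar e' := by rw [← a1.2.1, ← a2.2.1, h1]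
      have hno' := hno e he e' he' hne har
      rw [h1] at h2 a1
      rw [decide_eq_decide] at h2
      by_cases hq : co (f e') = hi e'
      · have := h2.2 hq
        rcases hno' with h | h <;> linarith
      · have hq' : co (f e') ≠ hi e := fun h => hq (h2.1 h)
        have b1 := lt_of_le_of_ne a1.2.2.2 hq'
        have b2 := lt_of_le_of_ne a2.2.2.2 hq
        rcases hno' with h | h <;> linarith
  simpa [mul_comm] using hc

/-- successive points on the same arc -/
def Nxt (g : ℝ[X]) (J : Finset (Par × Pt)) (θ : Par) (p q : Pt) : Prop :=
  (θ, p) ∈ J ∧ (θ, q) ∈ J ∧ Reg g θ p ∧ Reg g θ q ∧ arc g θ p = arc g θ q ∧ p.1 < q.1 ∧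
    ∀ r, (θ, r) ∈ J → Reg g θ r → arc g θ r = arc g θ p → r.1 ≤ p.1 ∨ q.1 ≤ r.1

open Classical in
noncomputable def edgesOf (g : ℝ[X]) (J : Finset (Par × Pt)) : Finset Edge :=
  ((J ×ˢ J).image (fun x => ((x.1.1, x.1.2, x.2.2) : Edge))).filter (fun e => Nxt g J e.1 e.2.1 e.2.2)

lemma mem_edgesOf {g : ℝ[X]} {J : Finset (Par × Pt)} {e : Edge} :
    e ∈ edgesOf g J ↔ Nxt g J e.1 e.2.1 e.2.2 := by
  classical
  obtain ⟨θ, p, q⟩ := e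
  unfold edgesOf
  rw [Finset.mem_filter, Finset.mem_image]
  constructor
  · exact fun h => h.2
  · intro h
    exact ⟨⟨((θ, p), (θ, q)), Finset.mem_product.2 ⟨h.1, h.2.1⟩, rfl⟩, h⟩

lemma Nxt.nonoverlap {g : ℝ[X]} {J : Finset (Par × Pt)} {θ : Par} {p q p' q' : Pt}
    (h : Nxt g J θ p q) (h' : Nxt g J θ p' q') (hne : (p, q) ≠ (p', q')) (ha : arc g θ p = arc g θ p') :
    q.1 ≤ p'.1 ∨ q'.1 ≤ p.1 := by
  obtain ⟨h1, h2, h3, h4, h5, h6, h7⟩ := h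
  obtain ⟨k1, k2, k3, k4, k5, k6, k7⟩ := h'
  by_contra hcon
  push Not at hcon
  have e1 : p.1 = p'.1 := by
    rcases h7 p' k1 k3 ha.symm with a | a
    · rcases k7 p h1 h3 ha with b | b <;> linarith
    · linarith
  have e2 : q.1 = q'.1 := by
    rcases h7 q' k2 k4 (by rw [← k5, ← ha]) with a | a
    · linarith
    · rcases k7 q h2 h4 (by rw [← h5, ha]) with b | b <;> linarith
  apply hne
  rw [arc_unique h3 k3 ha e1, arc_unique h4 k4 (by change arc g θ q = arc g θ q'; rw [← h5, ← k5, ha]) e2]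

lemma arc_mem (g : ℝ[X]) (d : ℕ) (hd : g.natDegree ≤ d) (hd1 : 1 ≤ d) (θ : Par) (p : Pt) :
    arc g θ p ∈ Finset.range d ×ˢ Finset.range d := by
  simp only [arc, arcAB, Finset.mem_product, Finset.mem_range]
  exact ⟨win_le _ _ _ ((pa_deg g θ).le.trans hd) hd1, win_le _ _ _ ((pb_deg g θ).le.trans hd) hd1⟩

lemma inc_le_edges (g : ℝ[X]) (d : ℕ) (hg : 2 ≤ g.natDegree) (hd : g.natDegree ≤ d) (Γ : Finset Par)
    (J : Finset (Par × Pt)) (hJ : ∀ x ∈ J, x.1 ∈ Γ ∧ On g x.1 x.2) :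
    J.card ≤ (edgesOf g J).card + 3 * d ^ 2 * Γ.card := by
  classical
  have hirr : ∀ θ : Par, ∃ Z : Finset Pt, (∀ p, On g θ p → ¬ Reg g θ p → p ∈ Z) ∧ Z.card ≤ 2 * d ^ 2 := by
    intro θ
    exact irr_points (pa g θ) (pb g θ) d (by rw [pa_deg]; omega) (by rw [pb_deg]; omega) ((pa_deg g θ).le.trans hd)
      ((pb_deg g θ).le.trans hd)
  choose Z hZ1 hZ2 using hirr
  let J1 := J.filter (fun x => ¬ Reg g x.1 x.2)
  let J2 := J.filter (fun x => Reg g x.1 x.2 ∧ ∃ q, Nxt g J x.1 x.2 q)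
  let J3 := J.filter (fun x => Reg g x.1 x.2 ∧ ¬ ∃ q, Nxt g J x.1 x.2 q)
  have hcov : J ⊆ J1 ∪ (J2 ∪ J3) := by
    intro x hx
    simp only [J1, J2, J3, Finset.mem_union, Finset.mem_filter]
    tauto
  have c1 : J1.card ≤ 2 * d ^ 2 * Γ.card := by
    have : J1 ⊆ Γ.biUnion (fun θ => (Z θ).image (fun p => (θ, p))) := by
      intro x hx
      rw [Finset.mem_filter] at hx
      rw [Finset.mem_biUnion]
      exact ⟨x.1, (hJ x hx.1).1, Finset.mem_image.2 ⟨x.2, hZ1 _ _ (hJ x hx.1).2 hx.2, rfl⟩⟩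
    calc J1.card ≤ _ := Finset.card_le_card this
      _ ≤ Γ.card * (2 * d ^ 2) := Finset.card_biUnion_le_card_mul _ _ _ (fun θ _ => Finset.card_image_le.trans (hZ2 θ))
      _ = _ := by ring
  have c2 : J2.card ≤ (edgesOf g J).card := by
    have : J2 ⊆ (edgesOf g J).image (fun e => (e.1, e.2.1)) := by
      intro x hx
      rw [Finset.mem_filter] at hx
      obtain ⟨q, hq⟩ := hx.2.2
      exact Finset.mem_image.2 ⟨(x.1, x.2, q), mem_edgesOf.2 hq, rfl⟩
    exact (Finset.card_le_card this).trans Finset.card_image_le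
  have htop : ∀ θ p p', (θ, p) ∈ J → (θ, p') ∈ J → Reg g θ p → Reg g θ p' → arc g θ p = arc g θ p' → p.1 < p'.1 →
      ∃ q, Nxt g J θ p q := by
    intro θ p p' hp hp' hr hr' ha hlt
    let W := J.filter (fun x => x.1 = θ ∧ Reg g θ x.2 ∧ arc g θ x.2 = arc g θ p ∧ p.1 < x.2.1)
    have hW : W.Nonempty := ⟨(θ, p'), Finset.mem_filter.2 ⟨hp', rfl, hr', ha.symm, hlt⟩⟩
    obtain ⟨w, hw, hmin⟩ := Finset.exists_min_image W (fun x => x.2.1) hW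
    simp only [W, Finset.mem_filter] at hw
    obtain ⟨hw1, rfl, hw2, hw3, hw4⟩ := hw
    refine ⟨w.2, hp, hw1, hr, hw2, hw3.symm, hw4, ?_⟩
    intro r h1 h2 h3
    by_contra hcon
    push Not at hcon
    have := hmin (w.1, r) (Finset.mem_filter.2 ⟨h1, rfl, h2, h3, hcon.1⟩)
    simp only at this
    linarith
  have c3 : J3.card ≤ d ^ 2 * Γ.card := by
    have : J3.card ≤ (Γ ×ˢ (Finset.range d ×ˢ Finset.range d)).card := by
      refine Finset.card_le_card_of_injOn (fun x => (x.1, arc g x.1 x.2)) ?_ ?_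
      · intro x hx
        have hx := (Finset.mem_filter.1 hx).1
        exact Finset.mem_product.2 ⟨(hJ x hx).1, arc_mem g d hd (by omega) _ _⟩
      · rintro ⟨θ, p⟩ hx ⟨θ', p'⟩ hx' heq
        simp only [Prod.mk.injEq] at heq
        obtain ⟨rfl, ha⟩ := heq
        have hx := Finset.mem_filter.1 hx
        have hx' := Finset.mem_filter.1 hx'
        rcases lt_trichotomy p.1 p'.1 with h | h | h
        · exact absurd (htop θ p p' hx.1 hx'.1 hx.2.1 hx'.2.1 ha h) hx.2.2
        · exact Prod.ext rfl (arc_unique hx.2.1 hx'.2.1 ha h)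
        · exact absurd (htop θ p' p hx'.1 hx.1 hx'.2.1 hx.2.1 ha.symm h) hx'.2.2
    rw [Finset.card_product, Finset.card_product, Finset.card_range] at this
    calc _ ≤ _ := this
      _ = _ := by ring
  have := Finset.card_le_card hcov
  have h1 := Finset.card_union_le J1 (J2 ∪ J3)
  have h2 := Finset.card_union_le J2 J3
  nlinarith

/-- the number of curves contained in the zero set of a list -/
lemma inside_count (g : ℝ[X]) (hg : 2 ≤ g.natDegree) (Γ : Finset Par) (hirr : ∀ θ ∈ Γ, Irreducible (HH g θ))
    (Ps : List Poly2) (h : ∀ θ ∈ Γ, ∃ P ∈ Ps, HH g θ ∣ P.1) : Γ.card ≤ (Ps.map (fun P => P.1.totalDegree)).sum := by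
  classical
  induction Ps generalizing Γ with
  | nil =>
    have : Γ = ∅ := by
      rw [Finset.eq_empty_iff_forall_notMem]; intro θ hθ; obtain ⟨P, hP, _⟩ := h θ hθ; simp at hP
    simp [this]
  | cons P Ps ih =>
    have h1 : (Γ.filter (fun θ => HH g θ ∣ P.1)).card ≤ P.1.totalDegree :=
      HH_dvd_count g hg _ (fun θ hθ => hirr θ (Finset.mem_filter.1 hθ).1) P.1 P.2 (fun θ hθ => (Finset.mem_filter.1 hθ).2)
    have h2 := ih (Γ.filter (fun θ => ¬ HH g θ ∣ P.1)) (fun θ hθ => hirr θ (Finset.mem_filter.1 hθ).1) (by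
      intro θ hθ
      rw [Finset.mem_filter] at hθ
      obtain ⟨Q, hQ, hd⟩ := h θ hθ.1
      rcases List.mem_cons.1 hQ with rfl | hQ
      · exact absurd hd hθ.2
      · exact ⟨Q, hQ, hd⟩)
    have := Finset.card_filter_add_card_filter_not (s := Γ) (fun θ => HH g θ ∣ P.1)
    simp only [List.map_cons, List.sum_cons]
    omega

lemma list_zeros (F : MP2) (hF : Irreducible F) (d : ℕ) (hd : F.totalDegree ≤ d) (Ps : List MP2) (h : ∀ P ∈ Ps, ¬ F ∣ P) :
    ∃ Z : Finset Pt, (∀ P ∈ Ps, ∀ p, ev F p = 0 → ev P p = 0 → p ∈ Z) ∧ Z.card ≤ d * (Ps.map (fun P => P.totalDegree)).sum := by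
  classical
  induction Ps with
  | nil => exact ⟨∅, by simp, by simp⟩
  | cons P Ps ih =>
    obtain ⟨Z, h1, h2⟩ := ih (fun Q hQ => h Q (List.mem_cons_of_mem _ hQ))
    obtain ⟨Z', h1', h2'⟩ := common_zeros F P hF (h P List.mem_cons_self)
    refine ⟨Z' ∪ Z, ?_, ?_⟩
    · intro Q hQ p hp hq
      rcases List.mem_cons.1 hQ with rfl | hQ
      · exact Finset.mem_union_left _ (h1' p hp hq)
      · exact Finset.mem_union_right _ (h1 Q hQ p hp hq)
    · refine (Finset.card_union_le _ _).trans ?_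
      simp only [List.map_cons, List.sum_cons]
      have := Nat.mul_le_mul_right P.totalDegree hd
      rw [mul_add]; omega

/-- few curves : trivial incidence bound -/
lemma few_curves (g : ℝ[X]) (d : ℕ) (hg : 2 ≤ g.natDegree) (hd : g.natDegree ≤ d) (Γ : Finset Par)
    (hirr : ∀ θ ∈ Γ, Irreducible (HH g θ)) (P : Finset Pt)
    (J : Finset (Par × Pt)) (hJ : ∀ x ∈ J, x.1 ∈ Γ ∧ x.2 ∈ P ∧ On g x.1 x.2) :
    J.card ≤ P.card + d ^ 2 * Γ.card ^ 2 := by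
  classical
  have hZ : ∀ θ θ' : Par, ∃ Z : Finset Pt, (θ ∈ Γ → θ' ∈ Γ → θ ≠ θ' → ∀ p, On g θ p → On g θ' p → p ∈ Z) ∧ Z.card ≤ d ^ 2 := by
    intro θ θ'
    by_cases h : θ ∈ Γ ∧ θ' ∈ Γ ∧ θ ≠ θ'
    · obtain ⟨Z, h1, h2⟩ := HH_common g hg d hd θ θ' h.2.2 (hirr θ h.1) (hirr θ' h.2.1)
      exact ⟨Z, fun _ _ _ => h1, h2⟩
    · exact ⟨∅, fun a b c => absurd ⟨a, b, c⟩ h, by simp⟩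
  choose Z hZ1 hZ2 using hZ
  let J1 := J.filter (fun x => ∃ θ', θ' ≠ x.1 ∧ (θ', x.2) ∈ J)
  let J2 := J.filter (fun x => ¬ ∃ θ', θ' ≠ x.1 ∧ (θ', x.2) ∈ J)
  have hs : J1.card + J2.card = J.card := Finset.card_filter_add_card_filter_not _
  have c2 : J2.card ≤ P.card := by
    refine Finset.card_le_card_of_injOn (fun x => x.2) ?_ ?_
    · intro x hx
      exact (hJ x (Finset.mem_filter.1 hx).1).2.1
    · rintro ⟨θ, p⟩ hx ⟨θ', p'⟩ hx' heq
      simp only at heq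
      subst heq
      have hx := Finset.mem_filter.1 hx
      have hx' := Finset.mem_filter.1 hx'
      by_contra hne
      exact hx.2 ⟨θ', fun h => hne (by simp only at h; rw [h]), hx'.1⟩
  have c1 : J1.card ≤ d ^ 2 * Γ.card ^ 2 := by
    have : J1 ⊆ (Γ ×ˢ Γ).biUnion (fun t => (Z t.1 t.2).image (fun p => (t.1, p))) := by
      intro x hx
      have hx := Finset.mem_filter.1 hx
      obtain ⟨θ', hne, hx'⟩ := hx.2
      rw [Finset.mem_biUnion]
      refine ⟨(x.1, θ'), Finset.mem_product.2 ⟨(hJ x hx.1).1, (hJ _ hx').1⟩, Finset.mem_image.2 ⟨x.2, ?_, rfl⟩⟩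
      exact hZ1 _ _ (hJ x hx.1).1 (hJ _ hx').1 hne.symm _ (hJ x hx.1).2.2 (hJ _ hx').2.2
    calc J1.card ≤ _ := Finset.card_le_card this
      _ ≤ (Γ ×ˢ Γ).card * (d ^ 2) := Finset.card_biUnion_le_card_mul _ _ _ (fun t _ => Finset.card_image_le.trans (hZ2 _ _))
      _ = _ := by rw [Finset.card_product]; ring
  omega

lemma edgesOf_filter (g : ℝ[X]) (J : Finset (Par × Pt)) (Q : Par → Prop) [DecidablePred Q] (e : Edge)
    (he : e ∈ edgesOf g (J.filter (fun x => Q x.1))) : e ∈ edgesOf g J ∧ Q e.1 := by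
  rw [mem_edgesOf] at he ⊢
  obtain ⟨h1, h2, h3, h4, h5, h6, h7⟩ := he
  rw [Finset.mem_filter] at h1 h2
  refine ⟨⟨h1.1, h2.1, h3, h4, h5, h6, ?_⟩, h1.2⟩
  intro r hr
  exact h7 r (Finset.mem_filter.2 ⟨hr, h1.2⟩)

lemma st_core (d : ℕ) : ∃ C : ℝ, 1 ≤ C ∧ ∀ (g : ℝ[X]) (hg : 2 ≤ g.natDegree) (hd : g.natDegree ≤ d) (Γ : Finset Par)
    (hirr : ∀ θ ∈ Γ, Irreducible (HH g θ)) (P : Finset Pt) (J : Finset (Par × Pt))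
    (hJ : ∀ x ∈ J, x.1 ∈ Γ ∧ x.2 ∈ P ∧ On g x.1 x.2) (U : Finset Edge) (μ : ℝ) (hμ : 0 ≤ μ)
    (hU : ∀ p q : Pt, ((U.filter (fun e => e.2 = (p, q))).card : ℝ) ≤ μ) (T : ℝ) (hT : 1 ≤ T),
    (J.card : ℝ) ≤ P.card + C * T + C * Γ.card * T ^ (1/2 : ℝ) + μ * P.card ^ 2 / T + ((edgesOf g J \ U).card : ℝ) := by
  classical
  obtain ⟨C, hC, hpart⟩ := partition (1/2) 6 (by norm_num) (by norm_num)
  refine ⟨1 + d ^ 2 * C ^ 2 + 3 * d ^ 2 + 2 * d * C, ?_, ?_⟩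
  · have : 0 ≤ (d:ℝ) ^ 2 * C ^ 2 + 3 * d ^ 2 + 2 * d * C := by positivity
    linarith
  intro g hg hd Γ hirr P J hJ U μ hμ hU T hT
  obtain ⟨Ps, hcl, hD⟩ := hpart (ι := {x // x ∈ P}) (𝓟 := Poly2) _ _ (hasFeat2 (fun x => x.1)) T hT
  set D : ℕ := (Ps.map (fun P => P.1.totalDegree)).sum with hDdef
  have hcardP : Fintype.card {x // x ∈ P} = P.card := by simp
  rw [hcardP] at hcl
  let Q : Par → Prop := fun θ => ∃ R ∈ Ps, HH g θ ∣ R.1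
  let Γ1 := Γ.filter Q
  let Γ2 := Γ.filter (fun θ => ¬ Q θ)
  let J1 := J.filter (fun x => Q x.1)
  let J2 := J.filter (fun x => ¬ Q x.1)
  have hJs : J1.card + J2.card = J.card := Finset.card_filter_add_card_filter_not _
  have hΓ1 : Γ1.card ≤ D := inside_count g hg Γ1 (fun θ h => hirr θ (Finset.mem_filter.1 h).1) Ps
    (fun θ h => (Finset.mem_filter.1 h).2)
  have hJ1 : J1.card ≤ P.card + d ^ 2 * D ^ 2 := by
    refine (few_curves g d hg hd Γ1 (fun θ h => hirr θ (Finset.mem_filter.1 h).1) P J1 ?_).trans ?_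
    · intro x hx
      have hx := Finset.mem_filter.1 hx
      exact ⟨Finset.mem_filter.2 ⟨(hJ x hx.1).1, hx.2⟩, (hJ x hx.1).2⟩
    · gcongr
  have hJ2 : J2.card ≤ (edgesOf g J2).card + 3 * d ^ 2 * Γ.card := by
    refine inc_le_edges g d hg hd Γ J2 ?_
    intro x hx
    have hx := Finset.mem_filter.1 hx
    exact ⟨(hJ x hx.1).1, (hJ x hx.1).2.2⟩
  -- split the edges
  let E := edgesOf g J2
  have hE : ∀ e ∈ E, e ∈ edgesOf g J ∧ ¬ Q e.1 := fun e he => edgesOf_filter g J (fun θ => ¬ Q θ) e he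
  let S : Pt → Pt → Prop := fun p q => ∀ R ∈ Ps, 0 < ev R.1 p * ev R.1 q
  let E0 := E \ U
  let E1 := (E ∩ U).filter (fun e => S e.2.1 e.2.2)
  let E2 := (E ∩ U).filter (fun e => ¬ S e.2.1 e.2.2)
  have hEs : E.card = E0.card + (E1.card + E2.card) := by
    rw [Finset.card_filter_add_card_filter_not, Finset.card_sdiff_add_card_inter]
  have hE0 : E0.card ≤ (edgesOf g J \ U).card := by
    apply Finset.card_le_card
    intro e he
    rw [Finset.mem_sdiff] at he ⊢
    exact ⟨(hE e he.1).1, he.2⟩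
  have hE1 : (E1.card : ℝ) ≤ μ * P.card ^ 2 / T := by
    let prs := (P ×ˢ P).filter (fun t => S t.1 t.2)
    have hprs : (prs.card : ℝ) ≤ P.card * (P.card / T) := by
      have : prs.card = ∑ p ∈ P, (P.filter (fun q => S p q)).card := by
        rw [Finset.card_filter, Finset.sum_product]
        simp only [Finset.card_filter]
      rw [this]
      push_cast
      calc _ ≤ ∑ p ∈ P, ((P.card : ℝ) / T) := by
            refine Finset.sum_le_sum fun p hp => ?_
            refine le_trans ?_ (hcl ⟨p, hp⟩)
            norm_cast
            refine Finset.card_le_card_of_surjOn (fun x => x.1) ?_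
            intro q hq
            have hq := Finset.mem_filter.1 hq
            refine ⟨⟨q, hq.1⟩, ?_, rfl⟩
            rw [Finset.mem_coe, mem_pcl]
            exact hq.2
        _ = _ := by rw [Finset.sum_const, nsmul_eq_mul]
    have h1 : (E1.card : ℝ) ≤ prs.card * μ := by
      have hmap : ∀ e ∈ E1, e.2 ∈ prs := by
        intro e he
        have he := Finset.mem_filter.1 he
        have h1 := (hE e (Finset.mem_inter.1 he.1).1).1
        rw [mem_edgesOf] at h1
        exact Finset.mem_filter.2 ⟨Finset.mem_product.2 ⟨(hJ _ h1.1).2.1, (hJ _ h1.2.1).2.1⟩, he.2⟩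
      rw [Finset.card_eq_sum_card_fiberwise hmap]
      push_cast
      rw [← nsmul_eq_mul]
      refine Finset.sum_le_card_nsmul _ _ _ fun t ht => ?_
      refine le_trans ?_ (hU t.1 t.2)
      norm_cast
      apply Finset.card_le_card
      intro e he
      rw [Finset.mem_filter] at he ⊢
      exact ⟨(Finset.mem_inter.1 (Finset.mem_filter.1 he.1).1).2, he.2⟩
    calc _ ≤ _ := h1
      _ ≤ (P.card * (P.card / T)) * μ := by gcongr
      _ = _ := by ring
  have hE2 : E2.card ≤ 2 * (Γ.card * (d * D)) := by
    have hZ : ∀ θ : Par, ∃ Z : Finset Pt, (θ ∈ Γ → ¬ Q θ → ∀ R ∈ Ps, ∀ p, On g θ p → ev R.1 p = 0 → p ∈ Z) ∧ Z.card ≤ d * D := by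
      intro θ
      by_cases h : θ ∈ Γ ∧ ¬ Q θ
      · obtain ⟨Z, h1, h2⟩ := list_zeros (HH g θ) (hirr θ h.1) d (HH_deg g θ d hd) (Ps.map (fun P => P.1)) (by
          intro R hR hdv
          obtain ⟨R', hR', rfl⟩ := List.mem_map.1 hR
          exact h.2 ⟨R', hR', hdv⟩)
        refine ⟨Z, fun _ _ R hR p hp hp' => h1 R.1 (List.mem_map.2 ⟨R, hR, rfl⟩) p ((on_iff _ _ _).1 hp) hp', ?_⟩
        rw [List.map_map] at h2
        exact h2
      · exact ⟨∅, fun a b => absurd ⟨a, b⟩ h, by simp⟩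
    choose Z hZ1 hZ2 using hZ
    let ZZ := Γ.biUnion (fun θ => (Z θ).image (fun p => (θ, p)))
    have hZZ : ZZ.card ≤ Γ.card * (d * D) :=
      Finset.card_biUnion_le_card_mul _ _ _ (fun θ _ => Finset.card_image_le.trans (hZ2 θ))
    have key : E2.card ≤ 2 * ZZ.card := by
      refine hit_count E2 (fun e => (e.1, arc g e.1 e.2.1)) (fun e => e.2.1.1) (fun e => e.2.2.1) ZZ
        (fun z => (z.1, arc g z.1 z.2)) (fun z => z.2.1) ?_ ?_ ?_
      · intro e he
        have he := (Finset.mem_inter.1 (Finset.mem_filter.1 he).1).1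
        exact (mem_edgesOf.1 he).2.2.2.2.2.1
      · rintro ⟨θ, p, q⟩ he ⟨θ', p', q'⟩ he' hne ha
        have he := mem_edgesOf.1 (Finset.mem_inter.1 (Finset.mem_filter.1 he).1).1
        have he' := mem_edgesOf.1 (Finset.mem_inter.1 (Finset.mem_filter.1 he').1).1
        simp only [Prod.mk.injEq] at ha
        obtain ⟨rfl, ha⟩ := ha
        refine Nxt.nonoverlap he he' ?_ ha
        intro h
        exact hne (Prod.ext rfl h)
      · rintro ⟨θ, p, q⟩ he
        have he := Finset.mem_filter.1 he
        have hEe := (Finset.mem_inter.1 he.1).1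
        have hQ := (hE _ hEe).2
        have hN := mem_edgesOf.1 (hE _ hEe).1
        obtain ⟨n1, n2, n3, n4, n5, n6, n7⟩ := hN
        simp only at n1 n2 n3 n4 n5 n6 n7 hQ
        have hΓ := (hJ _ n1).1
        have hns := he.2
        simp only [S] at hns
        push Not at hns
        obtain ⟨R, hR, hle⟩ := hns
        have mk : ∀ r : Pt, On g θ r → ev R.1 r = 0 → (θ, r) ∈ ZZ := fun r h1 h2 =>
          Finset.mem_biUnion.2 ⟨θ, hΓ, Finset.mem_image.2 ⟨r, hZ1 θ hΓ hQ R hR r h1 h2, rfl⟩⟩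
        rcases lt_or_eq_of_le hle with hlt | heq
        · obtain ⟨r, r1, r2, r3, r4, r5⟩ := arc_zero n3 n4 n5 n6 R.1 hlt
          refine ⟨(θ, r), mk r r1.1 r5, ?_, r3.le, r4.le⟩
          exact Prod.ext rfl r2
        · rcases mul_eq_zero.1 heq with h0 | h0
          · exact ⟨(θ, p), mk p n3.1 h0, rfl, le_refl _, n6.le⟩
          · exact ⟨(θ, q), mk q n4.1 h0, Prod.ext rfl n5.symm, n6.le, le_refl _⟩
    omega
  -- assemble
  have hT0 : (0:ℝ) ≤ T := by linarith
  have hsq : T ^ (1/2 : ℝ) * T ^ (1/2 : ℝ) = T := by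
    rw [← Real.rpow_add (by linarith)]; norm_num
  have hs1 : 1 ≤ T ^ (1/2 : ℝ) := Real.one_le_rpow hT (by norm_num)
  have hD2 : (D:ℝ) ^ 2 ≤ C ^ 2 * T := by
    calc (D:ℝ) ^ 2 ≤ (C * T ^ (1/2 : ℝ)) ^ 2 := by gcongr
      _ = C ^ 2 * (T ^ (1/2 : ℝ) * T ^ (1/2 : ℝ)) := by ring
      _ = _ := by rw [hsq]
  have tot : (J.card : ℝ) ≤ (P.card + d ^ 2 * D ^ 2) + ((E0.card + (E1.card + E2.card)) + 3 * d ^ 2 * Γ.card) := by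
    rw [← hJs]
    have : J1.card + J2.card ≤ (P.card + d ^ 2 * D ^ 2) + ((E0.card + (E1.card + E2.card)) + 3 * d ^ 2 * Γ.card) := by
      rw [← hEs]; exact Nat.add_le_add hJ1 hJ2
    exact_mod_cast this
  have b0 : (E0.card : ℝ) ≤ ((edgesOf g J \ U).card : ℝ) := by exact_mod_cast hE0
  have b2 : (E2.card : ℝ) ≤ 2 * (Γ.card * (d * (C * T ^ (1/2 : ℝ)))) := by
    calc (E2.card : ℝ) ≤ 2 * (Γ.card * (d * D)) := by exact_mod_cast hE2
      _ ≤ _ := by gcongr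
  have b3 : (d:ℝ) ^ 2 * D ^ 2 ≤ d ^ 2 * C ^ 2 * T := by
    calc _ ≤ (d:ℝ) ^ 2 * (C ^ 2 * T) := by gcongr
      _ = _ := by ring
  have b4 : 3 * (d:ℝ) ^ 2 * Γ.card ≤ 3 * d ^ 2 * Γ.card * T ^ (1/2 : ℝ) :=
    le_mul_of_one_le_right (by positivity) hs1
  have x1 : (d:ℝ) ^ 2 * C ^ 2 * T ≤ (1 + d ^ 2 * C ^ 2 + 3 * d ^ 2 + 2 * d * C) * T := by
    apply mul_le_mul_of_nonneg_right _ hT0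
    have : 0 ≤ 3 * (d:ℝ) ^ 2 + 2 * d * C := by positivity
    linarith
  have x2 : 3 * (d:ℝ) ^ 2 * Γ.card * T ^ (1/2 : ℝ) + 2 * (Γ.card * (d * (C * T ^ (1/2 : ℝ)))) ≤
      (1 + d ^ 2 * C ^ 2 + 3 * d ^ 2 + 2 * d * C) * Γ.card * T ^ (1/2 : ℝ) := by
    have : 0 ≤ (1 + (d:ℝ) ^ 2 * C ^ 2) * (Γ.card * T ^ (1/2 : ℝ)) := by positivity
    linarith
  linarith

lemma st_lemma (d : ℕ) : ∃ C : ℝ, 1 ≤ C ∧ ∀ (g : ℝ[X]) (hg : 2 ≤ g.natDegree) (hd : g.natDegree ≤ d) (Γ : Finset Par)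
    (hirr : ∀ θ ∈ Γ, Irreducible (HH g θ)) (P : Finset Pt) (J : Finset (Par × Pt))
    (hJ : ∀ x ∈ J, x.1 ∈ Γ ∧ x.2 ∈ P ∧ On g x.1 x.2) (U : Finset Edge) (μ : ℝ) (hμ : 1 ≤ μ)
    (hU : ∀ p q : Pt, ((U.filter (fun e => e.2 = (p, q))).card : ℝ) ≤ μ),
    (J.card : ℝ) ≤ C * (μ ^ (1/3 : ℝ) * (P.card : ℝ) ^ (2/3 : ℝ) * (Γ.card : ℝ) ^ (2/3 : ℝ) + μ * P.card + Γ.card) +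
      ((edgesOf g J \ U).card : ℝ) := by
  classical
  obtain ⟨C, hC, hst⟩ := st_core d
  refine ⟨2 * C + 2, by linarith, ?_⟩
  intro g hg hd Γ hirr P J hJ U μ hμ hU
  have hst := hst g hg hd Γ hirr P J hJ U μ (by linarith) hU
  rcases Nat.eq_zero_or_pos P.card with hP0 | hP0
  · have : J = ∅ := by
      rw [Finset.eq_empty_iff_forall_notMem]; intro x hx
      have := (hJ x hx).2.1
      rw [Finset.card_eq_zero.1 hP0] at this
      simp at this
    rw [this]; simp only [Finset.card_empty, Nat.cast_zero]; positivity
  rcases Nat.eq_zero_or_pos Γ.card with hn0 | hn0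
  · have : J = ∅ := by
      rw [Finset.eq_empty_iff_forall_notMem]; intro x hx
      have := (hJ x hx).1
      rw [Finset.card_eq_zero.1 hn0] at this
      simp at this
    rw [this]; simp only [Finset.card_empty, Nat.cast_zero]; positivity
  set m : ℝ := (P.card : ℝ)
  set n : ℝ := (Γ.card : ℝ)
  have hm : 1 ≤ m := by simp only [m]; exact_mod_cast hP0
  have hn : 1 ≤ n := by simp only [n]; exact_mod_cast hn0
  set e0 : ℝ := ((edgesOf g J \ U).card : ℝ)
  set T0 : ℝ := (μ * m ^ 2 / n) ^ (2/3 : ℝ) with hT0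
  have hbase : 0 < μ * m ^ 2 / n := by positivity
  have hmain : 0 ≤ μ ^ (1/3 : ℝ) * m ^ (2/3 : ℝ) * n ^ (2/3 : ℝ) := by positivity
  have hμm : m ≤ μ * m := le_mul_of_one_le_left (by linarith) hμ
  rcases lt_or_ge T0 1 with h1 | h1
  · have hb : μ * m ^ 2 / n < 1 := by
      by_contra hcon
      push Not at hcon
      have := Real.one_le_rpow hcon (z := 2/3) (by norm_num)
      linarith
    rw [div_lt_one (by linarith)] at hb
    have := hst 1 le_rfl
    rw [Real.one_rpow] at this
    have e : C ≤ C * n := le_mul_of_one_le_right (by linarith) hn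
    have e2 : 0 ≤ C * (μ ^ (1/3 : ℝ) * m ^ (2/3 : ℝ) * n ^ (2/3 : ℝ)) := by positivity
    have e3 : 0 ≤ C * (μ * m) := by positivity
    linarith
  rcases le_or_gt T0 m with h2 | h2
  · have := hst T0 h1
    have e1 : T0 ^ (1/2 : ℝ) = (μ * m ^ 2 / n) ^ (1/3 : ℝ) := by
      rw [hT0, ← Real.rpow_mul hbase.le]; norm_num
    have e2 : n * T0 ^ (1/2 : ℝ) = μ ^ (1/3 : ℝ) * m ^ (2/3 : ℝ) * n ^ (2/3 : ℝ) := by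
      rw [e1, Real.div_rpow (by positivity) (by linarith), Real.mul_rpow (by linarith) (by positivity),
        ← Real.rpow_natCast m 2, ← Real.rpow_mul (by linarith)]
      have : n = n ^ (2/3 : ℝ) * n ^ (1/3 : ℝ) := by
        rw [← Real.rpow_add (by linarith), show (2/3 : ℝ) + 1/3 = 1 by norm_num, Real.rpow_one]
      have hp : 0 < n ^ (1/3 : ℝ) := Real.rpow_pos_of_pos (by linarith) _
      have hq : m ^ (((2:ℕ):ℝ) * (1/3)) = m ^ (2/3 : ℝ) := by norm_num
      rw [hq]
      calc n * (μ ^ (1/3 : ℝ) * m ^ (2/3 : ℝ) / n ^ (1/3 : ℝ))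
          = (n ^ (2/3 : ℝ) * n ^ (1/3 : ℝ)) * (μ ^ (1/3 : ℝ) * m ^ (2/3 : ℝ) / n ^ (1/3 : ℝ)) := by rw [← this]
        _ = _ := by
          generalize n ^ (1/3 : ℝ) = s at hp ⊢
          generalize n ^ (2/3 : ℝ) = s'
          generalize m ^ (2/3 : ℝ) = s''
          field_simp
    have e3 : μ * m ^ 2 / T0 = n * T0 ^ (1/2 : ℝ) := by
      have : μ * m ^ 2 / n = T0 * T0 ^ (1/2 : ℝ) := by
        rw [e1, hT0, ← Real.rpow_add hbase]; norm_num
      rw [div_eq_iff (by linarith)]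
      rw [div_eq_iff (by linarith)] at this
      linarith
    rw [e3, mul_assoc C n, e2] at this
    have : C * T0 ≤ C * (μ * m) := by
      apply mul_le_mul_of_nonneg_left _ (by linarith); linarith
    have e4 : 0 ≤ C * (μ ^ (1/3 : ℝ) * m ^ (2/3 : ℝ) * n ^ (2/3 : ℝ)) := by positivity
    have e5 : 0 ≤ C * n := by positivity
    have e6 : 0 ≤ C * (μ * m) := by positivity
    linarith
  · have := hst m hm
    have hm32 : m ^ (3/2 : ℝ) < μ * m ^ 2 / n := by
      have h3 : m ^ (3/2 : ℝ) < T0 ^ (3/2 : ℝ) := Real.rpow_lt_rpow (by linarith) h2 (by norm_num)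
      have h4 : T0 ^ (3/2 : ℝ) = μ * m ^ 2 / n := by
        rw [hT0, ← Real.rpow_mul hbase.le]; norm_num
      linarith
    have e1 : n * m ^ (1/2 : ℝ) ≤ μ * m := by
      rw [lt_div_iff₀ (by linarith)] at hm32
      have h5 : m ^ (3/2 : ℝ) = m ^ (1/2 : ℝ) * m := by
        nth_rewrite 3 [← Real.rpow_one m]; rw [← Real.rpow_add (by linarith)]; norm_num
      rw [h5] at hm32
      nlinarith
    have e2 : μ * m ^ 2 / m = μ * m := by field_simp
    rw [e2] at this
    have e3 : C * n * m ^ (1/2 : ℝ) ≤ C * (μ * m) := by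
      rw [mul_assoc]; exact mul_le_mul_of_nonneg_left e1 (by linarith)
    have e4 : 0 ≤ C * (μ ^ (1/3 : ℝ) * m ^ (2/3 : ℝ) * n ^ (2/3 : ℝ)) := by positivity
    have e5 : 0 ≤ C * n := by positivity
    have e6 : C * m ≤ C * (μ * m) := mul_le_mul_of_nonneg_left hμm (by linarith)
    linarith



/-! ## D7 : analytic part of the lens bound -/

lemma mvt_poly (f : ℝ[X]) {u v : ℝ} (h : u < v) : ∃ c ∈ Set.Ioo u v, f.eval v - f.eval u = f.derivative.eval c * (v - u) := by
  obtain ⟨c, hc, hc0⟩ := exists_hasDerivAt_eq_slope _ _ h (f.continuousOn) (fun x _ => f.hasDerivAt x)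
  refine ⟨c, hc, ?_⟩
  rw [hc0]
  have : v - u ≠ 0 := by linarith
  field_simp

/-- Thom lemma (weak form) -/
lemma thom (N : ℕ) : ∀ (f : ℝ[X]), f.natDegree ≤ N → ∀ u v : ℝ, u ≤ v →
    (∀ j, SignType.sign ((derivative^[j] f).eval u) = SignType.sign ((derivative^[j] f).eval v)) →
    ∀ z ∈ Set.Icc u v, SignType.sign (f.eval z) = SignType.sign (f.eval u) := by
  induction N with
  | zero =>
    intro f hf u v huv hs z hz
    rw [Polynomial.eq_C_of_natDegree_le_zero hf]; simp
  | succ N ih =>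
    intro f hf u v huv hs z hz
    have hf' : f.derivative.natDegree ≤ N := by
      have := Polynomial.natDegree_derivative_le f; omega
    have hd := ih f.derivative hf' u v huv (fun j => by
      have := hs (j+1)
      simpa only [Function.iterate_succ, Function.comp] using this)
    have h0 := hs 0
    simp only [Function.iterate_zero, id] at h0
    rcases eq_or_lt_of_le hz.1 with h1 | h1
    · rw [h1]
    rcases eq_or_lt_of_le hz.2 with h2 | h2
    · rw [h2, h0]
    obtain ⟨c, hc, hce⟩ := mvt_poly f h1
    obtain ⟨c', hc', hce'⟩ := mvt_poly f h2
    have s1 := hd c ⟨hc.1.le, hc.2.le.trans h2.le⟩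
    have s2 := hd c' ⟨h1.le.trans hc'.1.le, hc'.2.le⟩
    have k1 : 0 < z - u := by linarith
    have k2 : 0 < v - z := by linarith
    rcases lt_trichotomy (f.derivative.eval u) 0 with hu | hu | hu
    · rw [sign_neg hu] at s1 s2
      rw [sign_eq_neg_one_iff] at s1 s2
      have m1 : f.eval z ≤ f.eval u := by nlinarith
      have m2 : f.eval v ≤ f.eval z := by nlinarith
      rcases lt_trichotomy (f.eval u) 0 with hh | hh | hh
      · rw [sign_neg hh, sign_neg (by linarith)]
      · rw [hh, sign_zero] at h0
        have := sign_eq_zero_iff.1 h0.symm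
        rw [hh, show f.eval z = 0 by linarith]
      · rw [sign_pos hh] at h0
        have := sign_eq_one_iff.1 h0.symm
        rw [sign_pos hh, sign_pos (by linarith)]
    · rw [hu, sign_zero] at s1
      rw [sign_eq_zero_iff] at s1
      rw [s1, zero_mul] at hce
      rw [show f.eval z = f.eval u by linarith]
    · rw [sign_pos hu] at s1 s2
      rw [sign_eq_one_iff] at s1 s2
      have m1 : f.eval u ≤ f.eval z := by nlinarith
      have m2 : f.eval z ≤ f.eval v := by nlinarith
      rcases lt_trichotomy (f.eval u) 0 with hh | hh | hh
      · rw [sign_neg hh] at h0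
        have := sign_eq_neg_one_iff.1 h0.symm
        rw [sign_neg hh, sign_neg (by linarith)]
      · rw [hh, sign_zero] at h0
        have := sign_eq_zero_iff.1 h0.symm
        rw [hh, show f.eval z = 0 by linarith]
      · rw [sign_pos hh, sign_pos (by linarith)]

/-- consequence: comparison of values -/
lemma thom_cmp (f : ℝ[X]) (u v : ℝ) (huv : u ≤ v)
    (hs : ∀ j, SignType.sign ((derivative^[j+1] f).eval u) = SignType.sign ((derivative^[j+1] f).eval v)) :
    (0 ≤ f.derivative.eval u → f.eval u ≤ f.eval v) ∧ (f.derivative.eval u ≤ 0 → f.eval v ≤ f.eval u) ∧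
    (f.derivative.eval u ≠ 0 → f.eval u = f.eval v → u = v) := by
  rcases eq_or_lt_of_le huv with rfl | h
  · simp
  have hd := thom _ f.derivative le_rfl u v huv (fun j => by
      have := hs j
      simpa only [Function.iterate_succ, Function.comp] using this)
  obtain ⟨c, hc, hce⟩ := mvt_poly f h
  have s1 := hd c ⟨hc.1.le, hc.2.le⟩
  have k1 : 0 < v - u := by linarith
  refine ⟨fun h0 => ?_, fun h0 => ?_, fun h0 h1 => ?_⟩
  · have : 0 ≤ f.derivative.eval c := by rw [← sign_nonneg_iff, s1, sign_nonneg_iff]; exact h0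
    nlinarith
  · have : f.derivative.eval c ≤ 0 := by rw [← sign_nonpos_iff, s1, sign_nonpos_iff]; exact h0
    nlinarith
  · exfalso
    have : f.derivative.eval c = 0 := by
      have : f.derivative.eval c * (v - u) = 0 := by linarith
      rcases mul_eq_zero.1 this with h | h
      · exact h
      · linarith
    rw [this, sign_zero] at s1
    exact h0 (sign_eq_zero_iff.1 s1.symm)

lemma left_deriv {w v : ℝ → ℝ} {s r : ℝ} (hsr : s < r) (hw : ContinuousOn w (Set.Icc s r))
    (hv : ContinuousOn v (Set.Icc s r)) (hd : ∀ x ∈ Set.Ioo s r, HasDerivAt w (v x) x)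
    (h0 : w s = 0) (hpos : ∀ x ∈ Set.Ioo s r, 0 < w x) : 0 ≤ v s := by
  by_contra hneg
  push Not at hneg
  have hc : ContinuousWithinAt v (Set.Icc s r) s := hv s ⟨le_rfl, hsr.le⟩
  have := hc.eventually (gt_mem_nhds hneg)
  rw [eventually_nhdsWithin_iff, Metric.eventually_nhds_iff] at this
  obtain ⟨δ, hδ, hb⟩ := this
  have hmin : s < min (s + δ) r := lt_min (by linarith) hsr
  obtain ⟨x, hx1, hx2⟩ := exists_between hmin
  have hxr : x < r := hx2.trans_le (min_le_right _ _)
  have hxδ : x < s + δ := hx2.trans_le (min_le_left _ _)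
  obtain ⟨c, hc, hce⟩ := exists_hasDerivAt_eq_slope w v hx1 (hw.mono (Set.Icc_subset_Icc_right hxr.le))
    (fun y hy => hd y ⟨hy.1, hy.2.trans hxr⟩)
  have hvc : v c < 0 := hb (by rw [Real.dist_eq, abs_lt]; constructor <;> linarith [hc.1, hc.2]) ⟨hc.1.le, hc.2.le.trans hxr.le⟩
  rw [hce, h0, sub_zero] at hvc
  have := div_pos (hpos x ⟨hx1, hxr⟩) (sub_pos.2 hx1)
  linarith

lemma right_deriv {w v : ℝ → ℝ} {s r : ℝ} (hsr : s < r) (hw : ContinuousOn w (Set.Icc s r))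
    (hv : ContinuousOn v (Set.Icc s r)) (hd : ∀ x ∈ Set.Ioo s r, HasDerivAt w (v x) x)
    (h0 : w r = 0) (hpos : ∀ x ∈ Set.Ioo s r, 0 < w x) : v r ≤ 0 := by
  by_contra hneg
  push Not at hneg
  have hc : ContinuousWithinAt v (Set.Icc s r) r := hv r ⟨hsr.le, le_rfl⟩
  have := hc.eventually (lt_mem_nhds hneg)
  rw [eventually_nhdsWithin_iff, Metric.eventually_nhds_iff] at this
  obtain ⟨δ, hδ, hb⟩ := this
  have hmin : max (r - δ) s < r := max_lt (by linarith) hsr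
  obtain ⟨x, hx1, hx2⟩ := exists_between hmin
  have hxr : s < x := (le_max_right _ _).trans_lt hx1
  have hxδ : r - δ < x := (le_max_left _ _).trans_lt hx1
  obtain ⟨c, hc, hce⟩ := exists_hasDerivAt_eq_slope w v hx2 (hw.mono (Set.Icc_subset_Icc_left hxr.le))
    (fun y hy => hd y ⟨hxr.trans hy.1, hy.2⟩)
  have hvc : 0 < v c := hb (by rw [Real.dist_eq, abs_lt]; constructor <;> linarith [hc.1, hc.2]) ⟨hxr.le.trans hc.1.le, hc.2.le⟩
  rw [hce, h0, zero_sub] at hvc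
  have h1 := hpos x ⟨hxr, hx2⟩
  have := div_neg_of_neg_of_pos (neg_lt_zero.2 h1) (sub_pos.2 hx2)
  linarith

lemma gron {w v : ℝ → ℝ} {s r K : ℝ} (hsr : s < r) (hw : ContinuousOn w (Set.Icc s r))
    (hd : ∀ x ∈ Set.Ioo s r, HasDerivAt w (v x) x) (h0 : w s = 0) (hpos : ∀ x ∈ Set.Ioo s r, 0 < w x)
    (hK : ∀ x ∈ Set.Ioo s r, v x ≤ K * w x) : False := by
  obtain ⟨x, hx1, hx2⟩ := exists_between hsr
  have hphi : ∀ y ∈ Set.Ioo s x, HasDerivAt (fun y => w y * Real.exp (-(K * y)))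
      (v y * Real.exp (-(K*y)) + w y * (Real.exp (-(K * y)) * (-K))) y := by
    intro y hy
    have h1 := hd y ⟨hy.1, hy.2.trans hx2⟩
    have h2 : HasDerivAt (fun y => Real.exp (-(K * y))) (Real.exp (-(K * y)) * (-K)) y := by
      have h3 : HasDerivAt (fun y => -(K * y)) (-K) y := by
        have h4 := ((hasDerivAt_id y).const_mul K).fun_neg
        simpa using h4
      exact h3.exp
    exact h1.mul h2
  obtain ⟨c, hc, hce⟩ := exists_hasDerivAt_eq_slope (fun y => w y * Real.exp (-(K * y))) _ hx1
    ((hw.mono (Set.Icc_subset_Icc_right hx2.le)).mul (by fun_prop)) hphi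
  simp only [h0, zero_mul, sub_zero] at hce
  have h1 := hK c ⟨hc.1, hc.2.trans hx2⟩
  have h2 := Real.exp_pos (-(K*c))
  have h3 : 0 < w x * Real.exp (-(K * x)) / (x - s) :=
    div_pos (mul_pos (hpos x ⟨hx1, hx2⟩) (Real.exp_pos _)) (sub_pos.2 hx1)
  rw [← hce] at h3
  nlinarith

lemma ev3_deriv (Q : Polynomial MP2) (k : ℕ) (p : Pt) (z : ℝ) :
    ev3 (derivative^[k] Q) p z = (derivative^[k] (Q.map (MvPolynomial.eval ![p.1, p.2]))).eval z := by
  unfold ev3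
  rw [Polynomial.iterate_derivative_map]

lemma ev3_contDiff (Q : Polynomial MP2) : ContDiff ℝ 1 (fun v : ℝ × ℝ × ℝ => ev3 Q (v.1, v.2.1) v.2.2) := by
  have hev : ∀ F : MP2, ContDiff ℝ 1 (fun v : ℝ × ℝ × ℝ => ev F (v.1, v.2.1)) := by
    intro F
    induction F using MvPolynomial.induction_on with
    | C a => simp only [ev_C]; exact contDiff_const
    | add F G hF hG => simp only [ev_add]; exact hF.add hG
    | mul_X F i hF =>
      simp only [ev_mul]
      refine hF.mul ?_
      fin_cases i
      · simp only [Fin.zero_eta, ev_X0]; exact contDiff_fst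
      · simp only [Fin.mk_one, ev_X1]; exact contDiff_fst.comp contDiff_snd
  induction Q using Polynomial.induction_on' with
  | add P Q hP hQ => simp only [ev3_add]; exact hP.add hQ
  | monomial n a =>
    simp only [ev3_monomial]
    exact (hev a).mul ((contDiff_snd.comp contDiff_snd).pow n)

/-- implicit Lipschitz estimate -/
lemma implicit_lip (Q : Polynomial MP2) (v : ℝ × ℝ × ℝ) (hz : ev3 (derivative Q) (v.1, v.2.1) v.2.2 ≠ 0) :
    ∃ K : ℝ, ∃ δ > 0, ∀ x y y' z z' : ℝ, |x - v.1| < δ → |y - v.2.1| < δ → |y' - v.2.1| < δ → |z - v.2.2| < δ → |z' - v.2.2| < δ →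
      ev3 Q (x, y) z = 0 → ev3 Q (x, y') z' = 0 → |z - z'| ≤ K * |y - y'| := by
  set f : ℝ × ℝ × ℝ → ℝ := fun v => ev3 Q (v.1, v.2.1) v.2.2 with hf
  have hs : HasStrictFDerivAt f (fderiv ℝ f v) v := (ev3_contDiff Q).contDiffAt.hasStrictFDerivAt (by norm_num)
  set L := fderiv ℝ f v
  have hL : L (0, 0, 1) = ev3 (derivative Q) (v.1, v.2.1) v.2.2 := by
    have h1 : HasDerivAt (fun z : ℝ => ((v.1, v.2.1, z) : ℝ × ℝ × ℝ)) (0, 0, 1) v.2.2 :=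
      (hasDerivAt_const _ _).prodMk ((hasDerivAt_const _ _).prodMk (hasDerivAt_id _))
    have h2 : HasDerivAt (fun z : ℝ => f (v.1, v.2.1, z)) (L (0, 0, 1)) v.2.2 := by
      have := hs.hasFDerivAt
      exact HasFDerivAt.comp_hasDerivAt (f := fun z : ℝ => ((v.1, v.2.1, z) : ℝ × ℝ × ℝ)) v.2.2 this h1
    have h3 : HasDerivAt (fun z : ℝ => f (v.1, v.2.1, z)) (ev3 (derivative Q) (v.1, v.2.1) v.2.2) v.2.2 := by
      have := (Q.map (MvPolynomial.eval ![v.1, v.2.1])).hasDerivAt v.2.2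
      rw [Polynomial.derivative_map] at this
      exact this
    exact h2.unique h3
  rw [← hL] at hz
  set A := L (0, 0, 1)
  set B := L (0, 1, 0)
  have hA : 0 < |A| := abs_pos.2 hz
  have ho := hs.isLittleO.def (c := |A| / 2) (by linarith)
  rw [Metric.eventually_nhds_iff] at ho
  obtain ⟨δ, hδ, hb⟩ := ho
  refine ⟨(|B| + |A| / 2) * 2 / |A|, δ, hδ, ?_⟩
  intro x y y' z z' hx hy hy' hz1 hz2 e1 e2
  have h := hb (y := ((x, y, z), (x, y', z'))) (by
    simp only [Prod.dist_eq, Real.dist_eq, max_lt_iff]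
    exact ⟨⟨hx, hy, hz1⟩, ⟨hx, hy', hz2⟩⟩)
  simp only [hf, e1, e2, sub_self, zero_sub, norm_neg] at h
  have hdec : ((x, y, z) - (x, y', z') : ℝ × ℝ × ℝ) = (y - y') • (0, 1, 0) + (z - z') • (0, 0, 1) := by
    simp
  have hn : ‖((x, y, z) - (x, y', z') : ℝ × ℝ × ℝ)‖ ≤ |y - y'| + |z - z'| := by
    simp only [Prod.mk_sub_mk, sub_self, Prod.norm_def, Real.norm_eq_abs, abs_zero]
    refine max_le (by positivity) (max_le ?_ ?_) <;> linarith [abs_nonneg (y - y'), abs_nonneg (z - z')]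
  rw [hdec, map_add, map_smul, map_smul, ← hdec] at h
  change ‖(y - y') * B + (z - z') * A‖ ≤ _ at h
  rw [Real.norm_eq_abs] at h
  have h3 : |z - z'| * |A| ≤ |(y - y') * B + (z - z') * A| + |y - y'| * |B| := by
    rw [← abs_mul, ← abs_mul]
    have := abs_sub ((y - y') * B + (z - z') * A) ((y - y') * B)
    rwa [add_sub_cancel_left] at this
  have h4 : |A| / 2 * ‖((x, y, z) - (x, y', z') : ℝ × ℝ × ℝ)‖ ≤ |A| / 2 * (|y - y'| + |z - z'|) :=
    mul_le_mul_of_nonneg_left hn (by linarith)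
  rw [div_mul_eq_mul_div, le_div_iff₀ hA]
  nlinarith

/-- the interval where two arcs differ -/
lemma excursion {w : ℝ → ℝ} {x0 x1 : ℝ} (hw : ContinuousOn w (Set.Icc x0 x1)) (h0 : w x0 = 0) (h1 : w x1 = 0)
    (x : ℝ) (hx : x ∈ Set.Icc x0 x1) (hpos : 0 < w x) :
    ∃ s r, x0 ≤ s ∧ s < r ∧ r ≤ x1 ∧ w s = 0 ∧ w r = 0 ∧ ∀ y ∈ Set.Ioo s r, 0 < w y := by
  have hc1 : IsCompact (Set.Icc x0 x ∩ w ⁻¹' {0}) := by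
    refine isCompact_Icc.of_isClosed_subset ?_ Set.inter_subset_left
    exact (hw.mono (Set.Icc_subset_Icc_right hx.2)).preimage_isClosed_of_isClosed isClosed_Icc isClosed_singleton
  have hc2 : IsCompact (Set.Icc x x1 ∩ w ⁻¹' {0}) := by
    refine isCompact_Icc.of_isClosed_subset ?_ Set.inter_subset_left
    exact (hw.mono (Set.Icc_subset_Icc_left hx.1)).preimage_isClosed_of_isClosed isClosed_Icc isClosed_singleton
  obtain ⟨s, ⟨hs1, hs2⟩, hs3⟩ := hc1.exists_isGreatest ⟨x0, ⟨le_rfl, hx.1⟩, h0⟩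
  obtain ⟨r, ⟨hr1, hr2⟩, hr3⟩ := hc2.exists_isLeast ⟨x1, ⟨hx.2, le_rfl⟩, h1⟩
  simp only [Set.mem_preimage, Set.mem_singleton_iff] at hs2 hr2
  have hsx : s < x := lt_of_le_of_ne hs1.2 (by rintro rfl; linarith)
  have hxr : x < r := lt_of_le_of_ne hr1.1 (by rintro rfl; linarith)
  refine ⟨s, r, hs1.1, hsx.trans hxr, hr1.2, hs2, hr2, ?_⟩
  intro y hy
  by_contra hneg
  push Not at hneg
  rcases lt_or_ge y x with hyx | hyx
  · have := intermediate_value_Icc hyx.le (hw.mono (Set.Icc_subset_Icc (hs1.1.trans hy.1.le) hx.2))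
    obtain ⟨c, hc, hc0⟩ := this ⟨hneg, hpos.le⟩
    have := hs3 ⟨⟨hs1.1.trans (hy.1.le.trans hc.1), hc.2⟩, hc0⟩
    linarith [hc.1, hy.1]
  · have := intermediate_value_Icc' hyx (hw.mono (Set.Icc_subset_Icc hx.1 (hy.2.le.trans hr1.2)))
    obtain ⟨c, hc, hc0⟩ := this ⟨hneg, hpos.le⟩
    have := hr3 ⟨⟨hc.1, hc.2.trans (hy.2.le.trans hr1.2)⟩, hc0⟩
    linarith [hc.2, hy.2]

lemma two_arcs_aux (P : Polynomial MP2) {s r : ℝ} (hsr : s < r) {Y1 Y2 Z1 Z2 : ℝ → ℝ}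
    (cY1 : ContinuousOn Y1 (Set.Icc s r)) (cY2 : ContinuousOn Y2 (Set.Icc s r))
    (cZ1 : ContinuousOn Z1 (Set.Icc s r)) (cZ2 : ContinuousOn Z2 (Set.Icc s r))
    (d1 : ∀ x ∈ Set.Ioo s r, HasDerivAt Y1 (Z1 x) x) (d2 : ∀ x ∈ Set.Ioo s r, HasDerivAt Y2 (Z2 x) x)
    (hs : Y1 s = Y2 s) (hr : Y1 r = Y2 r) (hpos : ∀ x ∈ Set.Ioo s r, Y2 x < Y1 x) (τ1 τ2 : ℕ → SignType)
    (t1 : ∀ k, ∀ x ∈ Set.Icc s r, SignType.sign (ev3 (derivative^[k] P) (x, Y1 x) (Z1 x)) = τ1 k)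
    (t2 : ∀ k, ∀ x ∈ Set.Icc s r, SignType.sign (ev3 (derivative^[k] P) (x, Y2 x) (Z2 x)) = τ2 k)
    (hne : ∃ k, τ1 k ≠ 0) : τ1 0 = τ2 0 ∧ τ1 0 ≠ 0 := by
  have ms : s ∈ Set.Icc s r := ⟨le_rfl, hsr.le⟩
  have mr : r ∈ Set.Icc s r := ⟨hsr.le, le_rfl⟩
  have hdw : ∀ x ∈ Set.Ioo s r, HasDerivAt (fun x => Y1 x - Y2 x) (Z1 x - Z2 x) x := fun x hx => (d1 x hx).sub (d2 x hx)
  have hpos' : ∀ x ∈ Set.Ioo s r, 0 < (fun x => Y1 x - Y2 x) x := fun x hx => sub_pos.2 (hpos x hx)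
  have zs : Z2 s ≤ Z1 s := by
    have := left_deriv (w := fun x => Y1 x - Y2 x) (v := fun x => Z1 x - Z2 x) hsr (cY1.sub cY2) (cZ1.sub cZ2) hdw
      (by simp [hs]) hpos'
    simpa using this
  have zr : Z1 r ≤ Z2 r := by
    have := right_deriv (w := fun x => Y1 x - Y2 x) (v := fun x => Z1 x - Z2 x) hsr (cY1.sub cY2) (cZ1.sub cZ2) hdw
      (by simp [hr]) hpos'
    simpa using this
  set fs := P.map (MvPolynomial.eval ![s, Y1 s]) with hfs
  set fr := P.map (MvPolynomial.eval ![r, Y1 r]) with hfr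
  have s1 : ∀ k, SignType.sign ((derivative^[k] fs).eval (Z1 s)) = τ1 k := fun k => by
    rw [← t1 k s ms, ev3_deriv]
  have s2 : ∀ k, SignType.sign ((derivative^[k] fs).eval (Z2 s)) = τ2 k := fun k => by
    rw [← t2 k s ms, ev3_deriv, hfs, hs]
  have r1 : ∀ k, SignType.sign ((derivative^[k] fr).eval (Z1 r)) = τ1 k := fun k => by
    rw [← t1 k r mr, ev3_deriv]
  have r2 : ∀ k, SignType.sign ((derivative^[k] fr).eval (Z2 r)) = τ2 k := fun k => by
    rw [← t2 k r mr, ev3_deriv, hfr, hr]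
  have step : ∀ k, (∀ j, k < j → τ1 j = τ2 j) → τ1 k = τ2 k := by
    intro k hk
    have hd : ∀ f : ℝ[X], (derivative^[k] f).derivative = derivative^[k+1] f := fun f => by
      rw [Function.iterate_succ', Function.comp]
    have hj : ∀ (f : ℝ[X]) j, derivative^[j+1] (derivative^[k] f) = derivative^[j+1+k] f := fun f j => by
      rw [Function.iterate_add_apply derivative (j+1) k]
    have a := thom_cmp (derivative^[k] fs) (Z2 s) (Z1 s) zs (fun j => by
      rw [hj, s1, s2, hk _ (by omega)])
    have b := thom_cmp (derivative^[k] fr) (Z1 r) (Z2 r) zr (fun j => by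
      rw [hj, r1, r2, hk _ (by omega)])
    have e1 := hk (k+1) (by omega)
    rcases le_total 0 ((derivative^[k+1] fs).eval (Z2 s)) with h | h
    · have h' : 0 ≤ (derivative^[k+1] fr).eval (Z1 r) := by
        rw [← sign_nonneg_iff, r1, e1, ← s2, sign_nonneg_iff]; exact h
      have u1 := a.1 (by rw [hd]; exact h)
      have u2 := b.1 (by rw [hd]; exact h')
      have v1 := SignType.sign.monotone u1
      have v2 := SignType.sign.monotone u2
      rw [s1, s2] at v1
      rw [r1, r2] at v2
      exact le_antisymm v2 v1
    · have h' : (derivative^[k+1] fr).eval (Z1 r) ≤ 0 := by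
        rw [← sign_nonpos_iff, r1, e1, ← s2, sign_nonpos_iff]; exact h
      have u1 := a.2.1 (by rw [hd]; exact h)
      have u2 := b.2.1 (by rw [hd]; exact h')
      have v1 := SignType.sign.monotone u1
      have v2 := SignType.sign.monotone u2
      rw [s1, s2] at v1
      rw [r1, r2] at v2
      exact le_antisymm v1 v2
  have hbig : ∀ j, P.natDegree < j → τ1 j = τ2 j := by
    intro j hj
    have : derivative^[j] P = 0 := Polynomial.iterate_derivative_eq_zero hj
    rw [← t1 j s ms, ← t2 j s ms, this]; simp [ev3]
  have hall : ∀ m k, P.natDegree < k + m → τ1 k = τ2 k := by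
    intro m
    induction m with
    | zero => intro k hk; exact hbig k (by omega)
    | succ m ih => intro k hk; exact step k (fun j hj => ih j (by omega))
  have heq : ∀ k, τ1 k = τ2 k := fun k => hall (P.natDegree + 1) k (by omega)
  refine ⟨heq 0, fun h0 => ?_⟩
  classical
  set k := Nat.find hne with hk
  have hkne : τ1 k ≠ 0 := Nat.find_spec hne
  have hkpos : k ≠ 0 := by intro h; rw [h] at hkne; exact hkne h0
  obtain ⟨l, hl⟩ := Nat.exists_eq_succ_of_ne_zero hkpos
  have hl0 : τ1 l = 0 := by
    by_contra hcon
    have := Nat.find_min' hne hcon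
    omega
  set Q := derivative^[l] P with hQ
  have hQd : derivative Q = derivative^[k] P := by rw [hQ, hl, Function.iterate_succ', Function.comp]
  have q1 : ∀ x ∈ Set.Icc s r, ev3 Q (x, Y1 x) (Z1 x) = 0 := fun x hx => by
    rw [← sign_eq_zero_iff, t1 l x hx, hl0]
  have q2 : ∀ x ∈ Set.Icc s r, ev3 Q (x, Y2 x) (Z2 x) = 0 := fun x hx => by
    rw [← sign_eq_zero_iff, t2 l x hx, ← heq, hl0]
  have hzeq : Z2 s = Z1 s := by
    have a := thom_cmp (derivative^[l] fs) (Z2 s) (Z1 s) zs (fun j => by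
      rw [← Function.iterate_add_apply derivative (j+1) l, s1, s2, heq])
    have hd : (derivative^[l] fs).derivative = derivative^[k] fs := by
      rw [hl, Function.iterate_succ', Function.comp]
    rw [hd] at a
    refine a.2.2 ?_ ?_
    · intro h
      have := s2 k
      rw [h, sign_zero, ← heq] at this
      exact hkne this.symm
    · have h1 := s1 l
      have h2 := s2 l
      rw [hl0, sign_eq_zero_iff] at h1
      rw [← heq, hl0, sign_eq_zero_iff] at h2
      rw [h1, h2]
  obtain ⟨K, δ, hδ, hlip⟩ := implicit_lip Q (s, Y1 s, Z1 s) (by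
    rw [hQd]
    intro h
    have := t1 k s ms
    rw [h, sign_zero] at this
    exact hkne this.symm)
  have near : ∀ f : ℝ → ℝ, ContinuousOn f (Set.Icc s r) → ∃ ρ > 0, ∀ x ∈ Set.Icc s r, |x - s| < ρ → |f x - f s| < δ := by
    intro f hf
    obtain ⟨ρ, h1, h2⟩ := Metric.continuousWithinAt_iff.1 (hf s ms) δ hδ
    exact ⟨ρ, h1, fun x hx h => h2 hx h⟩
  obtain ⟨ρ1, p1, n1⟩ := near Y1 cY1
  obtain ⟨ρ2, p2, n2⟩ := near Y2 cY2
  obtain ⟨ρ3, p3, n3⟩ := near Z1 cZ1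
  obtain ⟨ρ4, p4, n4⟩ := near Z2 cZ2
  set ρ := min (min (min ρ1 ρ2) (min ρ3 ρ4)) δ with hρ
  have hρpos : 0 < ρ := by simp only [hρ, lt_min_iff]; exact ⟨⟨⟨p1, p2⟩, p3, p4⟩, hδ⟩
  set r' := min r (s + ρ) with hr'
  have hsr' : s < r' := lt_min hsr (by linarith)
  have hr'r : r' ≤ r := min_le_left _ _
  refine gron (w := fun x => Y1 x - Y2 x) (v := fun x => Z1 x - Z2 x) (K := K) hsr'
    ((cY1.sub cY2).mono (Set.Icc_subset_Icc_right hr'r)) (fun x hx => hdw x ⟨hx.1, hx.2.trans_le hr'r⟩) (by simp [hs])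
    (fun x hx => hpos' x ⟨hx.1, hx.2.trans_le hr'r⟩) ?_
  intro x hx
  have hxm : x ∈ Set.Icc s r := ⟨hx.1.le, (hx.2.trans_le hr'r).le⟩
  have hxρ : |x - s| < ρ := by
    rw [abs_of_pos (by linarith [hx.1])]
    have := hx.2.trans_le (min_le_right r (s+ρ))
    linarith
  have hρs := hxρ
  simp only [hρ, lt_min_iff] at hρs
  have := hlip x (Y1 x) (Y2 x) (Z1 x) (Z2 x) hρs.2 (n1 x hxm hρs.1.1.1) (by simp only; rw [hs]; exact n2 x hxm hρs.1.1.2)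
    (n3 x hxm hρs.1.2.1) (by simp only; rw [← hzeq]; exact n4 x hxm hρs.1.2.2) (q1 x hxm) (q2 x hxm)
  have hw := hpos' x ⟨hx.1, hx.2.trans_le hr'r⟩
  simp only at hw ⊢
  rw [abs_of_pos hw] at this
  exact (le_abs_self _).trans this

lemma two_arcs (P : Polynomial MP2) {x0 x1 : ℝ} {Y1 Y2 Z1 Z2 : ℝ → ℝ}
    (cY1 : ContinuousOn Y1 (Set.Icc x0 x1)) (cY2 : ContinuousOn Y2 (Set.Icc x0 x1))
    (cZ1 : ContinuousOn Z1 (Set.Icc x0 x1)) (cZ2 : ContinuousOn Z2 (Set.Icc x0 x1))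
    (d1 : ∀ x ∈ Set.Ioo x0 x1, HasDerivAt Y1 (Z1 x) x) (d2 : ∀ x ∈ Set.Ioo x0 x1, HasDerivAt Y2 (Z2 x) x)
    (hs : Y1 x0 = Y2 x0) (hr : Y1 x1 = Y2 x1) (hdiff : ∃ x ∈ Set.Icc x0 x1, Y1 x ≠ Y2 x) (τ1 τ2 : ℕ → SignType)
    (t1 : ∀ k, ∀ x ∈ Set.Icc x0 x1, SignType.sign (ev3 (derivative^[k] P) (x, Y1 x) (Z1 x)) = τ1 k)
    (t2 : ∀ k, ∀ x ∈ Set.Icc x0 x1, SignType.sign (ev3 (derivative^[k] P) (x, Y2 x) (Z2 x)) = τ2 k)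
    (hne1 : ∃ k, τ1 k ≠ 0) (hne2 : ∃ k, τ2 k ≠ 0) : τ1 0 = τ2 0 ∧ τ1 0 ≠ 0 := by
  obtain ⟨x, hx, hxne⟩ := hdiff
  wlog hlt : Y2 x < Y1 x generalizing Y1 Y2 Z1 Z2 τ1 τ2
  · have := this cY2 cY1 cZ2 cZ1 d2 d1 hs.symm hr.symm τ2 τ1 t2 t1 hne2 hne1 hxne.symm
      (lt_of_le_of_ne (le_of_not_gt hlt) hxne)
    exact ⟨this.1.symm, by rw [← this.1]; exact this.2⟩
  obtain ⟨s, r, h1, h2, h3, h4, h5, h6⟩ := excursion (w := fun x => Y1 x - Y2 x) (cY1.sub cY2) (by simp [hs]) (by simp [hr]) x hx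
    (by simpa using hlt)
  have hsub : Set.Icc s r ⊆ Set.Icc x0 x1 := Set.Icc_subset_Icc h1 h3
  have hsub' : Set.Ioo s r ⊆ Set.Ioo x0 x1 := Set.Ioo_subset_Ioo h1 h3
  exact two_arcs_aux P h2 (cY1.mono hsub) (cY2.mono hsub) (cZ1.mono hsub) (cZ2.mono hsub) (fun x hx => d1 x (hsub' hx))
    (fun x hx => d2 x (hsub' hx)) (sub_eq_zero.1 h4) (sub_eq_zero.1 h5) (fun x hx => sub_pos.1 (h6 x hx)) τ1 τ2
    (fun k x hx => t1 k x (hsub hx)) (fun k x hx => t2 k x (hsub hx)) hne1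



/-! ## D8 : the lens bound, algebraic and counting parts -/

noncomputable def Zt (g : ℝ[X]) (θ : Par) (p : Pt) : ℝ :=
  (pa g θ).derivative.eval p.1 / (pb g θ).derivative.eval p.2

noncomputable def hatP (g : ℝ[X]) (e : ℕ) (Q : Polynomial MP2) (θ : Par) : MP2 :=
  ∑ i ∈ Finset.range (e+1), Q.coeff i * (Polynomial.aeval (MvPolynomial.X 0 : MP2) (pa g θ).derivative) ^ i *
    (Polynomial.aeval (MvPolynomial.X 1 : MP2) (pb g θ).derivative) ^ (2 * e - i)

lemma ev3_sum_range (e : ℕ) (Q : Polynomial MP2) (hQ : Q.natDegree ≤ e) (p : Pt) (z : ℝ) :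
    ev3 Q p z = ∑ i ∈ Finset.range (e+1), ev (Q.coeff i) p * z ^ i := by
  unfold ev3
  rw [Polynomial.eval_eq_sum_range' (n := e+1) (Nat.lt_succ_of_le ((Polynomial.natDegree_map_le).trans hQ))]
  simp [Polynomial.coeff_map, ev]

lemma ev_hatP (g : ℝ[X]) (e : ℕ) (Q : Polynomial MP2) (hQ : Q.natDegree ≤ e) (θ : Par) (p : Pt) (h : Reg g θ p) :
    ev (hatP g e Q θ) p = ev3 Q p (Zt g θ p) * ((pb g θ).derivative.eval p.2) ^ (2 * e) := by
  rw [ev3_sum_range e Q hQ, Finset.sum_mul]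
  unfold hatP
  rw [ev_sum]
  refine Finset.sum_congr rfl fun i hi => ?_
  have hb := h.2.2
  rw [Finset.mem_range] at hi
  simp only [ev_mul, ev_pow, ev_aeval, ev_X0, ev_X1, Zt]
  have : (pb g θ).derivative.eval p.2 ^ (2 * e) = (pb g θ).derivative.eval p.2 ^ i * (pb g θ).derivative.eval p.2 ^ (2 * e - i) := by
    rw [← pow_add]; congr 1; omega
  rw [this, div_pow]
  field_simp

lemma hatP_deg (g : ℝ[X]) (d : ℕ) (hd : g.natDegree ≤ d) (e : ℕ) (Q : Polynomial MP2) (hc : ∀ k, (Q.coeff k).totalDegree ≤ e) (θ : Par) :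
    (hatP g e Q θ).totalDegree ≤ (1 + 2 * d) * e := by
  refine MvPolynomial.totalDegree_finsetSum_le fun i hi => ?_
  rw [Finset.mem_range] at hi
  have hA : (Polynomial.aeval (MvPolynomial.X 0 : MP2) (pa g θ).derivative).totalDegree ≤ d := by
    refine (deg_aeval_le _ _ 1 (by simp)).trans ?_
    have := Polynomial.natDegree_derivative_le (pa g θ)
    have := pa_deg g θ
    omega
  have hB : (Polynomial.aeval (MvPolynomial.X 1 : MP2) (pb g θ).derivative).totalDegree ≤ d := by
    refine (deg_aeval_le _ _ 1 (by simp)).trans ?_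
    have := Polynomial.natDegree_derivative_le (pb g θ)
    have := pb_deg g θ
    omega
  refine (MvPolynomial.totalDegree_mul _ _).trans ?_
  have h1 := (MvPolynomial.totalDegree_mul (Q.coeff i) ((Polynomial.aeval (MvPolynomial.X 0 : MP2) (pa g θ).derivative) ^ i))
  have h2 := MvPolynomial.totalDegree_pow (Polynomial.aeval (MvPolynomial.X 0 : MP2) (pa g θ).derivative) i
  have h3 := MvPolynomial.totalDegree_pow (Polynomial.aeval (MvPolynomial.X 1 : MP2) (pb g θ).derivative) (2 * e - i)
  have h4 := hc i
  have h5 := Nat.mul_le_mul_left i hA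
  have h6 := Nat.mul_le_mul_left (2 * e - i) hB
  have h7 : i * d + (2 * e - i) * d = 2 * e * d := by rw [← add_mul]; congr 1; omega
  have h8 : (1 + 2 * d) * e = e + 2 * e * d := by ring
  omega

lemma Poly3.nd' (P : Poly3) (k : ℕ) : (derivative^[k] P.P).natDegree ≤ P.e :=
  (Polynomial.natDegree_iterate_derivative _ _).trans ((Nat.sub_le _ _).trans P.nd)

lemma Poly3.cd' (P : Poly3) (k i : ℕ) : ((derivative^[k] P.P).coeff i).totalDegree ≤ P.e := by
  rw [Polynomial.coeff_iterate_derivative]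
  refine le_trans ?_ (P.cd (i + k))
  rw [nsmul_eq_mul]
  refine (MvPolynomial.totalDegree_mul _ _).trans ?_
  have : ((((i + k).descFactorial k : ℕ)) : MP2).totalDegree = 0 := by
    have : ((((i + k).descFactorial k : ℕ)) : MP2) = MvPolynomial.C (((i + k).descFactorial k : ℕ) : ℝ) := by simp
    rw [this, MvPolynomial.totalDegree_C]
  omega

lemma aeval_C_eq (y : ℝ) (q : ℝ[X]) : Polynomial.aeval (C y : ℝ[X]) q = C (q.eval y) := by
  have h := Polynomial.aeval_algebraMap_apply (A := ℝ) ℝ[X] y q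
  simpa [Polynomial.algebraMap_eq, Polynomial.coe_aeval_eq_eval] using h

lemma HH_not_dvd_B (g : ℝ[X]) (hg : 2 ≤ g.natDegree) (θ : Par) :
    ¬ HH g θ ∣ Polynomial.aeval (MvPolynomial.X 1 : MP2) (pb g θ).derivative := by
  intro h
  have hb : (pb g θ).derivative ≠ 0 := by
    intro h0
    have := Polynomial.derivative_eq_zero.1 h0
    rw [pb_deg] at this; omega
  obtain ⟨y, hy⟩ : ∃ y, (pb g θ).derivative.eval y ≠ 0 := by
    by_contra hcon
    push Not at hcon
    exact hb (Polynomial.funext (by simpa using hcon))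
  let φ : MP2 →ₐ[ℝ] ℝ[X] := MvPolynomial.aeval ![X, C y]
  have h1 := map_dvd φ h
  have e1 : φ (HH g θ) = pa g θ - C ((pb g θ).eval y) := by
    simp only [HH, sepP, map_sub, ← Polynomial.aeval_algHom_apply, φ, MvPolynomial.aeval_X]
    simp [aeval_C_eq, Polynomial.aeval_X_left_apply]
  have e2 : φ (Polynomial.aeval (MvPolynomial.X 1 : MP2) (pb g θ).derivative) = C ((pb g θ).derivative.eval y) := by
    simp only [← Polynomial.aeval_algHom_apply, φ, MvPolynomial.aeval_X]
    simp [aeval_C_eq]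
  rw [e1, e2] at h1
  have h2 : IsUnit (pa g θ - C ((pb g θ).eval y)) :=
    isUnit_of_dvd_unit h1 (Polynomial.isUnit_C.2 (isUnit_iff_ne_zero.2 hy))
  have h3 := Polynomial.natDegree_eq_zero_of_isUnit h2
  rw [Polynomial.natDegree_sub_C, pa_deg] at h3
  omega

lemma special_dvd (g : ℝ[X]) (hg : 2 ≤ g.natDegree) (θ : Par) (hirr : Irreducible (HH g θ)) (P : Poly3)
    (h : ∀ k ≤ P.e, HH g θ ∣ hatP g P.e (derivative^[k] P.P) θ) : HH g θ ∣ P.P.leadingCoeff := by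
  have h1 := h P.P.natDegree P.nd
  have hnat : (derivative^[P.P.natDegree] P.P).natDegree = 0 := by
    have := Polynomial.natDegree_iterate_derivative P.P P.P.natDegree
    omega
  have h2 : hatP g P.e (derivative^[P.P.natDegree] P.P) θ =
      (derivative^[P.P.natDegree] P.P).coeff 0 * (Polynomial.aeval (MvPolynomial.X 1 : MP2) (pb g θ).derivative) ^ (2 * P.e) := by
    unfold hatP
    rw [Finset.sum_eq_single 0]
    · simp
    · intro i _ hi
      rw [Polynomial.coeff_eq_zero_of_natDegree_lt (by omega)]; simp
    · simp
  rw [h2] at h1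
  have hp := hirr.prime
  rcases hp.dvd_or_dvd h1 with h3 | h3
  · rw [Polynomial.coeff_iterate_derivative, zero_add, nsmul_eq_mul] at h3
    rcases hp.dvd_or_dvd h3 with h4 | h4
    · exfalso
      have e : (((P.P.natDegree.descFactorial P.P.natDegree : ℕ)) : MP2) = MvPolynomial.C ((P.P.natDegree.descFactorial P.P.natDegree : ℕ) : ℝ) := by simp
      rw [e] at h4
      apply hirr.not_isUnit
      refine isUnit_of_dvd_unit h4 (IsUnit.map _ (isUnit_iff_ne_zero.2 ?_))
      rw [Nat.descFactorial_self]
      exact_mod_cast Nat.factorial_ne_zero _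
    · exact h4
  · exact absurd (hp.dvd_of_dvd_pow h3) (HH_not_dvd_B g hg θ)

def Special (g : ℝ[X]) (Ps : List Poly3) (θ : Par) : Prop :=
  ∃ P ∈ Ps, ∀ k ≤ P.e, HH g θ ∣ hatP g P.e (derivative^[k] P.P) θ

lemma special_count (g : ℝ[X]) (hg : 2 ≤ g.natDegree) (Γ : Finset Par) (hirr : ∀ θ ∈ Γ, Irreducible (HH g θ))
    (Ps : List Poly3) (h : ∀ θ ∈ Γ, Special g Ps θ) : Γ.card ≤ (Ps.map (fun P => P.e)).sum := by
  classical
  induction Ps generalizing Γ with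
  | nil =>
    have : Γ = ∅ := by
      rw [Finset.eq_empty_iff_forall_notMem]; intro θ hθ; obtain ⟨P, hP, _⟩ := h θ hθ; simp at hP
    simp [this]
  | cons P Ps ih =>
    have h1 : (Γ.filter (fun θ => ∀ k ≤ P.e, HH g θ ∣ hatP g P.e (derivative^[k] P.P) θ)).card ≤ P.e := by
      refine (HH_dvd_count g hg _ (fun θ hθ => hirr θ (Finset.mem_filter.1 hθ).1) P.P.leadingCoeff
        (Polynomial.leadingCoeff_ne_zero.2 P.ne) (fun θ hθ => ?_)).trans (P.cd _)
      have hθ := Finset.mem_filter.1 hθ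
      exact special_dvd g hg θ (hirr θ hθ.1) P hθ.2
    have h2 := ih (Γ.filter (fun θ => ¬ ∀ k ≤ P.e, HH g θ ∣ hatP g P.e (derivative^[k] P.P) θ))
      (fun θ hθ => hirr θ (Finset.mem_filter.1 hθ).1) (by
      intro θ hθ
      rw [Finset.mem_filter] at hθ
      obtain ⟨Q, hQ, hd⟩ := h θ hθ.1
      rcases List.mem_cons.1 hQ with rfl | hQ
      · exact absurd hd hθ.2
      · exact ⟨Q, hQ, hd⟩)
    have := Finset.card_filter_add_card_filter_not (s := Γ) (fun θ => ∀ k ≤ P.e, HH g θ ∣ hatP g P.e (derivative^[k] P.P) θ)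
    simp only [List.map_cons, List.sum_cons]
    omega

/-- zeros hitting the curve -/
lemma hit_zeros (g : ℝ[X]) (d : ℕ) (hd : g.natDegree ≤ d) (θ : Par) (hirr : Irreducible (HH g θ)) (D : ℕ) (Ps : List Poly3)
    (hD : ∀ P ∈ Ps, P.e ≤ D) :
    ∃ Z : Finset Pt, (∀ P ∈ Ps, ∀ k ≤ P.e, ¬ HH g θ ∣ hatP g P.e (derivative^[k] P.P) θ → ∀ r, On g θ r →
      ev (hatP g P.e (derivative^[k] P.P) θ) r = 0 → r ∈ Z) ∧ Z.card ≤ (D + 1) * (d * (1 + 2 * d)) * (Ps.map (fun P => P.e)).sum := by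
  classical
  induction Ps with
  | nil => exact ⟨∅, by simp, by simp⟩
  | cons P Ps ih =>
    obtain ⟨Z, h1, h2⟩ := ih (fun Q hQ => hD Q (List.mem_cons_of_mem _ hQ))
    have hk : ∀ k : ℕ, ∃ W : Finset Pt, (¬ HH g θ ∣ hatP g P.e (derivative^[k] P.P) θ → ∀ r, On g θ r →
      ev (hatP g P.e (derivative^[k] P.P) θ) r = 0 → r ∈ W) ∧ W.card ≤ d * ((1 + 2 * d) * P.e) := by
      intro k
      by_cases h : HH g θ ∣ hatP g P.e (derivative^[k] P.P) θ
      · exact ⟨∅, fun hh => absurd h hh, by simp⟩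
      · obtain ⟨W, w1, w2⟩ := common_zeros _ _ hirr h
        refine ⟨W, fun _ r hr hr' => w1 r ((on_iff _ _ _).1 hr) hr', w2.trans ?_⟩
        exact Nat.mul_le_mul (HH_deg g θ d hd) (hatP_deg g d hd _ _ (P.cd' k) θ)
    choose W w1 w2 using hk
    refine ⟨((Finset.range (P.e + 1)).biUnion W) ∪ Z, ?_, ?_⟩
    · intro Q hQ k hk hnd r hr hr'
      rcases List.mem_cons.1 hQ with rfl | hQ
      · exact Finset.mem_union_left _ (Finset.mem_biUnion.2 ⟨k, Finset.mem_range.2 (by omega), w1 k hnd r hr hr'⟩)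
      · exact Finset.mem_union_right _ (h1 Q hQ k hk hnd r hr hr')
    · refine (Finset.card_union_le _ _).trans ?_
      have h3 := Finset.card_biUnion_le_card_mul (Finset.range (P.e+1)) W _ (fun k _ => w2 k)
      rw [Finset.card_range] at h3
      have h4 : (P.e + 1) * (d * ((1 + 2 * d) * P.e)) ≤ (D + 1) * (d * ((1 + 2 * d) * P.e)) :=
        Nat.mul_le_mul_right _ (by have := hD P List.mem_cons_self; omega)
      simp only [List.map_cons, List.sum_cons]
      have h5 : (D + 1) * (d * ((1 + 2 * d) * P.e)) = (D + 1) * (d * (1 + 2 * d)) * P.e := by ring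
      rw [mul_add]
      omega

/-- valid edges -/
def Val (g : ℝ[X]) (e : Edge) : Prop :=
  Reg g e.1 e.2.1 ∧ Reg g e.1 e.2.2 ∧ arc g e.1 e.2.1 = arc g e.1 e.2.2 ∧ e.2.1.1 < e.2.2.1

def Unhit (g : ℝ[X]) (Ps : List Poly3) (e : Edge) : Prop :=
  ∀ P ∈ Ps, ∀ k ≤ P.e, ¬ HH g e.1 ∣ hatP g P.e (derivative^[k] P.P) e.1 → ∀ r, Reg g e.1 r → arc g e.1 r = arc g e.1 e.2.1 →
    e.2.1.1 ≤ r.1 → r.1 ≤ e.2.2.1 → ev (hatP g P.e (derivative^[k] P.P) e.1) r ≠ 0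

lemma sign_hat (g : ℝ[X]) (e : ℕ) (Q : Polynomial MP2) (hQ : Q.natDegree ≤ e) (θ : Par) (p : Pt) (h : Reg g θ p) :
    SignType.sign (ev (hatP g e Q θ) p) = SignType.sign (ev3 Q p (Zt g θ p)) := by
  have hb := h.2.2
  have : 0 < ((pb g θ).derivative.eval p.2) ^ (2 * e) := by rw [pow_mul]; positivity
  rw [ev_hatP g e Q hQ θ p h, sign_mul, sign_pos this, mul_one]

lemma dvd_zero_on (g : ℝ[X]) (θ : Par) (F : MP2) (h : HH g θ ∣ F) (p : Pt) (hp : On g θ p) : ev F p = 0 := by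
  obtain ⟨W, rfl⟩ := h
  rw [ev_mul, (on_iff _ _ _).1 hp, zero_mul]

lemma edge_lift (g : ℝ[X]) (Ps : List Poly3) (e : Edge) (hv : Val g e) (hu : Unhit g Ps e) (hs : ¬ Special g Ps e.1) :
    ∃ Y Z : ℝ → ℝ, ContinuousOn Y (Set.Icc e.2.1.1 e.2.2.1) ∧ ContinuousOn Z (Set.Icc e.2.1.1 e.2.2.1) ∧
      (∀ x ∈ Set.Ioo e.2.1.1 e.2.2.1, HasDerivAt Y (Z x) x) ∧ Y e.2.1.1 = e.2.1.2 ∧ Y e.2.2.1 = e.2.2.2 ∧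
      (∀ x ∈ Set.Icc e.2.1.1 e.2.2.1, On g e.1 (x, Y x)) ∧
      ∀ P ∈ Ps, (∀ k, ∀ x ∈ Set.Icc e.2.1.1 e.2.2.1, SignType.sign (ev3 (derivative^[k] P.P) (x, Y x) (Z x)) =
        SignType.sign (ev3 (derivative^[k] P.P) e.2.1 (Zt g e.1 e.2.1))) ∧
        ∃ k, SignType.sign (ev3 (derivative^[k] P.P) e.2.1 (Zt g e.1 e.2.1)) ≠ 0 := by
  obtain ⟨θ, p, q⟩ := e
  obtain ⟨v1, v2, v3, v4⟩ := hv
  simp only at v1 v2 v3 v4 ⊢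
  obtain ⟨Y, h0, h1, hc, hY, hd⟩ := arc_between v1 v2 v3 v4
  refine ⟨Y, fun x => Zt g θ (x, Y x), hc, ?_, hd, h0, h1, fun x hx => (hY x hx).1.1, ?_⟩
  · simp only [Zt]
    refine ContinuousOn.div ((pa g θ).derivative.continuousOn) ((pb g θ).derivative.continuous.comp_continuousOn hc) ?_
    intro x hx
    exact (hY x hx).1.2.2
  intro P hP
  constructor
  · intro k x hx
    have hreg : Reg g θ (x, Y x) := (hY x hx).1
    have harc : arc g θ (x, Y x) = arc g θ p := (hY x hx).2
    rw [← sign_hat g P.e _ (P.nd' k) θ _ hreg, ← sign_hat g P.e _ (P.nd' k) θ _ v1]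
    by_cases hdv : HH g θ ∣ hatP g P.e (derivative^[k] P.P) θ
    · rw [dvd_zero_on g θ _ hdv _ hreg.on, dvd_zero_on g θ _ hdv _ v1.on]
    by_cases hk : k ≤ P.e
    · have hx' := hu P hP k hk hdv (x, Y x) hreg harc hx.1 hx.2
      have hp' := hu P hP k hk hdv p v1 rfl le_rfl v4.le
      rcases eq_or_lt_of_le hx.1 with heq | hlt
      · have : (x, Y x) = p := Prod.ext heq.symm (by simp only; rw [← heq, h0])
        rw [this]
      · by_contra hne
        have hprod : ev (hatP g P.e (derivative^[k] P.P) θ) p * ev (hatP g P.e (derivative^[k] P.P) θ) (x, Y x) < 0 := by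
          rcases lt_or_gt_of_ne hx' with a | a <;> rcases lt_or_gt_of_ne hp' with b | b
          · exact absurd (by rw [sign_neg a, sign_neg b]) hne
          · exact mul_neg_of_pos_of_neg b a
          · exact mul_neg_of_neg_of_pos b a
          · exact absurd (by rw [sign_pos a, sign_pos b]) hne
        obtain ⟨r, r1, r2, r3, r4, r5⟩ := arc_zero v1 hreg harc.symm hlt _ hprod
        exact hu P hP k hk hdv r r1 r2 r3.le (r4.le.trans hx.2) r5
    · have : derivative^[k] P.P = 0 := Polynomial.iterate_derivative_eq_zero (by have := P.nd; omega)
      rw [this]; simp [hatP, ev]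
  · have : ∃ k ≤ P.e, ¬ HH g θ ∣ hatP g P.e (derivative^[k] P.P) θ := by
      by_contra hcon
      push Not at hcon
      exact hs ⟨P, hP, hcon⟩
    obtain ⟨k, hk, hdv⟩ := this
    refine ⟨k, ?_⟩
    rw [← sign_hat g P.e _ (P.nd' k) θ _ v1]
    intro h
    exact hu P hP k hk hdv p v1 rfl le_rfl v4.le (sign_eq_zero_iff.1 h)

lemma same_class (g : ℝ[X]) (hg : 2 ≤ g.natDegree) (Ps : List Poly3) (θ1 θ2 : Par) (p q : Pt) (hne : θ1 ≠ θ2)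
    (i1 : Irreducible (HH g θ1)) (i2 : Irreducible (HH g θ2))
    (v1 : Val g (θ1, p, q)) (v2 : Val g (θ2, p, q)) (u1 : Unhit g Ps (θ1, p, q)) (u2 : Unhit g Ps (θ2, p, q))
    (s1 : ¬ Special g Ps θ1) (s2 : ¬ Special g Ps θ2) : ∀ P ∈ Ps, 0 < ev3 P.P p (Zt g θ1 p) * ev3 P.P p (Zt g θ2 p) := by
  obtain ⟨Y1, Z1, a1, a2, a3, a4, a5, a6, a7⟩ := edge_lift g Ps _ v1 u1 s1
  obtain ⟨Y2, Z2, b1, b2, b3, b4, b5, b6, b7⟩ := edge_lift g Ps _ v2 u2 s2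
  simp only at *
  have hlt : p.1 < q.1 := v1.2.2.2
  have hdiff : ∃ x ∈ Set.Icc p.1 q.1, Y1 x ≠ Y2 x := by
    by_contra hcon
    push Not at hcon
    obtain ⟨Z, z1, z2⟩ := HH_common g hg _ le_rfl θ1 θ2 hne i1 i2
    have hinf : (Set.Icc p.1 q.1).Infinite := Set.Icc_infinite hlt
    have hinj : Set.InjOn (fun x => (x, Y1 x)) (Set.Icc p.1 q.1) := fun x _ y _ h => (Prod.mk.injEq _ _ _ _ ▸ h).1
    refine (hinf.image hinj) (Z.finite_toSet.subset ?_)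
    rintro _ ⟨x, hx, rfl⟩
    exact z1 _ (a6 x hx) (by have := b6 x hx; rw [← hcon x hx] at this; exact this)
  intro P hP
  have := two_arcs P.P a1 b1 a2 b2 a3 b3 (a4.trans b4.symm) (a5.trans b5.symm) hdiff _ _ (a7 P hP).1 (b7 P hP).1
    (a7 P hP).2 (b7 P hP).2
  simp only [Function.iterate_zero, id] at this
  obtain ⟨h1, h2⟩ := this
  rcases lt_trichotomy (ev3 P.P p (Zt g θ1 p)) 0 with h | h | h
  · rw [sign_neg h] at h1
    exact mul_pos_of_neg_of_neg h (sign_eq_neg_one_iff.1 h1.symm)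
  · exact absurd (sign_eq_zero_iff.2 h) h2
  · rw [sign_pos h] at h1
    exact mul_pos h (sign_eq_one_iff.1 h1.symm)



structure LensSys (g : ℝ[X]) (Γ : Finset Par) (E : Finset Edge) : Prop where
  mem : ∀ e ∈ E, e.1 ∈ Γ
  val : ∀ e ∈ E, Val g e
  non : ∀ e ∈ E, ∀ e' ∈ E, e ≠ e' → e.1 = e'.1 → arc g e.1 e.2.1 = arc g e'.1 e'.2.1 →
    e.2.2.1 ≤ e'.2.1.1 ∨ e'.2.2.1 ≤ e.2.1.1
  bun : ∀ e ∈ E, ∃ e' ∈ E, e'.1 ≠ e.1 ∧ e'.2 = e.2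

/-- edges on one curve -/
lemma lens_curve (g : ℝ[X]) (d : ℕ) (hg : 2 ≤ g.natDegree) (hd : g.natDegree ≤ d) (Γ : Finset Par)
    (hirr : ∀ θ ∈ Γ, Irreducible (HH g θ)) (E : Finset Edge) (hE : LensSys g Γ E) (θ : Par) :
    (E.filter (fun e => e.1 = θ)).card ≤ d ^ 2 * Γ.card := by
  classical
  by_cases hθ : θ ∈ Γ
  swap
  · rw [Finset.card_eq_zero.2]; · simp
    rw [Finset.eq_empty_iff_forall_notMem]
    intro e he
    rw [Finset.mem_filter] at he
    exact hθ (he.2 ▸ hE.mem e he.1)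
  have hc : ∀ θ' : Par, ∃ Z : Finset Pt, (θ' ∈ Γ → θ ≠ θ' → ∀ p, On g θ p → On g θ' p → p ∈ Z) ∧ Z.card ≤ d ^ 2 := by
    intro θ'
    by_cases h : θ' ∈ Γ ∧ θ ≠ θ'
    · obtain ⟨Z, h1, h2⟩ := HH_common g hg d hd θ θ' h.2 (hirr θ hθ) (hirr θ' h.1)
      exact ⟨Z, fun _ _ => h1, h2⟩
    · exact ⟨∅, fun a b => absurd ⟨a, b⟩ h, by simp⟩
  choose Z z1 z2 using hc
  have h3 := Finset.card_biUnion_le_card_mul Γ Z _ (fun θ' _ => z2 θ')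
  rw [mul_comm] at h3
  refine le_trans ?_ h3
  refine Finset.card_le_card_of_injOn (fun e => e.2.1) ?_ ?_
  · intro e he
    have he := Finset.mem_filter.1 (Finset.mem_coe.1 he)
    obtain ⟨e', he', hne, heq⟩ := hE.bun e he.1
    refine Finset.mem_coe.2 (Finset.mem_biUnion.2 ⟨e'.1, hE.mem _ he', z1 e'.1 (hE.mem _ he') (by rw [← he.2]; exact hne.symm) _ ?_ ?_⟩)
    · rw [← he.2]; exact (hE.val e he.1).1.on
    · show On g e'.1 e.2.1
      rw [← heq]; exact (hE.val e' he').1.on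
  · intro e he e' he' heq
    have he := Finset.mem_filter.1 (Finset.mem_coe.1 he)
    have he' := Finset.mem_filter.1 (Finset.mem_coe.1 he')
    simp only at heq
    by_contra hne
    have h1 : e.1 = e'.1 := he.2.trans he'.2.symm
    have := hE.non e he.1 e' he'.1 hne h1 (by rw [h1, heq])
    have v1 := (hE.val e he.1).2.2.2
    have v2 := (hE.val e' he'.1).2.2.2
    rw [heq] at this v1
    rcases this with h | h <;> linarith

set_option maxHeartbeats 400000 in
lemma lens_step (d : ℕ) : ∃ C1 : ℝ, 0 < C1 ∧ ∀ T : ℝ, 1 ≤ T → ∃ K : ℝ, 0 < K ∧ ∀ (g : ℝ[X]) (hg : 2 ≤ g.natDegree) (hd : g.natDegree ≤ d)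
    (Γ : Finset Par) (hirr : ∀ θ ∈ Γ, Irreducible (HH g θ)) (E : Finset Edge) (hE : LensSys g Γ E),
    ∃ E2 ⊆ E, ∃ lab : Edge → Finset Edge, (E.card : ℝ) ≤ K * Γ.card + E2.card ∧
      (∀ e ∈ E2, ∃ e' ∈ E2, e'.1 ≠ e.1 ∧ e'.2 = e.2 ∧ lab e' = lab e) ∧
      (∀ e ∈ E2, ((E2.filter (fun e' => lab e' = lab e)).card : ℝ) ≤ E.card / T) ∧
      (∀ θ, (((E2.filter (fun e => e.1 = θ)).image lab).card : ℝ) ≤ C1 * T ^ ((1:ℝ)/3)) := by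
  classical
  obtain ⟨C, hC, hpart⟩ := partition (1/3) 6 (by norm_num) (by norm_num)
  refine ⟨d^2*(d*(1+2*d)*C+1) + 1, by positivity, fun T hT => ?_⟩
  obtain ⟨D, hD⟩ : ∃ D : ℕ, D = ⌊C * T ^ ((1:ℝ)/3)⌋₊ := ⟨_, rfl⟩
  refine ⟨2 * (D * d^2 + 2 * ((D + 1) * (d * (1 + 2 * d)) * D) : ℕ) + 1, by positivity, ?_⟩
  intro g hg hd Γ hirr E hE
  obtain ⟨Ps, hcl, hsum⟩ := hpart _ _ (hasFeat3 (fun e : {x // x ∈ E} => e.1.2.1) (fun e => Zt g e.1.1 e.1.2.1)) T hT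
  set val : Poly3 → {x // x ∈ E} → ℝ := fun P q => ev3 P.P q.1.2.1 (Zt g q.1.1 q.1.2.1) with hval
  have hsumD : (Ps.map (fun P => P.e)).sum ≤ D := by
    rw [hD]; exact Nat.le_floor hsum
  have heD : ∀ P ∈ Ps, P.e ≤ D := fun P hP =>
    (List.le_sum_of_mem (List.mem_map.2 ⟨P, hP, rfl⟩)).trans hsumD
  obtain ⟨lab, hlab⟩ : ∃ lab : Edge → Finset Edge, ∀ e (he : e ∈ E), lab e = (pcl val Ps ⟨e, he⟩).map (Function.Embedding.subtype _) :=
    ⟨fun e => if he : e ∈ E then (pcl val Ps ⟨e, he⟩).map (Function.Embedding.subtype _) else ∅, fun e he => by simp [he]⟩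
  set Good : Edge → Prop := fun e => ¬ Special g Ps e.1 ∧ Unhit g Ps e with hGood
  set E2 := E.filter (fun e => Good e ∧ ∃ e' ∈ E, Good e' ∧ e'.1 ≠ e.1 ∧ e'.2 = e.2) with hE2
  have hsame : ∀ e (he : e ∈ E), ∀ e' (he' : e' ∈ E), Good e → Good e' → e'.1 ≠ e.1 → e'.2 = e.2 → Same val Ps ⟨e, he⟩ ⟨e', he'⟩ := by
    intro e he e' he' g1 g2 hne heq P hP
    obtain ⟨θ, p, q⟩ := e
    obtain ⟨θ', p', q'⟩ := e'
    simp only [Prod.mk.injEq] at heq hne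
    obtain ⟨rfl, rfl⟩ := heq
    exact same_class g hg Ps θ θ' p' q' (Ne.symm hne) (hirr _ (hE.mem _ he)) (hirr _ (hE.mem _ he')) (hE.val _ he) (hE.val _ he')
      g1.2 g2.2 g1.1 g2.1 P hP
  have hne0 : ∀ e (he : e ∈ E2), ∀ P ∈ Ps, val P ⟨e, (Finset.mem_filter.1 he).1⟩ ≠ 0 := by
    intro e he P hP h0
    obtain ⟨he1, g1, e', he', g2, hne, heq⟩ := Finset.mem_filter.1 he
    have := hsame e he1 e' he' g1 g2 hne heq P hP
    rw [h0, zero_mul] at this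
    exact lt_irrefl _ this
  refine ⟨E2, Finset.filter_subset _ _, lab, ?_, ?_, ?_, ?_⟩
  · -- counting
    have hsp : (E.filter (fun e => Special g Ps e.1)).card ≤ D * (d^2 * Γ.card) := by
      have h1 := special_count g hg (Γ.filter (fun θ => Special g Ps θ)) (fun θ hθ => hirr θ (Finset.mem_filter.1 hθ).1) Ps
        (fun θ hθ => (Finset.mem_filter.1 hθ).2)
      have h2 := Finset.card_le_mul_card_image_of_maps_to (s := E.filter (fun e => Special g Ps e.1)) (t := Γ.filter (fun θ => Special g Ps θ))
        (f := fun e => e.1) (fun e he => by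
          have he := Finset.mem_filter.1 he
          exact Finset.mem_filter.2 ⟨hE.mem _ he.1, he.2⟩) (d^2 * Γ.card) (fun θ hθ => by
          refine le_trans (Finset.card_le_card ?_) (lens_curve g d hg hd Γ hirr E hE θ)
          exact Finset.filter_subset_filter _ (Finset.filter_subset _ _))
      calc _ ≤ _ := h2
        _ ≤ d^2 * Γ.card * D := Nat.mul_le_mul_left _ (h1.trans hsumD)
        _ = _ := by ring
    have hhit : (E.filter (fun e => ¬ Unhit g Ps e)).card ≤ (2 * ((D + 1) * (d * (1 + 2 * d)) * D)) * Γ.card := by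
      refine Finset.card_le_mul_card_image_of_maps_to (f := fun e => e.1) (fun e he => hE.mem _ (Finset.mem_filter.1 he).1) _ (fun θ hθ => ?_)
      obtain ⟨Z, z1, z2⟩ := hit_zeros g d hd θ (hirr θ hθ) D Ps heD
      refine (hit_count ((E.filter (fun e => ¬ Unhit g Ps e)).filter (fun e => e.1 = θ)) (fun e => arc g e.1 e.2.1) (fun e => e.2.1.1)
        (fun e => e.2.2.1) Z (fun z => arc g θ z) (fun z => z.1) ?_ ?_ ?_).trans ?_
      · intro e he
        have he := Finset.mem_filter.1 he
        exact (hE.val e (Finset.mem_filter.1 he.1).1).2.2.2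
      · intro e he e' he' hne harc
        have he := Finset.mem_filter.1 he
        have he' := Finset.mem_filter.1 he'
        exact hE.non e (Finset.mem_filter.1 he.1).1 e' (Finset.mem_filter.1 he'.1).1 hne (he.2.trans he'.2.symm) harc
      · intro e he
        have he := Finset.mem_filter.1 he
        have hu := (Finset.mem_filter.1 he.1).2
        unfold Unhit at hu
        push Not at hu
        obtain ⟨P, hP, k, hk, hdv, r, r1, r2, r3, r4, r5⟩ := hu
        rw [he.2] at hdv r1 r2 r5
        refine ⟨r, z1 P hP k hk hdv r r1.on r5, ?_, r3, r4⟩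
        rw [he.2]; exact r2
      · refine Nat.mul_le_mul_left _ (z2.trans ?_)
        exact Nat.mul_le_mul_left _ hsumD
    have hbad : (E.filter (fun e => ¬ Good e)).card ≤ D * (d^2 * Γ.card) + (2 * ((D + 1) * (d * (1 + 2 * d)) * D)) * Γ.card := by
      have hsub : E.filter (fun e => ¬ Good e) ⊆ E.filter (fun e => Special g Ps e.1) ∪ E.filter (fun e => ¬ Unhit g Ps e) := by
        intro e he
        have he := Finset.mem_filter.1 he
        have h2 := he.2
        simp only [hGood, not_and_or, not_not] at h2
        rcases h2 with h | h
        · exact Finset.mem_union_left _ (Finset.mem_filter.2 ⟨he.1, h⟩)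
        · exact Finset.mem_union_right _ (Finset.mem_filter.2 ⟨he.1, h⟩)
      have h1 := Finset.card_le_card hsub
      have h2 := Finset.card_union_le (E.filter (fun e => Special g Ps e.1)) (E.filter (fun e => ¬ Unhit g Ps e))
      generalize D * (d^2 * Γ.card) = X1 at *
      generalize (2 * ((D + 1) * (d * (1 + 2 * d)) * D)) * Γ.card = X2 at *
      omega
    have halone : (E.filter (fun e => Good e ∧ ¬ ∃ e' ∈ E, Good e' ∧ e'.1 ≠ e.1 ∧ e'.2 = e.2)).card ≤ (E.filter (fun e => ¬ Good e)).card := by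
      have : ∀ e : Edge, ∃ e' : Edge, e ∈ E → (e' ∈ E ∧ e'.1 ≠ e.1 ∧ e'.2 = e.2) := by
        intro e
        by_cases he : e ∈ E
        · obtain ⟨e', h1, h2, h3⟩ := hE.bun e he
          exact ⟨e', fun _ => ⟨h1, h2, h3⟩⟩
        · exact ⟨e, fun h => absurd h he⟩
      choose f hf using this
      refine Finset.card_le_card_of_injOn f ?_ ?_
      · intro e he
        have he := Finset.mem_filter.1 (Finset.mem_coe.1 he)
        have := hf e he.1
        refine Finset.mem_coe.2 (Finset.mem_filter.2 ⟨this.1, fun hg' => he.2.2 ⟨f e, this.1, hg', this.2.1, this.2.2⟩⟩)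
      · intro e he e' he' heq
        have he := Finset.mem_filter.1 (Finset.mem_coe.1 he)
        have he' := Finset.mem_filter.1 (Finset.mem_coe.1 he')
        have t1 := hf e he.1
        have t2 := hf e' he'.1
        have h2 : e'.2 = e.2 := by rw [← t1.2.2, ← t2.2.2, heq]
        by_contra hne
        refine he.2.2 ⟨e', he'.1, he'.2.1, fun h1 => hne (Prod.ext h1.symm h2.symm), h2⟩
    have hcov : E ⊆ (E.filter (fun e => ¬ Good e) ∪ E.filter (fun e => Good e ∧ ¬ ∃ e' ∈ E, Good e' ∧ e'.1 ≠ e.1 ∧ e'.2 = e.2)) ∪ E2 := by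
      intro e he
      by_cases h1 : Good e
      · by_cases h2 : ∃ e' ∈ E, Good e' ∧ e'.1 ≠ e.1 ∧ e'.2 = e.2
        · exact Finset.mem_union_right _ (Finset.mem_filter.2 ⟨he, h1, h2⟩)
        · exact Finset.mem_union_left _ (Finset.mem_union_right _ (Finset.mem_filter.2 ⟨he, h1, h2⟩))
      · exact Finset.mem_union_left _ (Finset.mem_union_left _ (Finset.mem_filter.2 ⟨he, h1⟩))
    have h1 := (Finset.card_le_card hcov).trans ((Finset.card_union_le _ _).trans (Nat.add_le_add_right (Finset.card_union_le _ _) _))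
    have h2 : E.card ≤ (2 * (D * d^2 + 2 * ((D + 1) * (d * (1 + 2 * d)) * D))) * Γ.card + E2.card := by
      calc E.card ≤ (D * (d^2 * Γ.card) + (2 * ((D + 1) * (d * (1 + 2 * d)) * D)) * Γ.card) * 2 + E2.card := by omega
        _ = _ := by ring
    clear hsp hhit hbad halone hcov h1
    have h3 : (E.card : ℝ) ≤ ((2 * (D * d^2 + 2 * ((D + 1) * (d * (1 + 2 * d)) * D)) : ℕ) : ℝ) * Γ.card + E2.card := by exact_mod_cast h2
    have h4 : (0:ℝ) ≤ Γ.card := by positivity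
    rw [Nat.cast_mul] at h3
    push_cast at h3 ⊢
    linarith
  · intro e he
    obtain ⟨he1, g1, e', he', g2, hne, heq⟩ := Finset.mem_filter.1 he
    refine ⟨e', Finset.mem_filter.2 ⟨he', g2, e, he1, g1, hne.symm, heq.symm⟩, hne, heq, ?_⟩
    rw [hlab e he1, hlab e' he', pcl_eq (hsame e he1 e' he' g1 g2 hne heq)]
  · intro e he
    have he1 := (Finset.mem_filter.1 he).1
    have h1 := hcl ⟨e, he1⟩
    rw [Fintype.card_coe] at h1
    refine le_trans ?_ h1
    rw [← Finset.card_map (Function.Embedding.subtype _), ← hlab e he1]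
    refine Nat.cast_le.2 (Finset.card_le_card ?_)
    intro e' he'
    obtain ⟨he2, hl⟩ := Finset.mem_filter.1 he'
    have he3 := (Finset.mem_filter.1 he2).1
    rw [← hl, hlab e' he3]
    refine Finset.mem_map.2 ⟨⟨e', he3⟩, mem_pcl.2 (fun P hP => ?_), rfl⟩
    exact mul_self_pos.2 (hne0 e' he2 P hP)
  · intro θ
    have hT3 : (1:ℝ) ≤ T ^ ((1:ℝ)/3) := Real.one_le_rpow hT (by norm_num)
    by_cases hemp : (E2.filter (fun e => e.1 = θ)) = ∅
    · rw [hemp]; simp; positivity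
    obtain ⟨e0, he0⟩ := Finset.nonempty_iff_ne_empty.2 hemp
    obtain ⟨he0, he0θ⟩ := Finset.mem_filter.1 he0
    have hθ : θ ∈ Γ := he0θ ▸ hE.mem _ (Finset.mem_filter.1 he0).1
    have hsg : ∀ e (he : e ∈ E2), e.1 = θ → ∀ P ∈ Ps, SignType.sign (ev (hatP g P.e P.P θ) e.2.1) = SignType.sign (val P ⟨e, (Finset.mem_filter.1 he).1⟩) := by
      intro e he heθ P hP
      have := sign_hat g P.e P.P P.nd θ e.2.1 (heθ ▸ (hE.val e (Finset.mem_filter.1 he).1).1)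
      rw [this, hval]; simp only; rw [heθ]
    obtain ⟨Z, z1, z2⟩ := list_zeros (HH g θ) (hirr θ hθ) d (HH_deg g θ d hd) (Ps.map (fun P => hatP g P.e P.P θ)) (by
      intro F hF hdv
      obtain ⟨P, hP, rfl⟩ := List.mem_map.1 hF
      have h1 := dvd_zero_on g θ _ hdv e0.2.1 (he0θ ▸ (hE.val e0 (Finset.mem_filter.1 he0).1).1.on)
      have h2 := hsg e0 he0 he0θ P hP
      rw [h1, sign_zero] at h2
      exact hne0 e0 he0 P hP (sign_eq_zero_iff.1 h2.symm))
    have hcc := crossing_count (a := pa g θ) (b := pb g θ) (d := d) (by omega) (by rw [pa_deg]; exact hd) (by rw [pb_deg]; exact hd)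
      (E2.filter (fun e => e.1 = θ)) (fun e => e.2.1) lab (by
        intro e he
        obtain ⟨he, heθ⟩ := Finset.mem_filter.1 he
        exact heθ ▸ (hE.val e (Finset.mem_filter.1 he).1).1) (Ps.map (fun P => hatP g P.e P.P θ)) (by
        intro e he e' he' hne
        obtain ⟨he, heθ⟩ := Finset.mem_filter.1 he
        obtain ⟨he', heθ'⟩ := Finset.mem_filter.1 he'
        have hns : ¬ Same val Ps ⟨e, (Finset.mem_filter.1 he).1⟩ ⟨e', (Finset.mem_filter.1 he').1⟩ := by
          intro hs
          exact hne (by rw [hlab e (Finset.mem_filter.1 he).1, hlab e' (Finset.mem_filter.1 he').1, pcl_eq hs])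
        unfold Same at hns
        push Not at hns
        obtain ⟨P, hP, hle⟩ := hns
        refine ⟨_, List.mem_map.2 ⟨P, hP, rfl⟩, ?_⟩
        have hlt : val P ⟨e, (Finset.mem_filter.1 he).1⟩ * val P ⟨e', (Finset.mem_filter.1 he').1⟩ < 0 :=
          lt_of_le_of_ne hle (mul_ne_zero (hne0 e he P hP) (hne0 e' he' P hP))
        rw [← sign_eq_neg_one_iff, sign_mul] at hlt ⊢
        rw [hsg e he heθ P hP, hsg e' he' heθ' P hP, hlt]) Z (by
        intro F hF r hr h0
        exact z1 F hF r ((on_iff _ _ _).1 hr.1) h0)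
    have hZ : Z.card ≤ d * ((1 + 2 * d) * (Ps.map (fun P => P.e)).sum) := by
      refine z2.trans (Nat.mul_le_mul_left _ ?_)
      rw [List.map_map, ← List.sum_map_mul_left]
      refine List.sum_le_sum (fun P hP => ?_)
      exact hatP_deg g d hd P.e P.P P.cd θ
    have h1 : (((E2.filter (fun e => e.1 = θ)).image lab).card : ℝ) ≤ d ^ 2 * (d * ((1 + 2 * d) * ((Ps.map (fun P => P.e)).sum : ℕ)) + 1) := by
      exact_mod_cast hcc.trans (Nat.mul_le_mul_left _ (Nat.add_le_add_right hZ 1))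
    refine h1.trans ?_
    generalize ((Ps.map (fun P => P.e)).sum : ℕ) = s at *
    generalize T ^ ((1:ℝ)/3) = τ at *
    have : (d:ℝ) ^ 2 * (d * ((1 + 2 * d) * (s:ℝ)) + 1) ≤ d ^ 2 * (d * ((1 + 2 * d) * (C * τ)) + τ) := by gcongr
    refine this.trans ?_
    nlinarith


lemma lens_param (C1 ε : ℝ) (hC : 0 < C1) (hε : 0 < ε) : ∃ τ : ℝ, 1 ≤ τ ∧ 4 * C1 * τ / τ ^ 3 < 1 ∧
    C1 * τ * (4 * C1 * τ / τ ^ 3) ^ (1/2 + ε) ≤ 1/4 := by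
  obtain ⟨k, hk⟩ : ∃ k : ℝ, k = 4 * C1 * (4 * C1) ^ (1/2 + ε) := ⟨_, rfl⟩
  have hk0 : 0 < k := by rw [hk]; positivity
  obtain ⟨τ, hτ⟩ : ∃ τ : ℝ, τ = max (4 * C1 + 1) (k ^ (1 / (2 * ε))) := ⟨_, rfl⟩
  have h1 : 4 * C1 + 1 ≤ τ := hτ ▸ le_max_left _ _
  have h2 : k ^ (1 / (2 * ε)) ≤ τ := hτ ▸ le_max_right _ _
  have h0 : 0 < τ := by linarith
  have h3 : k ≤ τ ^ (2 * ε) := by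
    calc k = (k ^ (1 / (2 * ε))) ^ (2 * ε) := by
          rw [← Real.rpow_mul hk0.le, one_div, inv_mul_cancel₀ (by positivity), Real.rpow_one]
      _ ≤ _ := Real.rpow_le_rpow (by positivity) h2 (by positivity)
  refine ⟨τ, by linarith, ?_, ?_⟩
  · rw [div_lt_one (by positivity)]
    nlinarith [mul_pos h0 h0]
  · have e1 : 4 * C1 * τ / τ ^ 3 = (4 * C1) * (τ ^ (2:ℝ))⁻¹ := by
      rw [show (2:ℝ) = ((2:ℕ):ℝ) by norm_num, Real.rpow_natCast]; field_simp
    rw [e1, Real.mul_rpow (by positivity) (by positivity), Real.inv_rpow (by positivity), ← Real.rpow_mul h0.le]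
    have e2 : τ ^ ((2:ℝ) * (1/2 + ε)) = τ * τ ^ (2 * ε) := by
      rw [show (2:ℝ) * (1/2 + ε) = 1 + 2 * ε by ring, Real.rpow_add h0, Real.rpow_one]
    rw [e2]
    have hp : 0 < τ ^ (2 * ε) := by positivity
    generalize τ ^ (2 * ε) = y at *
    generalize (4 * C1) ^ (1/2 + ε) = z at *
    have : C1 * τ * (z * (τ * y)⁻¹) = (C1 * z) / y := by field_simp
    rw [this, div_le_iff₀ hp]
    linarith

lemma LensSys.sub {g : ℝ[X]} {Γ : Finset Par} {E E2 : Finset Edge} (hE : LensSys g Γ E) (hs : E2 ⊆ E) (Γ' : Finset Par)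
    (hm : ∀ e ∈ E2, e.1 ∈ Γ') (hb : ∀ e ∈ E2, ∃ e' ∈ E2, e'.1 ≠ e.1 ∧ e'.2 = e.2) : LensSys g Γ' E2 :=
  ⟨hm, fun e he => hE.val e (hs he), fun e he e' he' => hE.non e (hs he) e' (hs he'), hb⟩

lemma lens_arith (n a ρ ε : ℝ) (ha : 0 ≤ a) (hn : 0 ≤ n) (hρ : 0 ≤ ρ) (hε : 0 < ε) (h : a ≤ ρ * n) :
    a ^ (3/2 + ε) ≤ a * (ρ ^ (1/2 + ε) * n ^ (1/2 + ε)) := by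
  rcases eq_or_lt_of_le ha with h0 | h0
  · rw [← h0, Real.zero_rpow (by positivity), zero_mul]
  · rw [show (3/2 + ε) = 1 + (1/2 + ε) by ring, Real.rpow_add h0, Real.rpow_one, ← Real.mul_rpow hρ hn]
    exact mul_le_mul_of_nonneg_left (Real.rpow_le_rpow ha h (by positivity)) ha

set_option maxHeartbeats 400000 in
lemma lens (d : ℕ) (ε : ℝ) (hε : 0 < ε) : ∃ C : ℝ, 0 < C ∧ ∀ (g : ℝ[X]) (hg : 2 ≤ g.natDegree) (hd : g.natDegree ≤ d)
    (Γ : Finset Par) (hirr : ∀ θ ∈ Γ, Irreducible (HH g θ)) (E : Finset Edge) (hE : LensSys g Γ E),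
    (E.card : ℝ) ≤ C * (Γ.card : ℝ) ^ (3/2 + ε) := by
  classical
  obtain ⟨C1, hC1, hstep⟩ := lens_step d
  obtain ⟨τ, hτ1, hτ2, hτ3⟩ := lens_param C1 ε hC1 hε
  obtain ⟨K, hK, hstep⟩ := hstep (τ ^ 3) (one_le_pow₀ hτ1)
  refine ⟨2 * K, by positivity, ?_⟩
  intro g hg hd Γ hirr E hE
  induction hn : Γ.card using Nat.strong_induction_on generalizing Γ E with
  | _ n ih =>
  subst hn
  obtain ⟨E2, hE2, lab, ha, hb, hc, hdd⟩ := hstep g hg hd Γ hirr E hE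
  have hroot : (τ ^ 3) ^ ((1:ℝ)/3) = τ := by
    rw [← Real.rpow_natCast, ← Real.rpow_mul (by linarith)]; norm_num
  simp only [hroot] at hdd
  rcases Nat.eq_zero_or_pos Γ.card with h0 | hpos
  · have hemp : E = ∅ := by
      rw [Finset.card_eq_zero] at h0
      rw [Finset.eq_empty_iff_forall_notMem]; intro e he
      have := hE.mem e he; rw [h0] at this; simp at this
    rw [hemp]; simp; positivity
  have hn1 : (1:ℝ) ≤ Γ.card := by exact_mod_cast hpos
  obtain ⟨n, hn⟩ : ∃ n : ℝ, n = Γ.card := ⟨_, rfl⟩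
  rw [← hn] at hn1 ha ⊢
  obtain ⟨ρ, hρ⟩ : ∃ ρ : ℝ, ρ = 4 * C1 * τ / τ ^ 3 := ⟨_, rfl⟩
  rw [← hρ] at hτ2 hτ3
  have hτ0 : 0 < τ := by linarith
  have hρ0 : 0 < ρ := by rw [hρ]; positivity
  -- labels
  set Ls := E2.image lab with hLs
  set EL : Finset Edge → Finset Edge := fun L => E2.filter (fun e => lab e = L) with hEL
  set PL : Finset Edge → Finset Par := fun L => (EL L).image (fun e => e.1) with hPL
  have hPLsub : ∀ L, PL L ⊆ Γ := by
    intro L θ hθ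
    obtain ⟨e, he, rfl⟩ := Finset.mem_image.1 hθ
    exact hE.mem e (hE2 (Finset.mem_filter.1 he).1)
  have hsum : (E2.card : ℝ) = ∑ L ∈ Ls, ((EL L).card : ℝ) := by
    rw [Finset.card_eq_sum_card_image lab E2]; push_cast; rfl
  have hGsum : ∑ L ∈ Ls, ((PL L).card : ℝ) ≤ C1 * τ * n := by
    have h1 : ∑ L ∈ Ls, (PL L).card = ∑ θ ∈ Γ, (Ls.filter (fun L => θ ∈ PL L)).card := by
      have := Finset.sum_card_bipartiteAbove_eq_sum_card_bipartiteBelow (s := Ls) (t := Γ) (fun L θ => θ ∈ PL L)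
      simp only [Finset.bipartiteAbove, Finset.bipartiteBelow] at this
      rw [← this]
      refine Finset.sum_congr rfl (fun L _ => ?_)
      congr 1
      ext θ; rw [Finset.mem_filter]
      exact ⟨fun h => ⟨hPLsub L h, h⟩, fun h => h.2⟩
    have h2 : ∀ θ ∈ Γ, ((Ls.filter (fun L => θ ∈ PL L)).card : ℝ) ≤ C1 * τ := by
      intro θ _
      refine le_trans (Nat.cast_le.2 (Finset.card_le_card ?_)) (hdd θ)
      intro L hL
      obtain ⟨_, hL⟩ := Finset.mem_filter.1 hL
      obtain ⟨e, he, heθ⟩ := Finset.mem_image.1 hL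
      obtain ⟨he, hl⟩ := Finset.mem_filter.1 he
      exact Finset.mem_image.2 ⟨e, Finset.mem_filter.2 ⟨he, heθ⟩, hl⟩
    calc ∑ L ∈ Ls, ((PL L).card : ℝ) = ∑ θ ∈ Γ, ((Ls.filter (fun L => θ ∈ PL L)).card : ℝ) := by exact_mod_cast h1
      _ ≤ ∑ θ ∈ Γ, C1 * τ := Finset.sum_le_sum h2
      _ = C1 * τ * n := by rw [Finset.sum_const, nsmul_eq_mul, hn]; ring
  -- heavy
  have hheavy : ∑ L ∈ Ls.filter (fun L => ρ * n < (PL L).card), ((EL L).card : ℝ) ≤ E.card / 4 := by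
    have h1 : ((Ls.filter (fun L => ρ * n < (PL L).card)).card : ℝ) * (ρ * n) ≤ C1 * τ * n := by
      calc _ = ∑ L ∈ Ls.filter (fun L => ρ * n < (PL L).card), (ρ * n) := by rw [Finset.sum_const, nsmul_eq_mul]
        _ ≤ ∑ L ∈ Ls.filter (fun L => ρ * n < (PL L).card), ((PL L).card : ℝ) :=
            Finset.sum_le_sum (fun L hL => (Finset.mem_filter.1 hL).2.le)
        _ ≤ ∑ L ∈ Ls, ((PL L).card : ℝ) := Finset.sum_le_sum_of_subset_of_nonneg (Finset.filter_subset _ _) (fun _ _ _ => by positivity)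
        _ ≤ _ := hGsum
    have h2 : ((Ls.filter (fun L => ρ * n < (PL L).card)).card : ℝ) ≤ τ ^ 3 / 4 := by
      rw [hρ] at h1 ⊢
      have h3 : 0 < C1 * τ * n := by positivity
      generalize ((Ls.filter (fun L => 4 * C1 * τ / τ ^ 3 * n < (PL L).card)).card : ℝ) = x at *
      have h4 : x * (4 * C1 * τ / τ ^ 3 * n) = (x * 4 / τ ^ 3) * (C1 * τ * n) := by field_simp
      rw [h4] at h1
      have h5 : x * 4 / τ ^ 3 ≤ 1 := by
        by_contra hcon
        push Not at hcon
        nlinarith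
      rw [div_le_one (by positivity)] at h5
      linarith
    calc _ ≤ ∑ L ∈ Ls.filter (fun L => ρ * n < (PL L).card), ((E.card : ℝ) / τ ^ 3) := by
          refine Finset.sum_le_sum (fun L hL => ?_)
          obtain ⟨e, he, rfl⟩ := Finset.mem_image.1 (Finset.mem_filter.1 hL).1
          exact hc e he
      _ = ((Ls.filter (fun L => ρ * n < (PL L).card)).card : ℝ) * ((E.card : ℝ) / τ ^ 3) := by rw [Finset.sum_const, nsmul_eq_mul]
      _ ≤ τ ^ 3 / 4 * ((E.card : ℝ) / τ ^ 3) := by gcongr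
      _ = _ := by field_simp
  -- light
  have hlight : ∑ L ∈ Ls.filter (fun L => ¬ ρ * n < (PL L).card), ((EL L).card : ℝ) ≤ (2 * K) * n ^ (3/2 + ε) / 4 := by
    have h1 : ∀ L ∈ Ls.filter (fun L => ¬ ρ * n < (PL L).card), ((EL L).card : ℝ) ≤
        2 * K * (((PL L).card : ℝ) * (ρ ^ (1/2 + ε) * n ^ (1/2 + ε))) := by
      intro L hL
      have hle := (Finset.mem_filter.1 hL).2
      push Not at hle
      have hlt : (PL L).card < Γ.card := by
        have : ((PL L).card : ℝ) < n := lt_of_le_of_lt hle (by nlinarith)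
        rw [hn] at this; exact_mod_cast this
      have := ih (PL L).card hlt (PL L) (fun θ hθ => hirr θ (hPLsub L hθ)) (EL L)
        (hE.sub ((Finset.filter_subset _ _).trans hE2) (PL L) (fun e he => Finset.mem_image_of_mem _ he) (fun e he => by
          obtain ⟨he, hl⟩ := Finset.mem_filter.1 he
          obtain ⟨e', h1, h2, h3, h4⟩ := hb e he
          exact ⟨e', Finset.mem_filter.2 ⟨h1, h4.trans hl⟩, h2, h3⟩)) rfl
      refine this.trans (mul_le_mul_of_nonneg_left ?_ (by positivity))
      exact lens_arith n _ ρ ε (by positivity) (by linarith) hρ0.le hε hle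
    calc _ ≤ ∑ L ∈ Ls.filter (fun L => ¬ ρ * n < (PL L).card), 2 * K * (((PL L).card : ℝ) * (ρ ^ (1/2 + ε) * n ^ (1/2 + ε))) :=
          Finset.sum_le_sum h1
      _ ≤ ∑ L ∈ Ls, 2 * K * (((PL L).card : ℝ) * (ρ ^ (1/2 + ε) * n ^ (1/2 + ε))) :=
          Finset.sum_le_sum_of_subset_of_nonneg (Finset.filter_subset _ _) (fun _ _ _ => by positivity)
      _ = 2 * K * ((∑ L ∈ Ls, ((PL L).card : ℝ)) * (ρ ^ (1/2 + ε) * n ^ (1/2 + ε))) := by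
          rw [← Finset.mul_sum, ← Finset.sum_mul]
      _ ≤ 2 * K * ((C1 * τ * n) * (ρ ^ (1/2 + ε) * n ^ (1/2 + ε))) := by gcongr
      _ = 2 * K * ((C1 * τ * ρ ^ (1/2 + ε)) * (n * n ^ (1/2 + ε))) := by ring
      _ ≤ 2 * K * ((1/4) * (n * n ^ (1/2 + ε))) := by gcongr
      _ = _ := by
          rw [show (3/2 + ε) = 1 + (1/2 + ε) by ring, Real.rpow_add (by linarith : 0 < n) 1 (1/2+ε), Real.rpow_one]; ring
  have hsplit := Finset.sum_filter_add_sum_filter_not Ls (fun L => ρ * n < (PL L).card) (fun L => ((EL L).card : ℝ))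
  have hnn : n ≤ n ^ (3/2 + ε) := by
    conv_lhs => rw [← Real.rpow_one n]
    exact Real.rpow_le_rpow_of_exponent_le hn1 (by linarith)
  have := mul_le_mul_of_nonneg_left hnn hK.le
  have hpos2 : 0 ≤ K * n := by positivity
  linarith


lemma one_le_deg_of_irr {f : MP2} (hf : Irreducible f) : 1 ≤ f.totalDegree := by
  by_contra h
  have h0 : f.totalDegree = 0 := by omega
  rw [MvPolynomial.totalDegree_eq_zero_iff_eq_C] at h0
  have hc : f.coeff 0 ≠ 0 := by
    intro hc; rw [hc, map_zero] at h0; exact hf.ne_zero h0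
  apply hf.not_isUnit
  rw [h0]
  exact (isUnit_iff_ne_zero.2 hc).map MvPolynomial.C

lemma irr_factors (F : MP2) (hF : F ≠ 0) : ∃ S : Finset MP2, (∀ f ∈ S, Irreducible f ∧ f ∣ F ∧ f.totalDegree ≤ F.totalDegree) ∧ S.card ≤ F.totalDegree ∧
    ∀ p, ev F p = 0 → ∃ f ∈ S, ev f p = 0 := by
  classical
  induction F using WfDvdMonoid.induction_on_irreducible with
  | zero => exact absurd rfl hF
  | unit u hu =>
    refine ⟨∅, by simp, by simp, fun p hp => ?_⟩
    obtain ⟨k, hk, rfl⟩ := isUnit_mp2 hu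
    simp at hp; exact absurd hp hk
  | mul a i ha hi ih =>
    obtain ⟨S, h1, h2, h3⟩ := ih ha
    have hdeg : (i * a).totalDegree = i.totalDegree + a.totalDegree := MvPolynomial.totalDegree_mul_of_isDomain hi.ne_zero ha
    refine ⟨insert i S, ?_, ?_, ?_⟩
    · intro f hf
      rcases Finset.mem_insert.1 hf with rfl | hf
      · exact ⟨hi, dvd_mul_right _ _, by omega⟩
      · have := h1 f hf
        exact ⟨this.1, this.2.1.mul_left _, by omega⟩
    · have := Finset.card_insert_le i S
      have := one_le_deg_of_irr hi
      omega
    · intro p hp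
      rw [ev_mul] at hp
      rcases mul_eq_zero.1 hp with h | h
      · exact ⟨i, Finset.mem_insert_self _ _, h⟩
      · obtain ⟨f, hf, hh⟩ := h3 p h
        exact ⟨f, Finset.mem_insert_of_mem hf, hh⟩

lemma generic_delta (S : Finset MP2) (hS : ∀ f ∈ S, Irreducible f) (Fs : List MP2) (ε : ℝ) (hε : 0 < ε) :
    ∃ δ : ℝ, 0 < δ ∧ δ < ε ∧ ∀ f ∈ S, ∀ F ∈ Fs, ¬ f ∣ F + MvPolynomial.C δ := by
  classical
  have hfin : (⋃ f ∈ S, ⋃ F ∈ Fs, {δ : ℝ | f ∣ F + MvPolynomial.C δ}).Finite := by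
    refine Set.Finite.biUnion S.finite_toSet (fun f hf => ?_)
    refine Set.Finite.biUnion (List.finite_toSet Fs) (fun F _ => ?_)
    refine Set.Subsingleton.finite (fun δ hδ δ' hδ' => ?_)
    by_contra hne
    have h1 : f ∣ MvPolynomial.C (δ - δ') := by
      have := dvd_sub (α := MP2) hδ hδ'
      rw [map_sub]; convert this using 1; ring
    exact (hS f hf).not_isUnit (isUnit_of_dvd_unit h1 ((isUnit_iff_ne_zero.2 (sub_ne_zero.2 hne)).map MvPolynomial.C))
  obtain ⟨δ, hδ, hδ'⟩ := ((Set.Ioo_infinite hε).sdiff hfin).nonempty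
  refine ⟨δ, hδ.1, hδ.2, fun f hf F hF hdv => hδ' ?_⟩
  exact Set.mem_biUnion hf (Set.mem_biUnion (s := {F | F ∈ Fs}) hF hdv)

lemma label_bound {L V : Type} [DecidableEq L] (d D : ℕ) (a b : ℝ[X]) (ha1 : 1 ≤ a.natDegree) (ha : a.natDegree ≤ d) (hb1 : 1 ≤ b.natDegree)
    (hb : b.natDegree ≤ d) (X : Finset V) (pt : V → ℝ × ℝ) (lab : V → L) (hon : ∀ v ∈ X, a.eval (pt v).1 = b.eval (pt v).2)
    (Fs : List MP2) (hne : ∀ v ∈ X, ∀ F ∈ Fs, ev F (pt v) ≠ 0)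
    (hlab : ∀ v ∈ X, ∀ w ∈ X, lab v ≠ lab w → ∃ F ∈ Fs, ev F (pt v) * ev F (pt w) < 0)
    (hD : (Fs.map (fun F => F.totalDegree)).sum ≤ D) : (X.image lab).card ≤ 2 * d ^ 2 + d ^ 2 * (d ^ 2 * D + 1) := by
  classical
  have hd : 1 ≤ d := by omega
  obtain ⟨W, w1, w2⟩ := irr_points a b d ha1 hb1 ha hb
  have hirr : ((X.filter (fun v => ¬ RegAB a b (pt v))).image lab).card ≤ 2 * d ^ 2 := by
    refine le_trans ?_ w2
    have hch : ∀ l : L, ∃ v : ℝ × ℝ, l ∈ (X.filter (fun v => ¬ RegAB a b (pt v))).image lab →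
        ∃ w ∈ X, ¬ RegAB a b (pt w) ∧ lab w = l ∧ pt w = v := by
      intro l
      by_cases hl : l ∈ (X.filter (fun v => ¬ RegAB a b (pt v))).image lab
      · obtain ⟨w, hw, hl⟩ := Finset.mem_image.1 hl
        obtain ⟨hw, hw'⟩ := Finset.mem_filter.1 hw
        exact ⟨pt w, fun _ => ⟨w, hw, hw', hl, rfl⟩⟩
      · exact ⟨(0, 0), fun h => absurd h hl⟩
    choose φ hφ using hch
    refine Finset.card_le_card_of_injOn φ ?_ ?_
    · intro l hl
      obtain ⟨w, hw, h1, h2, h3⟩ := hφ l hl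
      rw [← h3]
      exact w1 _ (hon w hw) h1
    · intro l hl l' hl' heq
      obtain ⟨w, hw, h1, h2, h3⟩ := hφ l hl
      obtain ⟨w', hw', h1', h2', h3'⟩ := hφ l' hl'
      by_contra hcon
      rw [← h2, ← h2'] at hcon
      obtain ⟨F, _, hlt⟩ := hlab w hw w' hw' hcon
      rw [h3, h3', heq] at hlt
      nlinarith [mul_self_nonneg (ev F (φ l'))]
  -- perturbation
  have hA : sepP a b ≠ 0 := by
    intro h0
    have h1 : ∀ x, a.eval x = b.eval 0 := fun x => by
      have := ev_sepP a b (x, 0); rw [h0, ev_zero] at this; simp only at this; linarith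
    have : a = C (b.eval 0) := Polynomial.funext (by simpa using h1)
    rw [this, Polynomial.natDegree_C] at ha1; omega
  obtain ⟨S, s1, s2, s3⟩ := irr_factors _ hA
  have hAd := deg_sepP_le a b d ha hb
  obtain ⟨ε, hε, hεle⟩ : ∃ ε : ℝ, 0 < ε ∧ ∀ v ∈ X, ∀ F ∈ Fs, ε ≤ |ev F (pt v)| := by
    by_cases hemp : (X ×ˢ Fs.toFinset).Nonempty
    · obtain ⟨m, hm, hmin⟩ := Finset.exists_min_image (X ×ˢ Fs.toFinset) (fun x => |ev x.2 (pt x.1)|) hemp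
      rw [Finset.mem_product, List.mem_toFinset] at hm
      refine ⟨_, abs_pos.2 (hne m.1 hm.1 m.2 hm.2), fun v hv F hF => ?_⟩
      exact hmin (v, F) (Finset.mem_product.2 ⟨hv, List.mem_toFinset.2 hF⟩)
    · refine ⟨1, one_pos, fun v hv F hF => absurd ⟨(v, F), Finset.mem_product.2 ⟨hv, List.mem_toFinset.2 hF⟩⟩ hemp⟩
  obtain ⟨δ, hδ0, hδε, hδ⟩ := generic_delta S (fun f hf => (s1 f hf).1) Fs ε hε
  have hsgn : ∀ v ∈ X, ∀ F ∈ Fs, 0 < ev F (pt v) * ev (F + MvPolynomial.C δ) (pt v) := by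
    intro v hv F hF
    have := hεle v hv F hF
    rw [ev_add, ev_C]
    rcases le_abs'.1 this with h | h <;> nlinarith
  have hZ : ∀ f : MP2, ∃ Z : Finset (ℝ × ℝ), (f ∈ S → ∀ F ∈ Fs, ∀ p, ev f p = 0 → ev (F + MvPolynomial.C δ) p = 0 → p ∈ Z) ∧ Z.card ≤ d * D := by
    intro f
    by_cases hf : f ∈ S
    · obtain ⟨Z, z1, z2⟩ := list_zeros f (s1 f hf).1 d ((s1 f hf).2.2.trans hAd) (Fs.map (fun F => F + MvPolynomial.C δ)) (by
        intro F hF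
        obtain ⟨F', hF', rfl⟩ := List.mem_map.1 hF
        exact hδ f hf F' hF')
      refine ⟨Z, fun _ F hF p h1 h2 => z1 _ (List.mem_map.2 ⟨F, hF, rfl⟩) p h1 h2, z2.trans (Nat.mul_le_mul_left _ (le_trans ?_ hD))⟩
      rw [List.map_map]
      refine List.sum_le_sum (fun F _ => ?_)
      refine (MvPolynomial.totalDegree_add _ _).trans ?_
      simp
    · exact ⟨∅, fun h => absurd h hf, by simp⟩
  choose Z z1 z2 using hZ
  have hcc := crossing_count (a := a) (b := b) (d := d) hd ha hb (X.filter (fun v => RegAB a b (pt v))) pt lab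
    (fun v hv => (Finset.mem_filter.1 hv).2) (Fs.map (fun F => F + MvPolynomial.C δ)) (by
      intro v hv w hw hl
      obtain ⟨F, hF, hlt⟩ := hlab v (Finset.mem_filter.1 hv).1 w (Finset.mem_filter.1 hw).1 hl
      refine ⟨_, List.mem_map.2 ⟨F, hF, rfl⟩, ?_⟩
      have h1 := hsgn v (Finset.mem_filter.1 hv).1 F hF
      have h2 := hsgn w (Finset.mem_filter.1 hw).1 F hF
      generalize ev (F + MvPolynomial.C δ) (pt v) = x at *
      generalize ev (F + MvPolynomial.C δ) (pt w) = y at *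
      by_contra hcon
      push Not at hcon
      nlinarith [mul_pos h1 h2]) (S.biUnion Z) (by
      intro F hF r hr h0
      obtain ⟨F', hF', rfl⟩ := List.mem_map.1 hF
      obtain ⟨f, hf, hf0⟩ := s3 r (by rw [ev_sepP, hr.1, sub_self])
      exact Finset.mem_biUnion.2 ⟨f, hf, z1 f hf F' hF' r hf0 h0⟩)
  have hZc : (S.biUnion Z).card ≤ d ^ 2 * D := by
    refine (Finset.card_biUnion_le_card_mul S Z _ (fun f _ => z2 f)).trans ?_
    calc S.card * (d * D) ≤ d * (d * D) := Nat.mul_le_mul_right _ (s2.trans hAd)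
      _ = _ := by ring
  have hun : X.image lab ⊆ (X.filter (fun v => ¬ RegAB a b (pt v))).image lab ∪ (X.filter (fun v => RegAB a b (pt v))).image lab := by
    intro l hl
    obtain ⟨v, hv, rfl⟩ := Finset.mem_image.1 hl
    by_cases h : RegAB a b (pt v)
    · exact Finset.mem_union_right _ (Finset.mem_image_of_mem _ (Finset.mem_filter.2 ⟨hv, h⟩))
    · exact Finset.mem_union_left _ (Finset.mem_image_of_mem _ (Finset.mem_filter.2 ⟨hv, h⟩))
  refine (Finset.card_le_card hun).trans ((Finset.card_union_le _ _).trans (Nat.add_le_add hirr (hcc.trans ?_)))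
  exact Nat.mul_le_mul_left _ (Nat.add_le_add_right hZc 1)


noncomputable def Phi (g : ℝ[X]) (p : Pt) : MP2 := - sepP (g.comp (C p.1 - X)) (g.comp (C p.2 - X))

lemma ev_Phi (g : ℝ[X]) (p u : Pt) : ev (Phi g p) u = g.eval (p.2 - u.2) - g.eval (p.1 - u.1) := by
  simp [Phi, ev_sepP]

lemma on_Phi (g : ℝ[X]) (θ : Par) (p : Pt) : On g θ p ↔ θ.2.2 = ev (Phi g p) (θ.1, θ.2.1) := by
  rw [ev_Phi, On, pa_eval, pb_eval]
  constructor <;> intro h <;> linarith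

lemma comp_CX_deg (g : ℝ[X]) (a : ℝ) : (g.comp (C a - X)).natDegree = g.natDegree := by
  rw [Polynomial.natDegree_comp]
  have : (C a - X : ℝ[X]).natDegree = 1 := by
    rw [← neg_sub, Polynomial.natDegree_neg]; exact Polynomial.natDegree_X_sub_C a
  rw [this, mul_one]

lemma Phi_deg (g : ℝ[X]) (p : Pt) (d : ℕ) (hd : g.natDegree ≤ d) : (Phi g p).totalDegree ≤ d := by
  rw [Phi, MvPolynomial.totalDegree_neg]
  exact deg_sepP_le _ _ d (by rw [comp_CX_deg]; exact hd) (by rw [comp_CX_deg]; exact hd)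

lemma ev_eval3 (P : Polynomial MP2) (F : MP2) (u : Pt) : ev (P.eval F) u = ev3 P u (ev F u) := by
  rw [ev3, ev, ev, Polynomial.eval_map, Polynomial.eval₂_hom]

lemma deg_eval3 (P : Poly3) (F : MP2) (d : ℕ) (hF : F.totalDegree ≤ d) : (P.P.eval F).totalDegree ≤ (1 + d) * P.e := by
  rw [Polynomial.eval_eq_sum_range]
  refine MvPolynomial.totalDegree_finsetSum_le (fun k hk => ?_)
  refine (MvPolynomial.totalDegree_mul _ _).trans ?_
  have h1 := P.cd k
  have h2 := MvPolynomial.totalDegree_pow F k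
  have h3 : k ≤ P.e := by have := Finset.mem_range.1 hk; have := P.nd; omega
  have h4 : k * F.totalDegree ≤ P.e * d := Nat.mul_le_mul h3 hF
  have h5 : (1 + d) * P.e = P.e + P.e * d := by ring
  omega

noncomputable def Dg (g : ℝ[X]) (a b : ℝ) : ℝ[X] := g.comp (C a - X) - g.comp (C b - X)

lemma Dg_eval (g : ℝ[X]) (a b x : ℝ) : (Dg g a b).eval x = g.eval (a - x) - g.eval (b - x) := by simp [Dg]

lemma Dg_deg (g : ℝ[X]) (a b : ℝ) (d : ℕ) (hd : g.natDegree ≤ d) : (Dg g a b).natDegree ≤ d := by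
  refine (Polynomial.natDegree_sub_le _ _).trans ?_
  rw [comp_CX_deg, comp_CX_deg]; simpa using hd

lemma Dg_pos (g : ℝ[X]) (hg : 2 ≤ g.natDegree) (a b : ℝ) (h : a ≠ b) : 1 ≤ (Dg g a b).natDegree := by
  by_contra hcon
  have h0 : (Dg g a b).natDegree = 0 := by omega
  rw [Polynomial.natDegree_eq_zero] at h0
  obtain ⟨κ, hκ⟩ := h0
  have := periodic_const g hg (a - b) κ (fun x => by
    have h1 := Dg_eval g a b (b - x)
    rw [← hκ, Polynomial.eval_C] at h1
    rw [h1]; congr 2 <;> ring)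
  exact h (by linarith)

lemma deg_aevalmv (φ : Fin 2 → MP2) (hφ : ∀ i, (φ i).totalDegree ≤ 1) (F : MP2) : (MvPolynomial.aeval φ F).totalDegree ≤ F.totalDegree := by
  rw [MvPolynomial.aeval_def, MvPolynomial.eval₂_eq']
  refine MvPolynomial.totalDegree_finsetSum_le (fun m hm => ?_)
  refine (MvPolynomial.totalDegree_mul _ _).trans ?_
  have h1 : (algebraMap ℝ MP2 (F.coeff m)).totalDegree = 0 := MvPolynomial.totalDegree_C _
  rw [h1, zero_add]
  refine (MvPolynomial.totalDegree_finsetProd _ _).trans ?_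
  refine le_trans ?_ (MvPolynomial.le_totalDegree hm)
  rw [Finsupp.sum_fintype _ _ (by simp)]
  refine Finset.sum_le_sum (fun i _ => ?_)
  refine (MvPolynomial.totalDegree_pow _ _).trans ?_
  have := Nat.mul_le_mul_left (m i) (hφ i)
  simpa using this

lemma ev_aevalmv (φ : Fin 2 → MP2) (F : MP2) (u : Pt) : ev (MvPolynomial.aeval φ F) u = ev F (ev (φ 0) u, ev (φ 1) u) := by
  induction F using MvPolynomial.induction_on with
  | C a => simp [ev]
  | add p q hp hq => rw [map_add, ev_add, ev_add, hp, hq]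
  | mul_X p i hp =>
    rw [map_mul, ev_mul, ev_mul, hp, MvPolynomial.aeval_X]
    fin_cases i <;> simp [ev]

lemma line_labels {L V : Type} [DecidableEq L] (d D : ℕ) (hd : 1 ≤ d) (φ : Fin 2 → MP2) (hφ : ∀ i, (φ i).totalDegree ≤ 1)
    (X : Finset V) (pt : V → Pt) (s : V → ℝ) (hpt : ∀ v ∈ X, pt v = (ev (φ 0) (s v, s v), ev (φ 1) (s v, s v))) (lab : V → L)
    (Fs : List MP2) (hne : ∀ v ∈ X, ∀ F ∈ Fs, ev F (pt v) ≠ 0)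
    (hlab : ∀ v ∈ X, ∀ w ∈ X, lab v ≠ lab w → ∃ F ∈ Fs, ev F (pt v) * ev F (pt w) < 0)
    (hD : (Fs.map (fun F => F.totalDegree)).sum ≤ D) : (X.image lab).card ≤ 2 * d ^ 2 + d ^ 2 * (d ^ 2 * D + 1) := by
  refine label_bound d D Polynomial.X Polynomial.X (by simp) (by simpa using hd) (by simp) (by simpa using hd) X (fun v => (s v, s v)) lab
    (fun v hv => rfl) (Fs.map (MvPolynomial.aeval φ)) ?_ ?_ ?_
  · intro v hv F hF
    obtain ⟨F', hF', rfl⟩ := List.mem_map.1 hF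
    rw [ev_aevalmv, ← hpt v hv]; exact hne v hv F' hF'
  · intro v hv w hw hl
    obtain ⟨F, hF, h⟩ := hlab v hv w hw hl
    refine ⟨_, List.mem_map.2 ⟨F, hF, rfl⟩, ?_⟩
    rw [ev_aevalmv, ev_aevalmv, ← hpt v hv, ← hpt w hw]; exact h
  · refine le_trans ?_ hD
    rw [List.map_map]
    exact List.sum_le_sum (fun F _ => deg_aevalmv φ hφ F)

def KL (d D : ℕ) : ℕ := d * (2 * d ^ 2 + d ^ 2 * (d ^ 2 * ((1 + d) * D) + 1))

lemma image_fiber_card {L V : Type} [DecidableEq L] [DecidableEq V] (X : Finset V) (lab : V → L) (R : Finset ℝ) (f : V → ℝ) (hf : ∀ v ∈ X, f v ∈ R) (B d : ℕ)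
    (hR : R.card ≤ d) (hB : ∀ y ∈ R, ((X.filter (fun v => f v = y)).image lab).card ≤ B) : (X.image lab).card ≤ d * B := by
  have : X.image lab ⊆ R.biUnion (fun y => (X.filter (fun v => f v = y)).image lab) := by
    intro l hl
    obtain ⟨v, hv, rfl⟩ := Finset.mem_image.1 hl
    exact Finset.mem_biUnion.2 ⟨f v, hf v hv, Finset.mem_image_of_mem _ (Finset.mem_filter.2 ⟨hv, rfl⟩)⟩
  refine (Finset.card_le_card this).trans ((Finset.card_biUnion_le_card_mul _ _ _ hB).trans (Nat.mul_le_mul_right _ hR))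

lemma pair_labels {L : Type} [DecidableEq L] (g : ℝ[X]) (d D : ℕ) (hg : 2 ≤ g.natDegree) (hd : g.natDegree ≤ d) (p q : Pt) (hpq : p ≠ q)
    (X : Finset Par) (hX : ∀ θ ∈ X, On g θ p ∧ On g θ q) (lab : Par → L) (Ps : List Poly3)
    (hne : ∀ θ ∈ X, ∀ P ∈ Ps, ev3 P.P (θ.1, θ.2.1) θ.2.2 ≠ 0)
    (hlab : ∀ θ ∈ X, ∀ θ' ∈ X, lab θ ≠ lab θ' → ∃ P ∈ Ps, ev3 P.P (θ.1, θ.2.1) θ.2.2 * ev3 P.P (θ'.1, θ'.2.1) θ'.2.2 < 0)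
    (hD : (Ps.map (fun P => P.e)).sum ≤ D) : (X.image lab).card ≤ KL d D := by
  classical
  have hd1 : 1 ≤ d := by omega
  set Fs : List MP2 := Ps.map (fun P => P.P.eval (Phi g p)) with hFs
  have hev : ∀ θ ∈ X, ∀ P : Poly3, ev (P.P.eval (Phi g p)) (θ.1, θ.2.1) = ev3 P.P (θ.1, θ.2.1) θ.2.2 := by
    intro θ hθ P
    rw [ev_eval3, (on_Phi g θ p).1 (hX θ hθ).1]
  have fne : ∀ θ ∈ X, ∀ F ∈ Fs, ev F (θ.1, θ.2.1) ≠ 0 := by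
    intro θ hθ F hF
    obtain ⟨P, hP, rfl⟩ := List.mem_map.1 hF
    rw [hev θ hθ]; exact hne θ hθ P hP
  have flab : ∀ θ ∈ X, ∀ θ' ∈ X, lab θ ≠ lab θ' → ∃ F ∈ Fs, ev F (θ.1, θ.2.1) * ev F (θ'.1, θ'.2.1) < 0 := by
    intro θ hθ θ' hθ' hl
    obtain ⟨P, hP, h⟩ := hlab θ hθ θ' hθ' hl
    refine ⟨_, List.mem_map.2 ⟨P, hP, rfl⟩, ?_⟩
    rw [hev θ hθ, hev θ' hθ']; exact h
  have fD : (Fs.map (fun F => F.totalDegree)).sum ≤ (1 + d) * D := by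
    refine le_trans ?_ (Nat.mul_le_mul_left _ hD)
    rw [hFs, List.map_map, ← List.sum_map_mul_left]
    exact List.sum_le_sum (fun P _ => deg_eval3 P _ d (Phi_deg g p d hd))
  have hcurve : ∀ θ ∈ X, (Dg g p.1 q.1).eval θ.1 = (Dg g p.2 q.2).eval θ.2.1 := by
    intro θ hθ
    have h1 := (on_Phi g θ p).1 (hX θ hθ).1
    have h2 := (on_Phi g θ q).1 (hX θ hθ).2
    rw [ev_Phi] at h1 h2
    rw [Dg_eval, Dg_eval]
    simp only at h1 h2
    linarith
  by_cases c1 : p.1 = q.1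
  · have c2 : p.2 ≠ q.2 := fun h => hpq (Prod.ext c1 h)
    have hpos := Dg_pos g hg p.2 q.2 c2
    have hz : ∀ θ ∈ X, (Dg g p.2 q.2).eval θ.2.1 = 0 := by
      intro θ hθ; rw [← hcurve θ hθ, c1, Dg_eval, sub_self]
    have hn0 : Dg g p.2 q.2 ≠ 0 := by intro h; rw [h] at hpos; simp at hpos
    refine image_fiber_card X lab (Dg g p.2 q.2).roots.toFinset (fun θ => θ.2.1) ?_ _ d ?_ ?_
    · intro θ hθ; rw [Multiset.mem_toFinset, Polynomial.mem_roots hn0]; exact hz θ hθ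
    · exact (Multiset.toFinset_card_le _).trans ((Polynomial.card_roots' _).trans (Dg_deg g _ _ d hd))
    · intro y _
      refine line_labels d ((1 + d) * D) hd1 ![MvPolynomial.X 0, MvPolynomial.C y] ?_ (X.filter (fun θ => θ.2.1 = y)) (fun θ => (θ.1, θ.2.1)) (fun θ => θ.1) ?_ lab Fs
        (fun θ hθ => fne θ (Finset.mem_filter.1 hθ).1) (fun θ hθ θ' hθ' => flab θ (Finset.mem_filter.1 hθ).1 θ' (Finset.mem_filter.1 hθ').1) fD
      · intro i; fin_cases i <;> simp [MvPolynomial.totalDegree_X]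
      · intro θ hθ
        have := (Finset.mem_filter.1 hθ).2
        simp [this]
  · by_cases c2 : p.2 = q.2
    · have hpos := Dg_pos g hg p.1 q.1 c1
      have hz : ∀ θ ∈ X, (Dg g p.1 q.1).eval θ.1 = 0 := by
        intro θ hθ; rw [hcurve θ hθ, c2, Dg_eval, sub_self]
      have hn0 : Dg g p.1 q.1 ≠ 0 := by intro h; rw [h] at hpos; simp at hpos
      refine image_fiber_card X lab (Dg g p.1 q.1).roots.toFinset (fun θ => θ.1) ?_ _ d ?_ ?_
      · intro θ hθ; rw [Multiset.mem_toFinset, Polynomial.mem_roots hn0]; exact hz θ hθ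
      · exact (Multiset.toFinset_card_le _).trans ((Polynomial.card_roots' _).trans (Dg_deg g _ _ d hd))
      · intro y _
        refine line_labels d ((1 + d) * D) hd1 ![MvPolynomial.C y, MvPolynomial.X 1] ?_ (X.filter (fun θ => θ.1 = y)) (fun θ => (θ.1, θ.2.1)) (fun θ => θ.2.1) ?_ lab Fs
          (fun θ hθ => fne θ (Finset.mem_filter.1 hθ).1) (fun θ hθ θ' hθ' => flab θ (Finset.mem_filter.1 hθ).1 θ' (Finset.mem_filter.1 hθ').1) fD
        · intro i; fin_cases i <;> simp [MvPolynomial.totalDegree_X]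
        · intro θ hθ
          have := (Finset.mem_filter.1 hθ).2
          simp [this]
    · refine (label_bound d ((1 + d) * D) (Dg g p.1 q.1) (Dg g p.2 q.2) (Dg_pos g hg _ _ c1) (Dg_deg g _ _ d hd) (Dg_pos g hg _ _ c2)
        (Dg_deg g _ _ d hd) X (fun θ => (θ.1, θ.2.1)) lab hcurve Fs fne flab fD).trans ?_
      exact Nat.le_mul_of_pos_left _ hd1


open Classical in
lemma class_reduce (N : Finset Pt) (R : Pt → Pt → Prop) [∀ p, DecidablePred (R p)] (hr : ∀ p ∈ N, R p p)
    (hs : ∀ p ∈ N, ∀ q ∈ N, R p q → R q p) (ht : ∀ p ∈ N, ∀ q ∈ N, ∀ r ∈ N, R p q → R q r → R p r) (k : ℕ) (hk : 1 ≤ k) :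
    ∃ J ⊆ N, N.card ≤ k * J.card ∧ ∀ p ∈ J, ∀ q ∈ J, p ≠ q → R p q → k < (N.filter (R p)).card := by
  have hrep : ∃ rep : Finset Pt → Pt, ∀ s : Finset Pt, s.Nonempty → rep s ∈ s := by
    have : ∀ s : Finset Pt, ∃ v : Pt, s.Nonempty → v ∈ s := by
      intro s
      by_cases h : s.Nonempty
      · exact ⟨h.choose, fun _ => h.choose_spec⟩
      · exact ⟨(0,0), fun h' => absurd h' h⟩
    choose rep hrep using this
    exact ⟨rep, hrep⟩
  obtain ⟨rep, hrep⟩ := hrep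
  have hcl : ∀ p ∈ N, ∀ q ∈ N, R p q → N.filter (R p) = N.filter (R q) := by
    intro p hp q hq h
    refine Finset.filter_congr (fun r hr' => ⟨fun h1 => ht q hq p hp r hr' (hs p hp q hq h) h1, fun h1 => ht p hp q hq r hr' h h1⟩)
  have hself : ∀ p ∈ N, p ∈ N.filter (R p) := fun p hp => Finset.mem_filter.2 ⟨hp, hr p hp⟩
  have hrepm : ∀ p ∈ N, rep (N.filter (R p)) ∈ N ∧ R p (rep (N.filter (R p))) := fun p hp =>
    Finset.mem_filter.1 (hrep _ ⟨p, hself p hp⟩)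
  refine ⟨N.filter (fun p => k < (N.filter (R p)).card ∨ p = rep (N.filter (R p))), Finset.filter_subset _ _, ?_, ?_⟩
  · refine Finset.card_le_mul_card_image_of_maps_to (f := fun p => if k < (N.filter (R p)).card then p else rep (N.filter (R p))) ?_ k ?_
    · intro p hp
      by_cases h : k < (N.filter (R p)).card
      · simp only [h, if_true]; exact Finset.mem_filter.2 ⟨hp, Or.inl h⟩
      · simp only [h, if_false]
        refine Finset.mem_filter.2 ⟨(hrepm p hp).1, Or.inr ?_⟩
        rw [← hcl p hp _ (hrepm p hp).1 (hrepm p hp).2]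
    · intro j hj
      have hjN := (Finset.mem_filter.1 hj).1
      have key : ∀ p ∈ N, (if k < (N.filter (R p)).card then p else rep (N.filter (R p))) = j → R j p ∧ (k < (N.filter (R j)).card → p = j) := by
        intro p hp he
        by_cases h : k < (N.filter (R p)).card
        · simp only [h, if_true] at he
          subst he; exact ⟨hr p hp, fun _ => rfl⟩
        · simp only [h, if_false] at he
          have h2 := (hrepm p hp).2
          rw [he] at h2
          refine ⟨hs p hp j hjN h2, fun h3 => ?_⟩
          rw [← hcl p hp j hjN h2] at h3; exact absurd h3 h
      by_cases h : k < (N.filter (R j)).card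
      · refine le_trans (Finset.card_le_one.2 ?_) hk
        intro a ha b hb
        have ha := Finset.mem_filter.1 ha
        have hb := Finset.mem_filter.1 hb
        rw [(key a ha.1 ha.2).2 h, (key b hb.1 hb.2).2 h]
      · refine le_trans (Finset.card_le_card ?_) (not_lt.1 h)
        intro a ha
        have ha := Finset.mem_filter.1 ha
        exact Finset.mem_filter.2 ⟨ha.1, (key a ha.1 ha.2).1⟩
  · intro p hp q hq hne hR
    have hp := Finset.mem_filter.1 hp
    have hq := Finset.mem_filter.1 hq
    have := hcl p hp.1 q hq.1 hR
    by_contra hcon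
    have h1 := hp.2.resolve_left hcon
    have h2 := hq.2.resolve_left (by rw [← this]; exact hcon)
    rw [← this, ← h1] at h2
    exact hne h2.symm

lemma Phi_inj (g : ℝ[X]) (hg : 2 ≤ g.natDegree) (p q : Pt) (h : Phi g p = Phi g q) : p = q := by
  have hu : ∀ u : Pt, g.eval (p.2 - u.2) - g.eval (p.1 - u.1) = g.eval (q.2 - u.2) - g.eval (q.1 - u.1) := by
    intro u; rw [← ev_Phi, ← ev_Phi, h]
  refine Prod.ext ?_ ?_
  · have := periodic_const g hg (p.1 - q.1) (g.eval p.2 - g.eval q.2) (fun x => by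
      have := hu (q.1 - x, 0)
      simp only [sub_zero] at this
      have e1 : p.1 - (q.1 - x) = x + (p.1 - q.1) := by ring
      have e2 : q.1 - (q.1 - x) = x := by ring
      rw [e1, e2] at this; linarith)
    linarith
  · have := periodic_const g hg (p.2 - q.2) (g.eval p.1 - g.eval q.1) (fun x => by
      have := hu (0, q.2 - x)
      simp only [sub_zero] at this
      have e1 : p.2 - (q.2 - x) = x + (p.2 - q.2) := by ring
      have e2 : q.2 - (q.2 - x) = x := by ring
      rw [e1, e2] at this; linarith)
    linarith

noncomputable def FP (g : ℝ[X]) (Ps : List Poly3) (p : Pt) : MP2 := (Ps.map (fun Q => Q.P.eval (Phi g p))).prod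

lemma FP_deg (g : ℝ[X]) (d D : ℕ) (hd : g.natDegree ≤ d) (Ps : List Poly3) (hD : (Ps.map (fun P => P.e)).sum ≤ D) (p : Pt) :
    (FP g Ps p).totalDegree ≤ (1 + d) * D := by
  refine le_trans ?_ (Nat.mul_le_mul_left _ hD)
  unfold FP
  clear hD
  induction Ps with
  | nil => simp
  | cons Q Ps ih =>
    simp only [List.map_cons, List.prod_cons, List.sum_cons]
    refine (MvPolynomial.totalDegree_mul _ _).trans ?_
    have := deg_eval3 Q (Phi g p) d (Phi_deg g p d hd)
    rw [mul_add]; omega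

lemma FP_zero (g : ℝ[X]) (Ps : List Poly3) (θ : Par) (p : Pt) (hp : On g θ p) (h : ∃ Q ∈ Ps, ev3 Q.P (θ.1, θ.2.1) θ.2.2 = 0) :
    ev (FP g Ps p) (θ.1, θ.2.1) = 0 := by
  obtain ⟨Q, hQ, h0⟩ := h
  have h1 : Q.P.eval (Phi g p) ∣ FP g Ps p := List.dvd_prod (List.mem_map.2 ⟨Q, hQ, rfl⟩)
  obtain ⟨G, hG⟩ := h1
  rw [hG, ev_mul, ev_eval3, ← (on_Phi g θ p).1 hp, h0, zero_mul]

open Classical in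
lemma FP_special (g : ℝ[X]) (hg : 2 ≤ g.natDegree) (D : ℕ) (Ps : List Poly3) (hD : (Ps.map (fun P => P.e)).sum ≤ D) (P : Finset Pt) :
    (P.filter (fun p => FP g Ps p = 0)).card ≤ D := by
  refine le_trans ?_ hD
  clear hD
  induction Ps with
  | nil => simp [FP]
  | cons Q Ps ih =>
    simp only [List.map_cons, List.sum_cons]
    have : P.filter (fun p => FP g (Q :: Ps) p = 0) ⊆ P.filter (fun p => Q.P.eval (Phi g p) = 0) ∪ P.filter (fun p => FP g Ps p = 0) := by
      intro p hp
      have hp := Finset.mem_filter.1 hp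
      have h2 : Q.P.eval (Phi g p) * FP g Ps p = 0 := by
        have := hp.2
        simpa only [FP, List.map_cons, List.prod_cons] using this
      rcases mul_eq_zero.1 h2 with h | h
      · exact Finset.mem_union_left _ (Finset.mem_filter.2 ⟨hp.1, h⟩)
      · exact Finset.mem_union_right _ (Finset.mem_filter.2 ⟨hp.1, h⟩)
    have h3 : (P.filter (fun p => Q.P.eval (Phi g p) = 0)).card ≤ Q.e := by
      refine le_trans ?_ ((Multiset.toFinset_card_le Q.P.roots).trans ((Polynomial.card_roots' _).trans Q.nd))
      refine Finset.card_le_card_of_injOn (Phi g) ?_ (fun p _ q _ h => Phi_inj g hg p q h)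
      intro p hp
      have hp := Finset.mem_filter.1 hp
      rw [Finset.mem_coe, Multiset.mem_toFinset, Polynomial.mem_roots Q.ne]
      exact hp.2
    exact (Finset.card_le_card this).trans ((Finset.card_union_le _ _).trans (Nat.add_le_add h3 ih))


def KZ (d D : ℕ) : ℕ :=
  ((1 + d) * D) * (((1 + d) * D) * (((1 + d) * D) * ((1 + d) * D))) + ((1 + d) * D) * (((1 + d) * D) * d) + (1 + d) * D

lemma par_ext_of_on (g : ℝ[X]) (θ θ' : Par) (p : Pt) (h : On g θ p) (h' : On g θ' p) (hu : ((θ.1, θ.2.1) : Pt) = (θ'.1, θ'.2.1)) : θ = θ' := by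
  have h1 := (on_Phi g θ p).1 h
  have h2 := (on_Phi g θ' p).1 h'
  rw [hu, ← h2] at h1
  have e1 := congrArg Prod.fst hu
  have e2 := congrArg Prod.snd hu
  exact Prod.ext e1 (Prod.ext e2 h1)

/-- common zeros as a total function -/
lemma cz_total : ∃ cz : MP2 → MP2 → Finset Pt, ∀ F G : MP2, Irreducible F → ¬ F ∣ G →
    (∀ p, ev F p = 0 → ev G p = 0 → p ∈ cz F G) ∧ (cz F G).card ≤ F.totalDegree * G.totalDegree := by
  have : ∀ F G : MP2, ∃ Z : Finset Pt, Irreducible F → ¬ F ∣ G →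
    (∀ p, ev F p = 0 → ev G p = 0 → p ∈ Z) ∧ Z.card ≤ F.totalDegree * G.totalDegree := by
    intro F G
    by_cases h : Irreducible F ∧ ¬ F ∣ G
    · obtain ⟨Z, h1, h2⟩ := common_zeros F G h.1 h.2
      exact ⟨Z, fun _ _ => ⟨h1, h2⟩⟩
    · exact ⟨∅, fun a b => absurd ⟨a, b⟩ h⟩
  choose cz hcz using this
  exact ⟨cz, hcz⟩

open Classical in
set_option maxHeartbeats 800000 in
lemma zpart (g : ℝ[X]) (d D : ℕ) (hg : 2 ≤ g.natDegree) (hd : g.natDegree ≤ d) (Z : Finset Par)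
    (hirr : ∀ θ ∈ Z, Irreducible (HH g θ)) (P : Finset Pt) (Ps : List Poly3) (hD : (Ps.map (fun P => P.e)).sum ≤ D)
    (hZ : ∀ θ ∈ Z, ∃ Q ∈ Ps, ev3 Q.P (θ.1, θ.2.1) θ.2.2 = 0) :
    ∃ Jt : Par → Finset Pt, (∀ θ ∈ Z, ∀ p ∈ Jt θ, p ∈ P ∧ On g θ p) ∧
      (∀ θ ∈ Z, (P.filter (fun p => On g θ p)).card ≤ d ^ 2 * (Jt θ).card + D) ∧
      ∀ p q, p ≠ q → (Z.filter (fun θ => p ∈ Jt θ ∧ q ∈ Jt θ)).card ≤ KZ d D := by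
  have hd1 : 1 ≤ d ^ 2 := Nat.one_le_pow _ _ (by omega)
  -- factor sets
  have hS : ∀ p : Pt, ∃ S : Finset MP2, FP g Ps p ≠ 0 → (∀ f ∈ S, Irreducible f ∧ f.totalDegree ≤ (1 + d) * D) ∧ S.card ≤ (1 + d) * D ∧
      ∀ u, ev (FP g Ps p) u = 0 → ∃ f ∈ S, ev f u = 0 := by
    intro p
    by_cases h : FP g Ps p = 0
    · exact ⟨∅, fun h' => absurd h h'⟩
    · obtain ⟨S, h1, h2, h3⟩ := irr_factors _ h
      have := FP_deg g d D hd Ps hD p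
      exact ⟨S, fun _ => ⟨fun f hf => ⟨(h1 f hf).1, (h1 f hf).2.2.trans this⟩, h2.trans this, h3⟩⟩
  choose S hS using hS
  have hf : ∀ (p : Pt) (θ : Par), ∃ f : MP2, FP g Ps p ≠ 0 → On g θ p → θ ∈ Z → f ∈ S p ∧ ev f (θ.1, θ.2.1) = 0 := by
    intro p θ
    by_cases h : FP g Ps p ≠ 0 ∧ On g θ p ∧ θ ∈ Z
    · obtain ⟨f, h1, h2⟩ := (hS p h.1).2.2 _ (FP_zero g Ps θ p h.2.1 (hZ θ h.2.2))
      exact ⟨f, fun _ _ _ => ⟨h1, h2⟩⟩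
    · exact ⟨0, fun a b c => absurd ⟨a, b, c⟩ h⟩
  choose f hf using hf
  let N : Par → Finset Pt := fun θ => P.filter (fun p => On g θ p ∧ FP g Ps p ≠ 0)
  have hN : ∀ {θ p}, p ∈ N θ ↔ p ∈ P ∧ On g θ p ∧ FP g Ps p ≠ 0 := fun {θ p} => Finset.mem_filter
  let R : Par → Pt → Pt → Prop := fun θ p q => Associated (f p θ) (f q θ) ∧ f p θ ∣ Phi g p - Phi g q
  have hred : ∀ θ : Par, ∃ J ⊆ N θ, (N θ).card ≤ d ^ 2 * J.card ∧ ∀ p ∈ J, ∀ q ∈ J, p ≠ q → R θ p q → d ^ 2 < ((N θ).filter (R θ p)).card := by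
    intro θ
    refine class_reduce (N θ) (R θ) ?_ ?_ ?_ (d ^ 2) hd1
    · intro p _; exact ⟨Associated.refl _, by rw [sub_self]; exact dvd_zero _⟩
    · intro p _ q _ h
      exact ⟨h.1.symm, by rw [← neg_sub, dvd_neg]; exact h.1.symm.dvd.trans h.2⟩
    · intro p _ q _ r _ h h'
      refine ⟨h.1.trans h'.1, ?_⟩
      have := dvd_add h.2 (h.1.dvd.trans h'.2)
      rwa [sub_add_sub_cancel] at this
  choose Jt hJ1 hJ2 hJ3 using hred
  refine ⟨Jt, ?_, ?_, ?_⟩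
  · intro θ hθ p hp
    have h2 := hN.1 (hJ1 θ hp)
    exact ⟨h2.1, h2.2.1⟩
  · intro θ hθ
    refine le_trans ?_ (Nat.add_le_add (hJ2 θ) (FP_special g hg D Ps hD P))
    refine (Finset.card_le_card ?_).trans (Finset.card_union_le _ _)
    intro p hp
    have hp := Finset.mem_filter.1 hp
    by_cases h : FP g Ps p = 0
    · exact Finset.mem_union_right _ (Finset.mem_filter.2 ⟨hp.1, h⟩)
    · exact Finset.mem_union_left _ (hN.2 ⟨hp.1, hp.2, h⟩)
  · intro p q hpq
    obtain ⟨cz, hcz⟩ := cz_total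
    set X := Z.filter (fun θ => p ∈ Jt θ ∧ q ∈ Jt θ) with hX
    have hXm : ∀ θ ∈ X, θ ∈ Z ∧ p ∈ Jt θ ∧ q ∈ Jt θ := fun θ h => Finset.mem_filter.1 h
    rcases X.eq_empty_or_nonempty with hE | ⟨θ0, hθ0⟩
    · rw [hE]; simp
    have hp0 : FP g Ps p ≠ 0 := (hN.1 (hJ1 _ (hXm θ0 hθ0).2.1)).2.2
    have hq0 : FP g Ps q ≠ 0 := (hN.1 (hJ1 _ (hXm θ0 hθ0).2.2)).2.2
    have hpS := hS p hp0
    have hqS := hS q hq0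
    have hon : ∀ θ ∈ X, On g θ p ∧ On g θ q := fun θ h => ⟨(hN.1 (hJ1 _ (hXm θ h).2.1)).2.1, (hN.1 (hJ1 _ (hXm θ h).2.2)).2.1⟩
    have hfp : ∀ θ ∈ X, f p θ ∈ S p ∧ ev (f p θ) (θ.1, θ.2.1) = 0 := fun θ h => hf p θ hp0 (hon θ h).1 (hXm θ h).1
    have hfq : ∀ θ ∈ X, f q θ ∈ S q ∧ ev (f q θ) (θ.1, θ.2.1) = 0 := fun θ h => hf q θ hq0 (hon θ h).2 (hXm θ h).1
    set M := (1 + d) * D with hM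
    -- three parts
    let X1 := X.filter (fun θ => ¬ Associated (f p θ) (f q θ))
    let X2 := X.filter (fun θ => ¬ (f p θ ∣ Phi g p - Phi g q))
    let X3 := X.filter (fun θ => R θ p q)
    have hsub : X ⊆ X1 ∪ X2 ∪ X3 := by
      intro θ h
      by_cases h1 : Associated (f p θ) (f q θ)
      · by_cases h2 : f p θ ∣ Phi g p - Phi g q
        · exact Finset.mem_union_right _ (Finset.mem_filter.2 ⟨h, h1, h2⟩)
        · exact Finset.mem_union_left _ (Finset.mem_union_right _ (Finset.mem_filter.2 ⟨h, h2⟩))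
      · exact Finset.mem_union_left _ (Finset.mem_union_left _ (Finset.mem_filter.2 ⟨h, h1⟩))
    have uinj : ∀ θ ∈ X, ∀ θ' ∈ X, ((θ.1, θ.2.1) : Pt) = (θ'.1, θ'.2.1) → θ = θ' := fun θ h θ' h' hu =>
      par_ext_of_on g θ θ' p (hon θ h).1 (hon θ' h').1 hu
    have c1 : X1.card ≤ M * (M * (M * M)) := by
      let W := (S p).biUnion (fun a => ((S q).filter (fun b => ¬ Associated a b)).biUnion (fun b => cz a b))
      have hW : W.card ≤ M * (M * (M * M)) := by
        refine (Finset.card_biUnion_le_card_mul _ _ (M * (M * M)) ?_).trans (Nat.mul_le_mul_right _ hpS.2.1)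
        intro a ha
        refine (Finset.card_biUnion_le_card_mul _ _ (M * M) ?_).trans (Nat.mul_le_mul_right _ ((Finset.card_filter_le _ _).trans hqS.2.1))
        intro b hb
        have hb := Finset.mem_filter.1 hb
        have hnd : ¬ a ∣ b := fun h => hb.2 ((hpS.1 a ha).1.associated_of_dvd (hqS.1 b hb.1).1 h)
        exact (hcz a b (hpS.1 a ha).1 hnd).2.trans (Nat.mul_le_mul (hpS.1 a ha).2 (hqS.1 b hb.1).2)
      refine le_trans (Finset.card_le_card_of_injOn (fun θ : Par => ((θ.1, θ.2.1) : Pt)) ?_ ?_) hW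
      · intro θ h
        have h := Finset.mem_filter.1 h
        have h1 := hfp θ h.1
        have h2 := hfq θ h.1
        have hnd : ¬ f p θ ∣ f q θ := fun h' => h.2 ((hpS.1 _ h1.1).1.associated_of_dvd (hqS.1 _ h2.1).1 h')
        exact Finset.mem_coe.2 (Finset.mem_biUnion.2 ⟨_, h1.1, Finset.mem_biUnion.2 ⟨_, Finset.mem_filter.2 ⟨h2.1, h.2⟩,
          (hcz _ _ (hpS.1 _ h1.1).1 hnd).1 _ h1.2 h2.2⟩⟩)
      · intro θ h θ' h' hu
        exact uinj θ (Finset.mem_filter.1 h).1 θ' (Finset.mem_filter.1 h').1 hu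
    have c2 : X2.card ≤ M * (M * d) := by
      let W := ((S p).filter (fun a => ¬ a ∣ Phi g p - Phi g q)).biUnion (fun a => cz a (Phi g p - Phi g q))
      have hW : W.card ≤ M * (M * d) := by
        refine (Finset.card_biUnion_le_card_mul _ _ (M * d) ?_).trans (Nat.mul_le_mul_right _ ((Finset.card_filter_le _ _).trans hpS.2.1))
        intro a ha
        have ha := Finset.mem_filter.1 ha
        refine (hcz a _ (hpS.1 a ha.1).1 ha.2).2.trans (Nat.mul_le_mul (hpS.1 a ha.1).2 ?_)
        refine (MvPolynomial.totalDegree_sub _ _).trans (max_le (Phi_deg g p d hd) (Phi_deg g q d hd))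
      refine le_trans (Finset.card_le_card_of_injOn (fun θ : Par => ((θ.1, θ.2.1) : Pt)) ?_ ?_) hW
      · intro θ h
        have h := Finset.mem_filter.1 h
        have h1 := hfp θ h.1
        refine Finset.mem_coe.2 (Finset.mem_biUnion.2 ⟨_, Finset.mem_filter.2 ⟨h1.1, h.2⟩, (hcz _ _ (hpS.1 _ h1.1).1 h.2).1 _ h1.2 ?_⟩)
        rw [ev_sub, ← (on_Phi g θ p).1 (hon θ h.1).1, ← (on_Phi g θ q).1 (hon θ h.1).2, sub_self]
      · intro θ h θ' h' hu
        exact uinj θ (Finset.mem_filter.1 h).1 θ' (Finset.mem_filter.1 h').1 hu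
    have c3 : X3.card ≤ M := by
      refine le_trans (Finset.card_le_card_of_injOn (fun θ : Par => f p θ) ?_ ?_) hpS.2.1
      · intro θ h
        exact (hfp θ (Finset.mem_filter.1 h).1).1
      · intro θ h θ' h' he
        have h := Finset.mem_filter.1 h
        have h' := Finset.mem_filter.1 h'
        simp only at he
        by_contra hne
        have hm := hXm θ h.1
        have hm' := hXm θ' h'.1
        have hbig := hJ3 θ p hm.2.1 q hm.2.2 hpq h.2
        obtain ⟨Y, hY1, hY2⟩ := HH_common g hg d hd θ θ' hne (hirr θ hm.1) (hirr θ' hm'.1)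
        refine absurd ((Finset.card_le_card ?_).trans hY2) (not_le.2 hbig)
        intro r hr
        have hr := Finset.mem_filter.1 hr
        have hr1 := hN.1 hr.1
        refine hY1 r hr1.2.1 ?_
        obtain ⟨G, hG⟩ := hr.2.2
        have e0 : ev (Phi g p - Phi g r) (θ'.1, θ'.2.1) = 0 := by
          rw [hG, ev_mul, he, (hfp θ' h'.1).2, zero_mul]
        rw [ev_sub] at e0
        rw [on_Phi, (on_Phi g θ' p).1 (hon θ' h'.1).1]
        linarith
    refine (Finset.card_le_card hsub).trans ((Finset.card_union_le _ _).trans ?_)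
    have := Finset.card_union_le X1 X2
    unfold KZ
    rw [← hM]
    generalize M * (M * (M * M)) = A1 at *
    generalize M * (M * d) = A2 at *
    omega


open Classical in
set_option maxHeartbeats 800000 in
lemma one_level : ∃ C : ℝ, 0 < C ∧ ∀ (d : ℕ) (T : ℝ) (hT : 1 ≤ T) (D : ℕ) (hD : C * T ^ ((1:ℝ)/3) ≤ D) (g : ℝ[X]) (hg : 2 ≤ g.natDegree) (hd : g.natDegree ≤ d)
    (P : Finset Pt) (Γ : Finset Par) (hirr : ∀ θ ∈ Γ, Irreducible (HH g θ)),
    ∃ Z ⊆ Γ, ∃ κ : Par → Finset Par, ∃ Jt : Par → Finset Pt,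
      (∀ θ ∈ Z, ∀ p ∈ Jt θ, p ∈ P ∧ On g θ p) ∧
      (∀ θ ∈ Z, (P.filter (fun p => On g θ p)).card ≤ d ^ 2 * (Jt θ).card + D) ∧
      (∀ p q, p ≠ q → (Z.filter (fun θ => p ∈ Jt θ ∧ q ∈ Jt θ)).card ≤ KZ d D) ∧
      (∀ L, (((Γ \ Z).filter (fun θ => κ θ = L)).card : ℝ) ≤ Γ.card / T) ∧
      (∀ p q, p ≠ q → (((Γ \ Z).filter (fun θ => On g θ p ∧ On g θ q)).image κ).card ≤ KL d D) := by
  obtain ⟨C, hC, hpart⟩ := partition ((1:ℝ)/3) 6 (by norm_num) (by norm_num)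
  refine ⟨C, hC, ?_⟩
  intro d T hT D hDT g hg hd P Γ hirr
  let v : Poly3 → {θ // θ ∈ Γ} → ℝ := fun Q q => ev3 Q.P (q.1.1, q.1.2.1) q.1.2.2
  obtain ⟨Ps, h1, h2⟩ := hpart v (fun Q => Q.e)
    (hasFeat3 (fun q : {θ // θ ∈ Γ} => (q.1.1, q.1.2.1)) (fun q => q.1.2.2)) T hT
  have hD : (Ps.map (fun Q => Q.e)).sum ≤ D := by exact_mod_cast h2.trans hDT
  let Z := Γ.filter (fun θ => ∃ Q ∈ Ps, ev3 Q.P (θ.1, θ.2.1) θ.2.2 = 0)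
  obtain ⟨Jt, z1, z2, z3⟩ := zpart g d D hg hd Z (fun θ h => hirr θ (Finset.mem_filter.1 h).1) P Ps hD (fun θ h => (Finset.mem_filter.1 h).2)
  let κ : Par → Finset Par := fun θ => if h : θ ∈ Γ then (pcl v Ps ⟨θ, h⟩).image Subtype.val else ∅
  have hne : ∀ θ ∈ Γ \ Z, ∀ Q ∈ Ps, ev3 Q.P (θ.1, θ.2.1) θ.2.2 ≠ 0 := by
    intro θ h Q hQ h0
    have h := Finset.mem_sdiff.1 h
    exact h.2 (Finset.mem_filter.2 ⟨h.1, Q, hQ, h0⟩)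
  have hself : ∀ θ ∈ Γ \ Z, θ ∈ κ θ := by
    intro θ h
    have hΓ := (Finset.mem_sdiff.1 h).1
    simp only [κ, hΓ, dif_pos]
    refine Finset.mem_image.2 ⟨⟨θ, hΓ⟩, mem_pcl.2 (fun Q hQ => ?_), rfl⟩
    exact mul_self_pos.2 (hne θ h Q hQ)
  have hcard : ∀ θ, ((κ θ).card : ℝ) ≤ Γ.card / T := by
    intro θ
    by_cases h : θ ∈ Γ
    · simp only [κ, h, dif_pos]
      have := h1 ⟨θ, h⟩
      rw [Fintype.card_coe] at this
      refine le_trans ?_ this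
      exact_mod_cast Finset.card_image_le
    · simp only [κ, h, dif_neg, not_false_iff]
      simp; positivity
  refine ⟨Z, Finset.filter_subset _ _, κ, Jt, z1, z2, z3, ?_, ?_⟩
  · intro L
    rcases ((Γ \ Z).filter (fun θ => κ θ = L)).eq_empty_or_nonempty with hE | ⟨θ0, h0⟩
    · rw [hE]; simp; positivity
    · have h0 := Finset.mem_filter.1 h0
      refine le_trans ?_ (hcard θ0)
      rw [h0.2]
      refine Nat.cast_le.2 (Finset.card_le_card ?_)
      intro θ h
      have h := Finset.mem_filter.1 h
      rw [← h.2]; exact hself θ h.1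
  · intro p q hpq
    refine pair_labels g d D hg hd p q hpq _ (fun θ h => (Finset.mem_filter.1 h).2) κ Ps
      (fun θ h => hne θ (Finset.mem_filter.1 h).1) ?_ hD
    intro θ h θ' h' hl
    have h := (Finset.mem_filter.1 h).1
    have h' := (Finset.mem_filter.1 h').1
    by_contra hcon
    push Not at hcon
    refine hl ?_
    have hΓ := (Finset.mem_sdiff.1 h).1
    have hΓ' := (Finset.mem_sdiff.1 h').1
    simp only [κ, hΓ, hΓ', dif_pos]
    have hsame : Same v Ps ⟨θ, hΓ⟩ ⟨θ', hΓ'⟩ := fun Q hQ =>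
      lt_of_le_of_ne (hcon Q hQ) (mul_ne_zero (hne θ h Q hQ) (hne θ' h' Q hQ)).symm
    rw [pcl_eq hsame]

def GG (K q : ℕ) : ℕ → ℕ
  | 0 => 0
  | l+1 => K + q * GG K q l

lemma GG_le (K q : ℕ) (hq : 2 ≤ q) (l : ℕ) : GG K q l + K ≤ K * q ^ l := by
  induction l with
  | zero => simp [GG]
  | succ l ih =>
    have h1 := Nat.mul_le_mul_left q ih
    have h2 := Nat.mul_le_mul_right K hq
    have h3 : K * q ^ (l+1) = q * (K * q ^ l) := by ring
    rw [h3, GG]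
    rw [mul_add] at h1
    omega

open Classical in
set_option maxHeartbeats 800000 in
lemma multi_level : ∃ C : ℝ, 0 < C ∧ ∀ (d : ℕ) (T : ℝ) (hT : 1 ≤ T) (D : ℕ) (hD : C * T ^ ((1:ℝ)/3) ≤ D) (g : ℝ[X]) (hg : 2 ≤ g.natDegree) (hd : g.natDegree ≤ d)
    (P : Finset Pt) (l : ℕ) (Γ : Finset Par) (hirr : ∀ θ ∈ Γ, Irreducible (HH g θ)),
    ∃ Z ⊆ Γ, ∃ κ : Par → List (Finset Par), ∃ Jt : Par → Finset Pt,
      (∀ θ ∈ Z, ∀ p ∈ Jt θ, p ∈ P ∧ On g θ p) ∧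
      (∀ θ ∈ Z, (P.filter (fun p => On g θ p)).card ≤ d ^ 2 * (Jt θ).card + D) ∧
      (∀ p q, p ≠ q → (Z.filter (fun θ => p ∈ Jt θ ∧ q ∈ Jt θ)).card ≤ GG (KZ d D) (KL d D) l) ∧
      (∀ L, (((Γ \ Z).filter (fun θ => κ θ = L)).card : ℝ) ≤ Γ.card / T ^ l) ∧
      (∀ p q, p ≠ q → (((Γ \ Z).filter (fun θ => On g θ p ∧ On g θ q)).image κ).card ≤ (KL d D) ^ l) := by
  obtain ⟨C, hC, hone⟩ := one_level
  refine ⟨C, hC, ?_⟩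
  intro d T hT D hD g hg hd P l
  have hT0 : 0 < T := by linarith
  induction l with
  | zero =>
    intro Γ hirr
    refine ⟨∅, Finset.empty_subset _, fun _ => [], fun _ => ∅, by simp, by simp, by simp, ?_, ?_⟩
    · intro L
      simp only [pow_zero, div_one]
      refine Nat.cast_le.2 ((Finset.card_filter_le _ _).trans ?_)
      simp
    · intro p q _
      rw [pow_zero]
      refine Finset.card_le_one.2 ?_
      intro a ha b hb
      obtain ⟨_, _, rfl⟩ := Finset.mem_image.1 ha
      obtain ⟨_, _, rfl⟩ := Finset.mem_image.1 hb
      rfl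
  | succ l ih =>
    intro Γ hirr
    obtain ⟨Z1, hZ1, κ1, J1, a1, a2, a3, a4, a5⟩ := hone d T hT D hD g hg hd P Γ hirr
    let ΓL : Finset Par → Finset Par := fun L => (Γ \ Z1).filter (fun θ => κ1 θ = L)
    have hΓL : ∀ L, ∀ θ ∈ ΓL L, (θ ∈ Γ ∧ θ ∉ Z1) ∧ κ1 θ = L := by
      intro L θ h
      have h := Finset.mem_filter.1 h
      exact ⟨Finset.mem_sdiff.1 h.1, h.2⟩
    have hΓL' : ∀ θ ∈ Γ, θ ∉ Z1 → θ ∈ ΓL (κ1 θ) := fun θ h h' => Finset.mem_filter.2 ⟨Finset.mem_sdiff.2 ⟨h, h'⟩, rfl⟩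
    have hL := fun L => ih (ΓL L) (fun θ h => hirr θ (hΓL L θ h).1.1)
    choose ZL hZL κL JL b1 b2 b3 b4 b5 using hL
    let Z := Γ.filter (fun θ => θ ∈ Z1 ∨ θ ∈ ZL (κ1 θ))
    let κ : Par → List (Finset Par) := fun θ => κ1 θ :: κL (κ1 θ) θ
    let Jt : Par → Finset Pt := fun θ => if θ ∈ Z1 then J1 θ else JL (κ1 θ) θ
    have hnZ : ∀ θ, θ ∈ Γ \ Z → (θ ∈ Γ ∧ θ ∉ Z1) ∧ θ ∈ ΓL (κ1 θ) \ ZL (κ1 θ) := by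
      intro θ h
      have h := Finset.mem_sdiff.1 h
      have h1 : θ ∉ Z1 := fun h' => h.2 (Finset.mem_filter.2 ⟨h.1, Or.inl h'⟩)
      have h2 : θ ∉ ZL (κ1 θ) := fun h' => h.2 (Finset.mem_filter.2 ⟨h.1, Or.inr h'⟩)
      exact ⟨⟨h.1, h1⟩, Finset.mem_sdiff.2 ⟨hΓL' θ h.1 h1, h2⟩⟩
    refine ⟨Z, Finset.filter_subset _ _, κ, Jt, ?_, ?_, ?_, ?_, ?_⟩
    · intro θ h p hp
      have h := Finset.mem_filter.1 h
      by_cases h1 : θ ∈ Z1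
      · simp only [Jt, h1, if_true] at hp; exact a1 θ h1 p hp
      · simp only [Jt, h1, if_false] at hp; exact b1 _ θ (h.2.resolve_left h1) p hp
    · intro θ h
      have h := Finset.mem_filter.1 h
      by_cases h1 : θ ∈ Z1
      · simp only [Jt, h1, if_true]; exact a2 θ h1
      · simp only [Jt, h1, if_false]; exact b2 _ θ (h.2.resolve_left h1)
    · intro p q hpq
      let Ls := (((Γ \ Z1).filter (fun θ => On g θ p ∧ On g θ q)).image κ1)
      have hsub : Z.filter (fun θ => p ∈ Jt θ ∧ q ∈ Jt θ) ⊆ Z1.filter (fun θ => p ∈ J1 θ ∧ q ∈ J1 θ) ∪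
          Ls.biUnion (fun L => (ZL L).filter (fun θ => p ∈ JL L θ ∧ q ∈ JL L θ)) := by
        intro θ h
        have h := Finset.mem_filter.1 h
        have hz := Finset.mem_filter.1 h.1
        have hj := h.2
        by_cases h1 : θ ∈ Z1
        · simp only [Jt, h1, if_true] at hj
          exact Finset.mem_union_left _ (Finset.mem_filter.2 ⟨h1, hj⟩)
        · simp only [Jt, h1, if_false] at hj
          have hzl := hz.2.resolve_left h1
          refine Finset.mem_union_right _ (Finset.mem_biUnion.2 ⟨κ1 θ, ?_, Finset.mem_filter.2 ⟨hzl, hj⟩⟩)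
          exact Finset.mem_image.2 ⟨θ, Finset.mem_filter.2 ⟨Finset.mem_sdiff.2 ⟨hz.1, h1⟩, (b1 _ θ hzl p hj.1).2, (b1 _ θ hzl q hj.2).2⟩, rfl⟩
      refine (Finset.card_le_card hsub).trans ((Finset.card_union_le _ _).trans ?_)
      rw [GG]
      refine Nat.add_le_add (a3 p q hpq) ?_
      exact (Finset.card_biUnion_le_card_mul _ _ _ (fun L _ => b3 L p q hpq)).trans (Nat.mul_le_mul_right _ (a5 p q hpq))
    · intro L
      rcases ((Γ \ Z).filter (fun θ => κ θ = L)).eq_empty_or_nonempty with hE | ⟨θ0, h0⟩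
      · rw [hE]; simp; positivity
      · have h0 := Finset.mem_filter.1 h0
        have hc : ((ΓL (κ1 θ0)).card : ℝ) / T ^ l ≤ Γ.card / T ^ (l+1) := by
          have := a4 (κ1 θ0)
          rw [pow_succ, mul_comm, ← div_div]
          exact div_le_div_of_nonneg_right this (by positivity)
        refine le_trans ?_ ((b4 (κ1 θ0) (κL (κ1 θ0) θ0)).trans hc)
        refine Nat.cast_le.2 (Finset.card_le_card ?_)
        intro θ h
        have h := Finset.mem_filter.1 h
        have e := h.2.trans h0.2.symm
        simp only [κ, List.cons.injEq] at e
        have h3 := (hnZ θ h.1).2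
        rw [e.1] at h3
        refine Finset.mem_filter.2 ⟨h3, ?_⟩
        have e2 := e.2
        rw [e.1] at e2
        exact e2
    · intro p q hpq
      let Ls := (((Γ \ Z1).filter (fun θ => On g θ p ∧ On g θ q)).image κ1)
      have hsub : ((Γ \ Z).filter (fun θ => On g θ p ∧ On g θ q)).image κ ⊆
          Ls.biUnion (fun L => (((ΓL L \ ZL L).filter (fun θ => On g θ p ∧ On g θ q)).image (κL L)).image (fun M => L :: M)) := by
        intro M hM
        obtain ⟨θ, h, rfl⟩ := Finset.mem_image.1 hM
        have h := Finset.mem_filter.1 h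
        have h2 := hnZ θ h.1
        refine Finset.mem_biUnion.2 ⟨κ1 θ, Finset.mem_image.2 ⟨θ, Finset.mem_filter.2 ⟨Finset.mem_sdiff.2 h2.1, h.2⟩, rfl⟩, ?_⟩
        exact Finset.mem_image.2 ⟨_, Finset.mem_image.2 ⟨θ, Finset.mem_filter.2 ⟨h2.2, h.2⟩, rfl⟩, rfl⟩
      refine (Finset.card_le_card hsub).trans ?_
      rw [pow_succ, mul_comm]
      refine (Finset.card_biUnion_le_card_mul _ _ _ (fun L _ => Finset.card_image_le.trans (b5 L p q hpq))).trans (Nat.mul_le_mul_right _ (a5 p q hpq))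


open Classical in
/-- Incidences in a labelled family of curves. -/
lemma labelled_inc (d : ℕ) (ε : ℝ) (hε : 0 < ε) : ∃ C1 C2 : ℝ, 1 ≤ C1 ∧ 0 < C2 ∧ ∀ (g : ℝ[X]) (hg : 2 ≤ g.natDegree) (hd : g.natDegree ≤ d)
    (P : Finset Pt) (Γ : Finset Par) (hirr : ∀ θ ∈ Γ, Irreducible (HH g θ)) (κ : Par → List (Finset Par)) (s : ℝ) (hs0 : 0 ≤ s) (μ : ℕ) (hμ : 1 ≤ μ)
    (hs : ∀ L, ((Γ.filter (fun θ => κ θ = L)).card : ℝ) ≤ s)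
    (hq : ∀ p q, p ≠ q → ((Γ.filter (fun θ => On g θ p ∧ On g θ q)).image κ).card ≤ μ),
    (((Γ ×ˢ P).filter (fun x => On g x.1 x.2)).card : ℝ) ≤ C1 * ((μ:ℝ) ^ (1/3 : ℝ) * (P.card : ℝ) ^ (2/3 : ℝ) * (Γ.card : ℝ) ^ (2/3 : ℝ) + μ * P.card + Γ.card)
      + C2 * (Γ.card * s ^ (1/2 + ε)) := by
  obtain ⟨C1, hC1, hst⟩ := st_lemma d
  obtain ⟨C2, hC2, hlens⟩ := lens d ε hε
  refine ⟨C1, C2, hC1, hC2, ?_⟩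
  intro g hg hd P Γ hirr κ s hs0 μ hμ hs hq
  set J := (Γ ×ˢ P).filter (fun x => On g x.1 x.2) with hJ
  have hJm : ∀ x ∈ J, x.1 ∈ Γ ∧ x.2 ∈ P ∧ On g x.1 x.2 := by
    intro x hx
    have hx := Finset.mem_filter.1 hx
    have h2 := Finset.mem_product.1 hx.1
    exact ⟨h2.1, h2.2, hx.2⟩
  let U := (edgesOf g J).filter (fun e => ∀ e' ∈ edgesOf g J, e'.2 = e.2 → κ e'.1 = κ e.1 → e'.1 = e.1)
  have hU : ∀ p q : Pt, ((U.filter (fun e => e.2 = (p, q))).card : ℝ) ≤ (μ : ℝ) := by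
    intro p q
    refine Nat.cast_le.2 ?_
    rcases (U.filter (fun e => e.2 = (p, q))).eq_empty_or_nonempty with hE | ⟨e0, h0⟩
    · rw [hE]; simp
    have hpq : p ≠ q := by
      have h0 := Finset.mem_filter.1 h0
      have h1 := mem_edgesOf.1 (Finset.mem_filter.1 h0.1).1
      have h2 := h1.2.2.2.2.2.1
      rw [h0.2] at h2
      rintro rfl; exact lt_irrefl _ h2
    refine le_trans (Finset.card_le_card_of_injOn (fun e : Edge => κ e.1) ?_ ?_) (hq p q hpq)
    · intro e he
      have he := Finset.mem_filter.1 he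
      have h1 := mem_edgesOf.1 (Finset.mem_filter.1 he.1).1
      rw [he.2] at h1
      have j1 := hJm _ h1.1
      have j2 := hJm _ h1.2.1
      exact Finset.mem_coe.2 (Finset.mem_image.2 ⟨e.1, Finset.mem_filter.2 ⟨j1.1, j1.2.2, j2.2.2⟩, rfl⟩)
    · intro e he e' he' hk
      have he := Finset.mem_filter.1 he
      have he' := Finset.mem_filter.1 he'
      have h1 := Finset.mem_filter.1 he.1
      have h1' := Finset.mem_filter.1 he'.1
      have e2 : e'.2 = e.2 := he'.2.trans he.2.symm
      have := h1.2 e' h1'.1 e2 hk.symm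
      exact (Prod.ext this e2).symm
  have main := hst g hg hd Γ hirr P J hJm U (μ : ℝ) (by exact_mod_cast hμ) hU
  refine main.trans (add_le_add le_rfl ?_)
  set E := edgesOf g J \ U with hE
  have hEm : ∀ e ∈ E, Nxt g J e.1 e.2.1 e.2.2 ∧ e.1 ∈ Γ ∧ ∃ e' ∈ E, e'.2 = e.2 ∧ κ e'.1 = κ e.1 ∧ e'.1 ≠ e.1 := by
    intro e he
    have he := Finset.mem_sdiff.1 he
    refine ⟨mem_edgesOf.1 he.1, (hJm _ (mem_edgesOf.1 he.1).1).1, ?_⟩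
    have : ¬ ∀ e' ∈ edgesOf g J, e'.2 = e.2 → κ e'.1 = κ e.1 → e'.1 = e.1 := fun h => he.2 (Finset.mem_filter.2 ⟨he.1, h⟩)
    push Not at this
    obtain ⟨e', a, b, c, dd⟩ := this
    refine ⟨e', Finset.mem_sdiff.2 ⟨a, fun h => ?_⟩, b, c, dd⟩
    exact dd ((Finset.mem_filter.1 h).2 e he.1 b.symm c.symm).symm
  let Ls := Γ.image κ
  have hsum : E.card = ∑ L ∈ Ls, (E.filter (fun e => κ e.1 = L)).card :=
    Finset.card_eq_sum_card_fiberwise (fun e he => Finset.mem_coe.2 (Finset.mem_image_of_mem κ (hEm e he).2.1))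
  have hsumΓ : Γ.card = ∑ L ∈ Ls, (Γ.filter (fun θ => κ θ = L)).card :=
    Finset.card_eq_sum_card_fiberwise (fun θ h => Finset.mem_coe.2 (Finset.mem_image_of_mem κ h))
  have hL : ∀ L ∈ Ls, ((E.filter (fun e => κ e.1 = L)).card : ℝ) ≤ C2 * (((Γ.filter (fun θ => κ θ = L)).card : ℝ) * s ^ (1/2 + ε)) := by
    intro L _
    have hls : LensSys g (Γ.filter (fun θ => κ θ = L)) (E.filter (fun e => κ e.1 = L)) := by
      refine ⟨?_, ?_, ?_, ?_⟩
      · intro e he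
        have he := Finset.mem_filter.1 he
        exact Finset.mem_filter.2 ⟨(hEm e he.1).2.1, he.2⟩
      · intro e he
        have h := (hEm e (Finset.mem_filter.1 he).1).1
        exact ⟨h.2.2.1, h.2.2.2.1, h.2.2.2.2.1, h.2.2.2.2.2.1⟩
      · intro e he e' he' hne h1 ha
        have h := (hEm e (Finset.mem_filter.1 he).1).1
        have h' := (hEm e' (Finset.mem_filter.1 he').1).1
        rw [← h1] at h' ha
        refine h.nonoverlap h' (fun hh => hne (Prod.ext h1 ?_)) ha
        exact hh
      · intro e he
        have he := Finset.mem_filter.1 he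
        obtain ⟨e', a, b, c, dd⟩ := (hEm e he.1).2.2
        exact ⟨e', Finset.mem_filter.2 ⟨a, c.trans he.2⟩, dd, b⟩
    have h1 := hlens g hg hd _ (fun θ h => hirr θ (Finset.mem_filter.1 h).1) _ hls
    refine h1.trans (mul_le_mul_of_nonneg_left ?_ hC2.le)
    have e : (3/2 + ε : ℝ) = 1 + (1/2 + ε) := by ring
    have h2 := hs L
    generalize ((Γ.filter (fun θ => κ θ = L)).card) = nL at *
    rcases Nat.eq_zero_or_pos nL with h0 | h0
    · subst h0
      rw [Nat.cast_zero, Real.zero_rpow (by linarith), zero_mul]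
    · have : (0:ℝ) < nL := by exact_mod_cast h0
      rw [e, Real.rpow_add this, Real.rpow_one]
      exact mul_le_mul_of_nonneg_left (Real.rpow_le_rpow this.le h2 (by linarith)) this.le
  rw [hsum]
  push_cast
  refine (Finset.sum_le_sum hL).trans ?_
  rw [← Finset.mul_sum, ← Finset.sum_mul]
  refine le_of_eq ?_
  congr 2
  rw [hsumΓ]; push_cast; rfl

open Classical in
/-- Incidences in the zero set part. -/
lemma zero_inc (d : ℕ) : ∃ C1 : ℝ, 1 ≤ C1 ∧ ∀ (g : ℝ[X]) (hg : 2 ≤ g.natDegree) (hd : g.natDegree ≤ d)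
    (P : Finset Pt) (Z : Finset Par) (hirr : ∀ θ ∈ Z, Irreducible (HH g θ)) (D : ℕ) (Jt : Par → Finset Pt) (μ : ℕ) (hμ : 1 ≤ μ)
    (h1 : ∀ θ ∈ Z, ∀ p ∈ Jt θ, p ∈ P ∧ On g θ p)
    (h2 : ∀ θ ∈ Z, (P.filter (fun p => On g θ p)).card ≤ d ^ 2 * (Jt θ).card + D)
    (h3 : ∀ p q, p ≠ q → (Z.filter (fun θ => p ∈ Jt θ ∧ q ∈ Jt θ)).card ≤ μ),
    (((Z ×ˢ P).filter (fun x => On g x.1 x.2)).card : ℝ) ≤ d ^ 2 * (C1 * ((μ:ℝ) ^ (1/3 : ℝ) * (P.card : ℝ) ^ (2/3 : ℝ) * (Z.card : ℝ) ^ (2/3 : ℝ) + μ * P.card + Z.card))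
      + D * Z.card := by
  obtain ⟨C1, hC1, hst⟩ := st_lemma d
  refine ⟨C1, hC1, ?_⟩
  intro g hg hd P Z hirr D Jt μ hμ h1 h2 h3
  set J := (Z ×ˢ P).filter (fun x => x.2 ∈ Jt x.1) with hJ
  have hmemJ : ∀ {θ p}, (θ, p) ∈ J ↔ θ ∈ Z ∧ p ∈ Jt θ := by
    intro θ p
    rw [Finset.mem_filter, Finset.mem_product]
    exact ⟨fun h => ⟨h.1.1, h.2⟩, fun h => ⟨⟨h.1, (h1 θ h.1 p h.2).1⟩, h.2⟩⟩
  have hJm : ∀ x ∈ J, x.1 ∈ Z ∧ x.2 ∈ P ∧ On g x.1 x.2 := by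
    rintro ⟨θ, p⟩ hx
    have h := hmemJ.1 hx
    exact ⟨h.1, h1 θ h.1 p h.2⟩
  have hU : ∀ p q : Pt, (((edgesOf g J).filter (fun e => e.2 = (p, q))).card : ℝ) ≤ (μ : ℝ) := by
    intro p q
    refine Nat.cast_le.2 ?_
    rcases ((edgesOf g J).filter (fun e => e.2 = (p, q))).eq_empty_or_nonempty with hE | ⟨e0, h0⟩
    · rw [hE]; simp
    have hpq : p ≠ q := by
      have h0 := Finset.mem_filter.1 h0
      have h1 := mem_edgesOf.1 h0.1
      have h2 := h1.2.2.2.2.2.1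
      rw [h0.2] at h2
      rintro rfl; exact lt_irrefl _ h2
    refine le_trans (Finset.card_le_card_of_injOn (fun e : Edge => e.1) ?_ ?_) (h3 p q hpq)
    · intro e he
      have he := Finset.mem_filter.1 he
      have h1 := mem_edgesOf.1 he.1
      rw [he.2] at h1
      have j1 := hmemJ.1 h1.1
      have j2 := hmemJ.1 h1.2.1
      exact Finset.mem_coe.2 (Finset.mem_filter.2 ⟨j1.1, j1.2, j2.2⟩)
    · intro e he e' he' hk
      have he := Finset.mem_filter.1 he
      have he' := Finset.mem_filter.1 he'
      exact Prod.ext hk (he.2.trans he'.2.symm)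
  have main := hst g hg hd Z hirr P J hJm (edgesOf g J) (μ : ℝ) (by exact_mod_cast hμ) hU
  rw [Finset.sdiff_self, Finset.card_empty, Nat.cast_zero, add_zero] at main
  have e1 : ((Z ×ˢ P).filter (fun x => On g x.1 x.2)).card = ∑ θ ∈ Z, (P.filter (fun p => On g θ p)).card := by
    rw [Finset.card_filter, Finset.sum_product]
    exact Finset.sum_congr rfl (fun θ _ => (Finset.card_filter _ _).symm)
  have e2 : J.card = ∑ θ ∈ Z, (Jt θ).card := by
    rw [hJ, Finset.card_filter, Finset.sum_product]
    refine Finset.sum_congr rfl (fun θ hθ => ?_)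
    rw [← Finset.card_filter]
    congr 1
    ext p
    rw [Finset.mem_filter]
    exact ⟨fun h => h.2, fun h => ⟨(h1 θ hθ p h).1, h⟩⟩
  have e3 : ((Z ×ˢ P).filter (fun x => On g x.1 x.2)).card ≤ d ^ 2 * J.card + D * Z.card := by
    rw [e1, e2, Finset.mul_sum, mul_comm D, ← smul_eq_mul (Z.card), ← Finset.sum_const, ← Finset.sum_add_distrib]
    exact Finset.sum_le_sum h2
  have e4 : (((Z ×ˢ P).filter (fun x => On g x.1 x.2)).card : ℝ) ≤ (d:ℝ) ^ 2 * J.card + D * Z.card := by exact_mod_cast e3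
  refine e4.trans (add_le_add (mul_le_mul_of_nonneg_left main (by positivity)) le_rfl)

open Classical in
lemma inc_level (d : ℕ) (ε : ℝ) (hε : 0 < ε) : ∃ C1 C2 C3 : ℝ, 1 ≤ C1 ∧ 0 < C2 ∧ 0 < C3 ∧ ∀ (T : ℝ) (hT : 1 ≤ T) (D : ℕ) (hD : C3 * T ^ ((1:ℝ)/3) ≤ D)
    (g : ℝ[X]) (hg : 2 ≤ g.natDegree) (hd : g.natDegree ≤ d)
    (P : Finset Pt) (Γ : Finset Par) (hirr : ∀ θ ∈ Γ, Irreducible (HH g θ)) (l : ℕ) (μ : ℕ) (hμ : (KZ d D + 1) * KL d D ^ l ≤ μ),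
    (((Γ ×ˢ P).filter (fun x => On g x.1 x.2)).card : ℝ) ≤ (d ^ 2 + 1) * C1 * ((μ:ℝ) ^ (1/3 : ℝ) * (P.card : ℝ) ^ (2/3 : ℝ) * (Γ.card : ℝ) ^ (2/3 : ℝ) + μ * P.card + Γ.card)
      + D * Γ.card + C2 * (Γ.card * (Γ.card / T ^ l) ^ (1/2 + ε)) := by
  obtain ⟨C1, C2, hC1, hC2, hlab⟩ := labelled_inc d ε hε
  obtain ⟨C1', hC1', hzero⟩ := zero_inc d
  obtain ⟨C3, hC3, hmul⟩ := multi_level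
  refine ⟨max C1 C1', C2, C3, hC1.trans (le_max_left _ _), hC2, hC3, ?_⟩
  intro T hT D hD g hg hd P Γ hirr l μ hμ
  obtain ⟨Z, hZ, κ, Jt, a1, a2, a3, a4, a5⟩ := hmul d T hT D hD g hg hd P l Γ hirr
  have hKL : 2 ≤ KL d D := by
    have : 2 ≤ d := hg.trans hd
    unfold KL
    have h1 : 1 ≤ d ^ 2 := Nat.one_le_pow _ _ (by omega)
    calc 2 = 1 * (2 * 1) := rfl
      _ ≤ d * (2 * d ^ 2 + d ^ 2 * (d ^ 2 * ((1 + d) * D) + 1)) := by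
        refine Nat.mul_le_mul (by omega) ?_
        exact (Nat.mul_le_mul_left 2 h1).trans (Nat.le_add_right _ _)
  have hpw : 1 ≤ KL d D ^ l := Nat.one_le_pow _ _ (by omega)
  have hμ1 : KL d D ^ l ≤ μ := le_trans (by nlinarith [Nat.zero_le (KZ d D)]) hμ
  have hμ2 : GG (KZ d D) (KL d D) l ≤ μ := by
    have := GG_le (KZ d D) (KL d D) hKL l
    have h2 : KZ d D * KL d D ^ l ≤ (KZ d D + 1) * KL d D ^ l := Nat.mul_le_mul_right _ (Nat.le_succ _)
    omega
  have hμ0 : 1 ≤ μ := hpw.trans hμ1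
  have hsub : Γ \ Z ⊆ Γ := Finset.sdiff_subset
  have r1 := hlab g hg hd P (Γ \ Z) (fun θ h => hirr θ (hsub h)) κ (Γ.card / T ^ l) (by positivity) μ hμ0 a4 (fun p q h => (a5 p q h).trans hμ1)
  have r2 := hzero g hg hd P Z (fun θ h => hirr θ (hZ h)) D Jt μ hμ0 a1 a2 (fun p q h => (a3 p q h).trans hμ2)
  have hcov : ((Γ ×ˢ P).filter (fun x => On g x.1 x.2)).card ≤ (((Γ \ Z) ×ˢ P).filter (fun x => On g x.1 x.2)).card + ((Z ×ˢ P).filter (fun x => On g x.1 x.2)).card := by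
    refine (Finset.card_le_card ?_).trans (Finset.card_union_le _ _)
    intro x hx
    have hx := Finset.mem_filter.1 hx
    have h2 := Finset.mem_product.1 hx.1
    by_cases h : x.1 ∈ Z
    · exact Finset.mem_union_right _ (Finset.mem_filter.2 ⟨Finset.mem_product.2 ⟨h, h2.2⟩, hx.2⟩)
    · exact Finset.mem_union_left _ (Finset.mem_filter.2 ⟨Finset.mem_product.2 ⟨Finset.mem_sdiff.2 ⟨h2.1, h⟩, h2.2⟩, hx.2⟩)
  have hcov' : (((Γ ×ˢ P).filter (fun x => On g x.1 x.2)).card : ℝ) ≤ (((Γ \ Z) ×ˢ P).filter (fun x => On g x.1 x.2)).card + ((Z ×ˢ P).filter (fun x => On g x.1 x.2)).card := by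
    exact_mod_cast hcov
  have hn1 : ((Γ \ Z).card : ℝ) ≤ Γ.card := by exact_mod_cast Finset.card_le_card hsub
  have hn2 : (Z.card : ℝ) ≤ Γ.card := by exact_mod_cast Finset.card_le_card hZ
  have p1 : ((Γ \ Z).card : ℝ) ^ (2/3 : ℝ) ≤ (Γ.card : ℝ) ^ (2/3 : ℝ) := Real.rpow_le_rpow (by positivity) hn1 (by norm_num)
  have p2 : (Z.card : ℝ) ^ (2/3 : ℝ) ≤ (Γ.card : ℝ) ^ (2/3 : ℝ) := Real.rpow_le_rpow (by positivity) hn2 (by norm_num)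
  have hA : (0:ℝ) ≤ (μ:ℝ) ^ (1/3 : ℝ) * (P.card : ℝ) ^ (2/3 : ℝ) := by positivity
  have hB : (0:ℝ) ≤ (Γ.card / T ^ l : ℝ) ^ (1/2 + ε) := by positivity
  have hμP : (0:ℝ) ≤ (μ:ℝ) * P.card := by positivity
  generalize (Γ.card / T ^ l : ℝ) ^ (1/2 + ε) = s at *
  generalize (μ:ℝ) ^ (1/3 : ℝ) * (P.card : ℝ) ^ (2/3 : ℝ) = A at *
  have q1 := mul_le_mul_of_nonneg_left p1 hA
  have q2 := mul_le_mul_of_nonneg_left p2 hA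
  have hG : (0:ℝ) ≤ A * (Γ.card : ℝ) ^ (2/3 : ℝ) := by positivity
  generalize A * (Γ.card : ℝ) ^ (2/3 : ℝ) = G at *
  generalize A * ((Γ \ Z).card : ℝ) ^ (2/3 : ℝ) = G1 at *
  generalize A * (Z.card : ℝ) ^ (2/3 : ℝ) = G2 at *
  generalize (μ:ℝ) * P.card = M at *
  have hn0 : (0:ℝ) ≤ Γ.card := by positivity
  have hz0 : (0:ℝ) ≤ Z.card := by positivity
  have hD0 : (0:ℝ) ≤ D := by positivity
  have hd0 : (0:ℝ) ≤ (d:ℝ) ^ 2 := by positivity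
  generalize ((Γ \ Z).card : ℝ) = n1 at *
  generalize (Z.card : ℝ) = n2 at *
  generalize (Γ.card : ℝ) = n at *
  generalize (d:ℝ) ^ 2 = dd at *
  have t1 : C1 * (G1 + M + n1) ≤ max C1 C1' * (G + M + n) := by
    have : G1 + M + n1 ≤ G + M + n := by linarith
    calc C1 * (G1 + M + n1) ≤ C1 * (G + M + n) := mul_le_mul_of_nonneg_left this (by linarith)
      _ ≤ _ := mul_le_mul_of_nonneg_right (le_max_left _ _) (by linarith)
  have t2 : C1' * (G2 + M + n2) ≤ max C1 C1' * (G + M + n) := by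
    have : G2 + M + n2 ≤ G + M + n := by linarith
    calc C1' * (G2 + M + n2) ≤ C1' * (G + M + n) := mul_le_mul_of_nonneg_left this (by linarith)
      _ ≤ _ := mul_le_mul_of_nonneg_right (le_max_right _ _) (by linarith)
  have t3 := mul_le_mul_of_nonneg_left t2 hd0
  have t4 : (D:ℝ) * n2 ≤ D * n := mul_le_mul_of_nonneg_left hn2 hD0
  have t5 : C2 * (n1 * s) ≤ C2 * (n * s) := mul_le_mul_of_nonneg_left (mul_le_mul_of_nonneg_right hn1 hB) hC2.le
  have t6 : (dd + 1) * max C1 C1' * (G + M + n) = dd * (max C1 C1' * (G + M + n)) + max C1 C1' * (G + M + n) := by ring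
  rw [t6]
  linarith


lemma KL_le (d D : ℕ) (hD : 1 ≤ D) : KL d D ≤ (3 * d ^ 3 + d ^ 5 * (1 + d)) * D := by
  unfold KL
  have h : d * (2 * d ^ 2 + d ^ 2 * (d ^ 2 * ((1 + d) * D) + 1)) = 3 * d ^ 3 * 1 + d ^ 5 * (1 + d) * D := by ring
  rw [h, add_mul]
  exact Nat.add_le_add (Nat.mul_le_mul_left _ hD) le_rfl

open Classical in
set_option maxHeartbeats 800000 in
lemma inc_X (d : ℕ) (ε : ℝ) (hε : 0 < ε) : ∃ C : ℝ, 0 < C ∧ ∀ (g : ℝ[X]) (hg : 2 ≤ g.natDegree) (hd : g.natDegree ≤ d)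
    (P : Finset Pt) (Γ : Finset Par) (hirr : ∀ θ ∈ Γ, Irreducible (HH g θ)) (X : ℝ) (hX : 1 ≤ X),
    (((Γ ×ˢ P).filter (fun x => On g x.1 x.2)).card : ℝ) ≤ C * (X ^ ((1/3 + ε) * (1/3)) * (P.card : ℝ) ^ (2/3 : ℝ) * (Γ.card : ℝ) ^ (2/3 : ℝ)
      + X ^ (1/3 + ε) * P.card + Γ.card + Γ.card * (Γ.card / X) ^ (1/2 + ε)) := by
  obtain ⟨C1, C2, C3, hC1, hC2, hC3, hinc⟩ := inc_level d ε hε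
  set c0 : ℕ := 3 * d ^ 3 + d ^ 5 * (1 + d) with hc0
  set K0 : ℝ := c0 * (C3 + 1) + 2 with hK0
  have hK02 : 2 ≤ K0 := by rw [hK0]; have : (0:ℝ) ≤ c0 * (C3 + 1) := by positivity
                           linarith
  set T : ℝ := K0 ^ (1/ε) with hT
  have hTε : T ^ ε = K0 := by
    rw [hT, ← Real.rpow_mul (by linarith), one_div, inv_mul_cancel₀ hε.ne', Real.rpow_one]
  have hT1 : 1 < T := Real.one_lt_rpow (by linarith) (by positivity)
  have hT0 : 0 < T := by linarith
  set D : ℕ := ⌈C3 * T ^ ((1:ℝ)/3)⌉₊ with hDdef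
  have hD : C3 * T ^ ((1:ℝ)/3) ≤ D := Nat.le_ceil _
  have hT3 : 1 ≤ T ^ ((1:ℝ)/3) := Real.one_le_rpow hT1.le (by norm_num)
  have hDpos : 1 ≤ D := by
    have : 0 < D := Nat.ceil_pos.2 (by positivity)
    exact this
  have hDle : (D:ℝ) ≤ (C3 + 1) * T ^ ((1:ℝ)/3) := by
    have := (Nat.ceil_lt_add_one (a := C3 * T ^ ((1:ℝ)/3)) (by positivity)).le
    rw [← hDdef] at this
    nlinarith
  have hq : ((KL d D : ℕ) : ℝ) ≤ T ^ (1/3 + ε) := by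
    have h1 : ((KL d D : ℕ) : ℝ) ≤ c0 * D := by exact_mod_cast KL_le d D hDpos
    have h2 : (c0:ℝ) * D ≤ c0 * ((C3 + 1) * T ^ ((1:ℝ)/3)) := mul_le_mul_of_nonneg_left hDle (by positivity)
    have h3 : T ^ (1/3 + ε) = K0 * T ^ ((1:ℝ)/3) := by
      rw [Real.rpow_add hT0, hTε]; ring
    rw [h3]
    have h4 : (c0:ℝ) * ((C3 + 1) * T ^ ((1:ℝ)/3)) ≤ K0 * T ^ ((1:ℝ)/3) := by
      rw [hK0, ← mul_assoc]
      exact mul_le_mul_of_nonneg_right (by linarith) (by linarith)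
    linarith
  set K : ℕ := KZ d D + 1 with hK
  have hK1 : (1:ℝ) ≤ K := by rw [hK]; push_cast; linarith [Nat.cast_nonneg (α := ℝ) (KZ d D)]
  refine ⟨(d ^ 2 + 1) * C1 * K + D + C2 * T ^ (1/2 + ε), by positivity, ?_⟩
  intro g hg hd P Γ hirr X hX
  obtain ⟨l, hl1, hl2⟩ := exists_nat_pow_near hX hT1
  have hX0 : 0 < X := by linarith
  have main := hinc T hT1.le D hD g hg hd P Γ hirr l (K * KL d D ^ l) le_rfl
  have hTl : 0 < T ^ l := by positivity
  have hμ : ((K * KL d D ^ l : ℕ) : ℝ) ≤ K * X ^ (1/3 + ε) := by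
    push_cast
    refine mul_le_mul_of_nonneg_left ?_ (by positivity)
    calc ((KL d D : ℕ) : ℝ) ^ l ≤ (T ^ (1/3 + ε)) ^ l := pow_le_pow_left₀ (by positivity) hq l
      _ = (T ^ l) ^ (1/3 + ε) := by
        rw [← Real.rpow_natCast, ← Real.rpow_natCast, ← Real.rpow_mul hT0.le, ← Real.rpow_mul hT0.le, mul_comm]
      _ ≤ X ^ (1/3 + ε) := Real.rpow_le_rpow hTl.le hl1 (by linarith)
  have hμ3 : ((K * KL d D ^ l : ℕ) : ℝ) ^ (1/3 : ℝ) ≤ K * X ^ ((1/3 + ε) * (1/3)) := by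
    calc ((K * KL d D ^ l : ℕ) : ℝ) ^ (1/3 : ℝ) ≤ (K * X ^ (1/3 + ε)) ^ (1/3 : ℝ) := Real.rpow_le_rpow (by positivity) hμ (by norm_num)
      _ = (K:ℝ) ^ (1/3 : ℝ) * X ^ ((1/3 + ε) * (1/3)) := by
        rw [Real.mul_rpow (by positivity) (by positivity), ← Real.rpow_mul hX0.le]
      _ ≤ _ := by
        refine mul_le_mul_of_nonneg_right ?_ (by positivity)
        calc (K:ℝ) ^ (1/3 : ℝ) ≤ (K:ℝ) ^ (1:ℝ) := Real.rpow_le_rpow_of_exponent_le hK1 (by norm_num)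
          _ = K := Real.rpow_one _
  have hs : ((Γ.card : ℝ) / T ^ l) ^ (1/2 + ε) ≤ T ^ (1/2 + ε) * (Γ.card / X) ^ (1/2 + ε) := by
    rw [← Real.mul_rpow hT0.le (by positivity)]
    refine Real.rpow_le_rpow (by positivity) ?_ (by linarith)
    rw [pow_succ] at hl2
    rw [div_le_iff₀ hTl, mul_comm T, mul_assoc, div_mul_eq_mul_div, le_div_iff₀ hX0]
    refine mul_le_mul_of_nonneg_left ?_ (by positivity)
    nlinarith
  have hA : (0:ℝ) ≤ (P.card : ℝ) ^ (2/3 : ℝ) * (Γ.card : ℝ) ^ (2/3 : ℝ) := by positivity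
  have hn0 : (0:ℝ) ≤ Γ.card := by positivity
  have hm0 : (0:ℝ) ≤ P.card := by positivity
  have hcc : (0:ℝ) ≤ (d ^ 2 + 1) * C1 := by positivity
  have hs2 : (0:ℝ) ≤ ((Γ.card:ℝ) / X) ^ (1/2 + ε) := by positivity
  have hX1 : (0:ℝ) ≤ X ^ ((1/3 + ε) * (1/3)) := by positivity
  have hX2 : (0:ℝ) ≤ X ^ (1/3 + ε) := by positivity
  have hT2 : (0:ℝ) ≤ T ^ (1/2 + ε) := by positivity
  refine main.trans ?_
  rw [mul_assoc (((K * KL d D ^ l : ℕ) : ℝ) ^ (1/3 : ℝ)), mul_assoc (X ^ ((1/3 + ε) * (1/3)))]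
  generalize (P.card : ℝ) ^ (2/3 : ℝ) * (Γ.card : ℝ) ^ (2/3 : ℝ) = A at *
  generalize ((K * KL d D ^ l : ℕ) : ℝ) ^ (1/3 : ℝ) = u3 at *
  generalize ((K * KL d D ^ l : ℕ) : ℝ) = u at *
  generalize ((Γ.card:ℝ) / X) ^ (1/2 + ε) = s at *
  generalize ((Γ.card:ℝ) / T ^ l) ^ (1/2 + ε) = s' at *
  generalize X ^ ((1/3 + ε) * (1/3)) = x3 at *
  generalize X ^ (1/3 + ε) = x at *
  generalize T ^ (1/2 + ε) = t at *
  generalize (Γ.card : ℝ) = n at *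
  generalize (P.card : ℝ) = m at *
  generalize ((d:ℝ) ^ 2 + 1) * C1 = c at *
  have hK0' : (0:ℝ) ≤ K := by linarith
  have hD0 : (0:ℝ) ≤ D := by positivity
  have t1 : u3 * A ≤ K * (x3 * A) := by rw [← mul_assoc]; exact mul_le_mul_of_nonneg_right hμ3 hA
  have t2 : u * m ≤ K * (x * m) := by rw [← mul_assoc]; exact mul_le_mul_of_nonneg_right hμ hm0
  have t3 : n ≤ K * n := by nlinarith
  have t4 : c * (u3 * A + u * m + n) ≤ c * (K * (x3 * A + x * m + n)) := by
    refine mul_le_mul_of_nonneg_left ?_ hcc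
    rw [mul_add, mul_add]; linarith
  have t5 : C2 * (n * s') ≤ C2 * (n * (t * s)) := mul_le_mul_of_nonneg_left (mul_le_mul_of_nonneg_left hs hn0) hC2.le
  have y1 : 0 ≤ x3 * A := mul_nonneg hX1 hA
  have y2 : 0 ≤ x * m := mul_nonneg hX2 hm0
  have y3 : 0 ≤ n * s := mul_nonneg hn0 hs2
  generalize x3 * A = a1 at *
  generalize x * m = a2 at *
  have e1 : C2 * (n * (t * s)) = C2 * t * (n * s) := by ring
  rw [e1] at t5
  generalize n * s = a3 at *
  have w1 : 0 ≤ c * K := mul_nonneg hcc hK0'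
  have w2 : 0 ≤ C2 * t := mul_nonneg hC2.le hT2
  have e2 : c * (K * (a1 + a2 + n)) = c * K * (a1 + a2 + n) := by ring
  rw [e2] at t4
  generalize c * K = k1 at *
  generalize C2 * t = k2 at *
  have z1 := mul_nonneg w1 y3
  have z2 := mul_nonneg hD0 y1
  have z3 := mul_nonneg hD0 y2
  have z4 := mul_nonneg hD0 y3
  have z5 := mul_nonneg w2 y1
  have z6 := mul_nonneg w2 y2
  have z7 := mul_nonneg w2 hn0
  nlinarith

open Classical in
lemma incidence (d : ℕ) (η : ℝ) (hη : 0 < η) : ∃ C : ℝ, 0 < C ∧ ∀ (g : ℝ[X]) (hg : 2 ≤ g.natDegree) (hd : g.natDegree ≤ d)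
    (P : Finset Pt) (Γ : Finset Par) (hirr : ∀ θ ∈ Γ, Irreducible (HH g θ)),
    (((Γ ×ˢ P).filter (fun x => On g x.1 x.2)).card : ℝ) ≤ C * ((P.card : ℝ) ^ (2/3 : ℝ) * (Γ.card : ℝ) ^ (2/3 : ℝ)
      + (P.card : ℝ) ^ (6/11 : ℝ) * (Γ.card : ℝ) ^ (9/11 + η) + P.card + Γ.card) := by
  obtain ⟨C, hC, hinc⟩ := inc_X d (η/2) (by linarith)
  refine ⟨4 * C, by linarith, ?_⟩
  intro g hg hd P Γ hirr
  rcases Nat.eq_zero_or_pos Γ.card with h0 | hn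
  · rw [Finset.card_eq_zero] at h0
    subst h0
    simp only [Finset.empty_product, Finset.filter_empty, Finset.card_empty, Nat.cast_zero]
    positivity
  rcases Nat.eq_zero_or_pos P.card with h0 | hm
  · rw [Finset.card_eq_zero] at h0
    subst h0
    simp only [Finset.product_empty, Finset.filter_empty, Finset.card_empty, Nat.cast_zero]
    positivity
  have hn1 : (1:ℝ) ≤ Γ.card := by exact_mod_cast hn
  have hm1 : (1:ℝ) ≤ P.card := by exact_mod_cast hm
  have hinc := hinc g hg hd P Γ hirr
  generalize (((Γ ×ˢ P).filter (fun x => On g x.1 x.2)).card : ℝ) = I at *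
  generalize (Γ.card : ℝ) = n at *
  generalize (P.card : ℝ) = m at *
  obtain ⟨a, rfl⟩ : ∃ a, n = Real.exp a := ⟨Real.log n, (Real.exp_log (by linarith)).symm⟩
  obtain ⟨b, rfl⟩ : ∃ b, m = Real.exp b := ⟨Real.log m, (Real.exp_log (by linarith)).symm⟩
  have ha : 0 ≤ a := Real.one_le_exp_iff.1 hn1
  have hb : 0 ≤ b := Real.one_le_exp_iff.1 hm1
  rcases le_total (4 * b) (5 * a) with hc | hc
  · have h := hinc (Real.exp (15/11 * a - 12/11 * b)) (Real.one_le_exp_iff.2 (by linarith))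
    rw [← Real.exp_sub] at h
    simp only [← Real.exp_mul, ← Real.exp_add] at h ⊢
    refine h.trans ?_
    rw [mul_comm 4 C, mul_assoc]
    refine mul_le_mul_of_nonneg_left ?_ hC.le
    have hab : 0 ≤ η * a := by positivity
    have hbb : 0 ≤ η * b := by positivity
    have g1 := Real.exp_le_exp.2 (show (15/11 * a - 12/11 * b) * ((1/3 + η/2) * (1/3)) + b * (2/3) + a * (2/3) ≤ b * (6/11) + a * (9/11 + η) by nlinarith)
    have g2 := Real.exp_le_exp.2 (show (15/11 * a - 12/11 * b) * (1/3 + η/2) + b ≤ b * (6/11) + a * (9/11 + η) by nlinarith)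
    have g3 := Real.exp_le_exp.2 (show a + (a - (15/11 * a - 12/11 * b)) * (1/2 + η/2) ≤ b * (6/11) + a * (9/11 + η) by nlinarith)
    have g4 := Real.exp_pos (b * (2/3) + a * (2/3))
    have g5 := Real.exp_pos a
    have g6 := Real.exp_pos b
    have g7 := Real.exp_pos (b * (6/11) + a * (9/11 + η))
    linarith
  · have h := hinc 1 le_rfl
    rw [div_one] at h
    simp only [Real.one_rpow, one_mul, ← Real.exp_mul, ← Real.exp_add] at h ⊢
    refine h.trans ?_
    rw [mul_comm 4 C, mul_assoc]
    refine mul_le_mul_of_nonneg_left ?_ hC.le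
    have hab : 0 ≤ η * a := by positivity
    have g3 := Real.exp_le_exp.2 (show a + a * (1/2 + η/2) ≤ b * (6/11) + a * (9/11 + η) by nlinarith)
    have g4 := Real.exp_pos (b * (2/3) + a * (2/3))
    have g5 := Real.exp_pos a
    have g6 := Real.exp_pos b
    have g7 := Real.exp_pos (b * (6/11) + a * (9/11 + η))
    linarith


lemma RedBiv_swap_neg (q : ℝ[X]) (c : ℝ) (hR : RedBiv (bivDiff q + MvPolynomial.C c)) :
    RedBiv (bivDiff q + MvPolynomial.C (-c)) := by
  obtain ⟨F1, F2, he, h1, h2⟩ := hR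
  let e : Fin 2 ≃ Fin 2 := Equiv.swap 0 1
  refine ⟨- MvPolynomial.rename e F1, MvPolynomial.rename e F2, ?_, ?_, ?_⟩
  · rw [neg_mul, ← map_mul, ← he]
    unfold bivDiff
    rw [map_add, map_sub, MvPolynomial.rename_C, ← Polynomial.aeval_algHom_apply, ← Polynomial.aeval_algHom_apply,
      MvPolynomial.rename_X, MvPolynomial.rename_X, map_neg]
    have e0 : e 0 = 1 := by simp [e]
    have e1 : e 1 = 0 := by simp [e]
    rw [e0, e1]
    ring
  · rw [MvPolynomial.totalDegree_neg, show MvPolynomial.rename e F1 = MvPolynomial.renameEquiv ℝ e F1 from rfl,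
      MvPolynomial.totalDegree_renameEquiv]
    exact h1
  · rw [show MvPolynomial.rename e F2 = MvPolynomial.renameEquiv ℝ e F2 from rfl,
      MvPolynomial.totalDegree_renameEquiv]
    exact h2

lemma Bad_symm (g h : ℝ[X]) (b1 b2 : ℝ) (hb : Bad g h b1 b2) : Bad g h b2 b1 := by
  rcases hb with hb | hb
  · left
    have := RedBiv_swap_neg _ _ hb
    rwa [neg_sub] at this
  · right
    have := RedBiv_swap_neg _ _ hb
    rwa [neg_sub] at this

lemma tClose_symm (X : Finset ℝ) (t x y : ℝ) (h : tClose X t x y) : tClose X t y x := by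
  unfold tClose at *
  rwa [abs_sub_comm]

lemma idx_injOn (X : Finset ℝ) : Set.InjOn (idx X) X := by
  intro x hx y hy hxy
  by_contra hne
  have key : ∀ x ∈ X, ∀ y ∈ X, x < y → idx X x < idx X y := by
    intro x hx y hy hlt
    unfold idx
    apply Finset.card_lt_card
    rw [Finset.ssubset_iff_of_subset]
    · refine ⟨y, Finset.mem_filter.2 ⟨hy, le_rfl⟩, ?_⟩
      intro hm
      exact absurd (Finset.mem_filter.1 hm).2 (not_le.2 hlt)
    · intro z hz
      rw [Finset.mem_filter] at hz ⊢
      exact ⟨hz.1, hz.2.trans hlt.le⟩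
  rcases lt_or_gt_of_ne hne with hlt | hlt
  · exact absurd hxy (key x hx y hy hlt).ne
  · exact absurd hxy (key y hy x hx hlt).ne'

open Classical in
lemma close_count (X : Finset ℝ) (t : ℝ) (ht : 1 ≤ t * X.card) (x : ℝ) :
    ((X.filter (fun y => tClose X t x y)).card : ℝ) ≤ 3 * t * X.card := by
  set N := ⌊t * (X.card : ℝ)⌋₊ with hN
  have hNle : (N : ℝ) ≤ t * X.card := Nat.floor_le (by linarith)
  have h1 : (X.filter (fun y => tClose X t x y)).card ≤ (Finset.Icc (idx X x - N) (idx X x + N)).card := by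
    apply Finset.card_le_card_of_injOn (idx X)
    · intro y hy
      have hy := (Finset.mem_filter.1 hy).2
      unfold tClose at hy
      have hy' : |((idx X x : ℤ) - (idx X y : ℤ))| ≤ (N : ℤ) := by
        have h2 : ((|((idx X x : ℤ) - (idx X y : ℤ))|).toNat : ℝ) ≤ t * X.card := by
          have : (((|((idx X x : ℤ) - (idx X y : ℤ))|).toNat : ℤ) : ℝ) ≤ t * X.card := by
            rw [Int.toNat_of_nonneg (abs_nonneg _)]
            push_cast
            exact hy
          exact_mod_cast this
        have h3 := Nat.le_floor h2
        omega
      rw [abs_le] at hy'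
      simp only [Finset.coe_Icc, Set.mem_Icc]
      omega
    · intro y hy z hz hyz
      exact idx_injOn X (Finset.mem_filter.1 hy).1 (Finset.mem_filter.1 hz).1 hyz
  have h2 : (X.filter (fun y => tClose X t x y)).card ≤ 2 * N + 1 := by
    refine h1.trans ?_
    rw [Nat.card_Icc]; omega
  have h3 : ((X.filter (fun y => tClose X t x y)).card : ℝ) ≤ 2 * N + 1 := by exact_mod_cast h2
  linarith

open Classical in
lemma close_pairs (X : Finset ℝ) (t : ℝ) (ht : 1 ≤ t * X.card) :
    (((X ×ˢ X).filter (fun q => tClose X t q.1 q.2)).card : ℝ) ≤ 3 * t * X.card ^ 2 := by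
  have : ((X ×ˢ X).filter (fun q => tClose X t q.1 q.2)).card = ∑ x ∈ X, (X.filter (fun y => tClose X t x y)).card := by
    simp only [Finset.card_filter, Finset.sum_product]
  rw [this]
  push_cast
  calc _ ≤ ∑ x ∈ X, 3 * t * (X.card : ℝ) := Finset.sum_le_sum (fun x _ => close_count X t ht x)
    _ = _ := by rw [Finset.sum_const, nsmul_eq_mul]; ring

lemma dyad_pow (u n M E : ℝ) (hu : 0 < u) (hn : 0 ≤ n) (h1 : u * n ≤ M) (h2 : u ^ 2 * n ≤ E) (α β : ℝ) (hα : 0 ≤ α) (hβ : 0 ≤ β)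
    (hab : α + 2 * β = 1) : u * n ^ (α + β) ≤ M ^ α * E ^ β := by
  have e : u * n ^ (α + β) = (u * n) ^ α * (u ^ 2 * n) ^ β := by
    rw [Real.mul_rpow hu.le hn, Real.mul_rpow (by positivity) hn, Real.rpow_add' hn (by linarith),
      ← Real.rpow_natCast u 2, ← Real.rpow_mul hu.le]
    have : u = u ^ α * u ^ (((2:ℕ):ℝ) * β) := by
      rw [← Real.rpow_add hu]; push_cast; rw [hab, Real.rpow_one]
    nth_rewrite 1 [this]
    ring
  rw [e]
  have hun : 0 ≤ u * n := by positivity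
  have hun2 : 0 ≤ u ^ 2 * n := by positivity
  exact mul_le_mul (Real.rpow_le_rpow hun h1 hα) (Real.rpow_le_rpow hun2 h2 hβ) (by positivity)
    (Real.rpow_nonneg (hun.trans h1) _)

open Classical in
set_option maxHeartbeats 800000 in
lemma weighted_inc {κ : Type*} (d : ℕ) (η : ℝ) (hη : 0 < η) : ∃ C : ℝ, 0 < C ∧ ∀ (g : ℝ[X]) (hg : 2 ≤ g.natDegree) (hd : g.natDegree ≤ d)
    (P : Finset Pt) (Q : Finset κ) (φ : κ → Par) (hirr : ∀ q ∈ Q, Irreducible (HH g (φ q))) (W : ℕ) (hW0 : 0 < W)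
    (hW : ∀ q ∈ Q, (Q.filter (fun q' => φ q' = φ q)).card ≤ W),
    (((Q ×ˢ P).filter (fun x => On g (φ x.1) x.2)).card : ℝ) ≤ C * (
      (Nat.log 2 W + 1 : ℝ) * ((P.card : ℝ) ^ (2/3 : ℝ) * ((Q.card : ℝ) ^ (1/3 : ℝ) * (((Q ×ˢ Q).filter (fun x => φ x.1 = φ x.2)).card : ℝ) ^ (1/3 : ℝ))
        + (P.card : ℝ) ^ (6/11 : ℝ) * ((Q.card : ℝ) ^ (7/11 : ℝ) * (((Q ×ˢ Q).filter (fun x => φ x.1 = φ x.2)).card : ℝ) ^ (2/11 : ℝ)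
            * (Q.card : ℝ) ^ η)) + W * P.card + Q.card) := by
  obtain ⟨C, hC, hinc⟩ := incidence d η hη
  refine ⟨4 * C, by linarith, ?_⟩
  intro g hg hd P Q φ hirr W hW0 hW
  let w : Par → ℕ := fun θ => (Q.filter (fun q => φ q = θ)).card
  let inc : Par → ℕ := fun θ => (P.filter (fun p => On g θ p)).card
  let T := Q.image φ
  let J := Nat.log 2 W
  let Γ : ℕ → Finset Par := fun j => T.filter (fun θ => Nat.log 2 (w θ) = j)
  set E := ((Q ×ˢ Q).filter (fun x => φ x.1 = φ x.2)).card with hE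
  have hmaps : ∀ q ∈ Q, φ q ∈ T := fun q hq => Finset.mem_image_of_mem _ hq
  have hwpos : ∀ θ ∈ T, w θ ≠ 0 := by
    intro θ hθ
    obtain ⟨q, hq, rfl⟩ := Finset.mem_image.1 hθ
    exact Finset.card_ne_zero.2 ⟨q, Finset.mem_filter.2 ⟨hq, rfl⟩⟩
  have hwW : ∀ θ ∈ T, w θ ≤ W := by
    intro θ hθ
    obtain ⟨q, hq, rfl⟩ := Finset.mem_image.1 hθ
    exact hW q hq
  have hQsum : Q.card = ∑ θ ∈ T, w θ := Finset.card_eq_sum_card_fiberwise hmaps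
  have hsum1 : ∀ F : Par → ℕ, ∑ q ∈ Q, F (φ q) = ∑ θ ∈ T, w θ * F θ := by
    intro F
    rw [← Finset.sum_fiberwise_of_maps_to hmaps]
    refine Finset.sum_congr rfl (fun θ _ => ?_)
    rw [Finset.sum_congr rfl (g := fun _ => F θ) (fun q hq => by rw [(Finset.mem_filter.1 hq).2]), Finset.sum_const, smul_eq_mul]
  have hEsum : E = ∑ θ ∈ T, w θ * w θ := by
    rw [← hsum1 w, hE]
    simp only [Finset.card_filter, Finset.sum_product, w]
    refine Finset.sum_congr rfl (fun q _ => Finset.sum_congr rfl (fun q' _ => ?_))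
    simp only [eq_comm]
  have hIsum : ((Q ×ˢ P).filter (fun x => On g (φ x.1) x.2)).card = ∑ θ ∈ T, w θ * inc θ := by
    rw [← hsum1 inc]
    simp only [Finset.card_filter, Finset.sum_product, inc]
  have hlog : ∀ θ ∈ T, Nat.log 2 (w θ) ∈ Finset.range (J + 1) := by
    intro θ hθ
    rw [Finset.mem_range, Nat.lt_succ_iff]
    exact Nat.log_mono_right (hwW θ hθ)
  have hsplit : ∀ F : Par → ℕ, ∑ θ ∈ T, F θ = ∑ j ∈ Finset.range (J + 1), ∑ θ ∈ Γ j, F θ := by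
    intro F
    exact (Finset.sum_fiberwise_of_maps_to hlog F).symm
  have hlow : ∀ j, ∀ θ ∈ Γ j, 2 ^ j ≤ w θ := by
    intro j θ hθ
    have := Finset.mem_filter.1 hθ
    rw [← this.2]
    exact Nat.pow_log_le_self 2 (hwpos θ this.1)
  have hup : ∀ j, ∀ θ ∈ Γ j, w θ ≤ 2 ^ (j + 1) := by
    intro j θ hθ
    have := Finset.mem_filter.1 hθ
    rw [← this.2]
    exact (Nat.lt_pow_succ_log_self (by norm_num) _).le
  have hsumn : ∑ j ∈ Finset.range (J + 1), 2 ^ j * (Γ j).card ≤ Q.card := by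
    rw [hQsum, hsplit w]
    refine Finset.sum_le_sum (fun j _ => ?_)
    rw [mul_comm, ← smul_eq_mul, ← Finset.sum_const]
    exact Finset.sum_le_sum (hlow j)
  have hM : ∀ j ∈ Finset.range (J + 1), 2 ^ j * (Γ j).card ≤ Q.card := by
    intro j hj
    exact (Finset.single_le_sum (f := fun j => 2 ^ j * (Γ j).card) (fun _ _ => Nat.zero_le _) hj).trans hsumn
  have hE2 : ∀ j ∈ Finset.range (J + 1), (2 ^ j) ^ 2 * (Γ j).card ≤ E := by
    intro j hj
    calc (2 ^ j) ^ 2 * (Γ j).card = ∑ θ ∈ Γ j, (2 ^ j) ^ 2 := by rw [Finset.sum_const, smul_eq_mul, mul_comm]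
      _ ≤ ∑ θ ∈ Γ j, w θ * w θ := by
        refine Finset.sum_le_sum (fun θ hθ => ?_)
        rw [pow_two]
        exact Nat.mul_le_mul (hlow j θ hθ) (hlow j θ hθ)
      _ ≤ E := by rw [hEsum]; exact Finset.sum_le_sum_of_subset (Finset.filter_subset _ _)
  have hIle : ((Q ×ˢ P).filter (fun x => On g (φ x.1) x.2)).card ≤
      ∑ j ∈ Finset.range (J + 1), 2 ^ (j + 1) * ((Γ j ×ˢ P).filter (fun x => On g x.1 x.2)).card := by
    rw [hIsum, hsplit]
    refine Finset.sum_le_sum (fun j _ => ?_)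
    have : ((Γ j ×ˢ P).filter (fun x => On g x.1 x.2)).card = ∑ θ ∈ Γ j, inc θ := by
      simp only [Finset.card_filter, Finset.sum_product, inc]
    rw [this, Finset.mul_sum]
    exact Finset.sum_le_sum (fun θ hθ => Nat.mul_le_mul_right _ (hup j θ hθ))
  have hirr' : ∀ j, ∀ θ ∈ Γ j, Irreducible (HH g θ) := by
    intro j θ hθ
    obtain ⟨q, hq, rfl⟩ := Finset.mem_image.1 (Finset.mem_filter.1 hθ).1
    exact hirr q hq
  have hgeo : ∑ j ∈ Finset.range (J + 1), 2 ^ j ≤ 2 * W := by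
    have h1 : ∑ j ∈ Finset.range (J + 1), 2 ^ j < 2 ^ (J + 1) := by
      have := Nat.geomSum_eq (m := 2) le_rfl (J + 1)
      have h2 : 0 < 2 ^ (J + 1) := by positivity
      omega
    have h2 : 2 ^ J ≤ W := Nat.pow_log_le_self 2 hW0.ne'
    rw [pow_succ] at h1
    omega
  set m : ℝ := (P.card : ℝ) with hm
  set M : ℝ := (Q.card : ℝ) with hMdef
  set X : ℝ := m ^ (2/3 : ℝ) * (M ^ (1/3 : ℝ) * (E : ℝ) ^ (1/3 : ℝ)) with hX
  set Y : ℝ := m ^ (6/11 : ℝ) * (M ^ (7/11 : ℝ) * (E : ℝ) ^ (2/11 : ℝ) * M ^ η) with hY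
  have hm0 : 0 ≤ m := by positivity
  have hX0 : 0 ≤ X := by positivity
  have hY0 : 0 ≤ Y := by positivity
  have hterm : ∀ j ∈ Finset.range (J + 1), ((2 ^ (j + 1) * ((Γ j ×ˢ P).filter (fun x => On g x.1 x.2)).card : ℕ) : ℝ) ≤
      2 * C * (X + Y + (2 ^ j : ℕ) * m + (2 ^ j * (Γ j).card : ℕ)) := by
    intro j hj
    have h := hinc g hg hd P (Γ j) (hirr' j)
    have a1 : (2:ℝ) ^ j * (Γ j).card ≤ M := by have := hM j hj; rw [hMdef]; exact_mod_cast this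
    have a2 : ((2:ℝ) ^ j) ^ 2 * (Γ j).card ≤ E := by have := hE2 j hj; exact_mod_cast this
    push_cast
    generalize (((Γ j ×ˢ P).filter (fun x => On g x.1 x.2)).card : ℝ) = I at *
    have hn0 : (0:ℝ) ≤ (Γ j).card := by positivity
    have hnM : ((Γ j).card : ℝ) ≤ M := by
      have : (1:ℝ) ≤ 2 ^ j := one_le_pow₀ (by norm_num)
      nlinarith
    have hu : (0:ℝ) < 2 ^ j := by positivity
    rw [pow_succ]
    generalize ((2:ℝ) ^ j) = u at *
    generalize ((Γ j).card : ℝ) = n at *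
    have b1 := dyad_pow u n M E hu hn0 a1 a2 (1/3) (1/3) (by norm_num) (by norm_num) (by norm_num)
    have b2 := dyad_pow u n M E hu hn0 a1 a2 (7/11) (2/11) (by norm_num) (by norm_num) (by norm_num)
    rw [show (1/3 + 1/3 : ℝ) = 2/3 by norm_num] at b1
    rw [show (7/11 + 2/11 : ℝ) = 9/11 by norm_num] at b2
    have b3 : n ^ (9/11 + η) = n ^ (9/11 : ℝ) * n ^ η := Real.rpow_add' hn0 (by positivity)
    have b4 : n ^ η ≤ M ^ η := Real.rpow_le_rpow hn0 hnM hη.le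
    have c1 : u * (m ^ (2/3 : ℝ) * n ^ (2/3 : ℝ)) ≤ X := by
      rw [hX]
      calc _ = m ^ (2/3 : ℝ) * (u * n ^ (2/3 : ℝ)) := by ring
        _ ≤ _ := mul_le_mul_of_nonneg_left b1 (by positivity)
    have c2 : u * (m ^ (6/11 : ℝ) * n ^ (9/11 + η)) ≤ Y := by
      rw [hY, b3]
      calc _ = m ^ (6/11 : ℝ) * ((u * n ^ (9/11 : ℝ)) * n ^ η) := by ring
        _ ≤ _ := mul_le_mul_of_nonneg_left (mul_le_mul b2 b4 (Real.rpow_nonneg hn0 _) (by positivity)) (by positivity)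
    calc u * 2 * I ≤ u * 2 * _ := mul_le_mul_of_nonneg_left h (by positivity)
      _ = 2 * C * (u * (m ^ (2/3 : ℝ) * n ^ (2/3 : ℝ)) + u * (m ^ (6/11 : ℝ) * n ^ (9/11 + η)) + u * m + u * n) := by ring
      _ ≤ _ := mul_le_mul_of_nonneg_left (by linarith) (by linarith)
  have hI : (((Q ×ˢ P).filter (fun x => On g (φ x.1) x.2)).card : ℝ) ≤
      ∑ j ∈ Finset.range (J + 1), 2 * C * (X + Y + (2 ^ j : ℕ) * m + (2 ^ j * (Γ j).card : ℕ)) := by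
    refine le_trans ?_ (Finset.sum_le_sum hterm)
    exact_mod_cast hIle
  refine hI.trans ?_
  rw [← Finset.mul_sum, Finset.sum_add_distrib, Finset.sum_add_distrib, Finset.sum_const, Finset.card_range, nsmul_eq_mul,
    ← Finset.sum_mul]
  have s1 : ∑ j ∈ Finset.range (J + 1), ((2 ^ j : ℕ) : ℝ) ≤ 2 * W := by exact_mod_cast hgeo
  have s2 : ∑ j ∈ Finset.range (J + 1), ((2 ^ j * (Γ j).card : ℕ) : ℝ) ≤ M := by
    rw [hMdef]; exact_mod_cast hsumn
  have s3 := mul_le_mul_of_nonneg_right s1 hm0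
  have s4 : 0 ≤ (J + 1 : ℝ) * (X + Y) := by positivity
  have s5 : 0 ≤ M := by positivity
  push_cast at *
  rw [show 4 * C * ((J + 1 : ℝ) * (X + Y) + W * m + M) = 2 * C * (2 * ((J + 1 : ℝ) * (X + Y) + W * m + M)) by ring]
  refine mul_le_mul_of_nonneg_left ?_ (by linarith)
  linarith


lemma log_bound (η : ℝ) (hη : 0 < η) (d b : ℕ) (hd : 1 ≤ d) (hb : 1 ≤ b) :
    (Nat.log 2 (d * b) + 1 : ℝ) ≤ (1 / (η * Real.log 2) + 1) * (d : ℝ) ^ η * (b : ℝ) ^ η := by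
  have hW : 1 ≤ d * b := Nat.mul_pos hd hb
  have h1 : ((2:ℝ)) ^ (Nat.log 2 (d * b)) ≤ ((d * b : ℕ) : ℝ) := by
    exact_mod_cast Nat.pow_log_le_self 2 (by omega)
  have hW' : (1:ℝ) ≤ ((d * b : ℕ) : ℝ) := by exact_mod_cast hW
  have hl2 : 0 < Real.log 2 := Real.log_pos (by norm_num)
  have h2 := Real.log_le_log (by positivity) h1
  rw [Real.log_pow] at h2
  have h3 := Real.log_le_rpow_div (x := ((d * b : ℕ) : ℝ)) (by linarith) hη
  have h4 : (1:ℝ) ≤ ((d * b : ℕ) : ℝ) ^ η := Real.one_le_rpow hW' hη.le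
  have e : (1 / (η * Real.log 2) + 1) * (d : ℝ) ^ η * (b : ℝ) ^ η = (1 / (η * Real.log 2) + 1) * ((d * b : ℕ) : ℝ) ^ η := by
    rw [Nat.cast_mul, Real.mul_rpow (by positivity) (by positivity)]; ring
  rw [e]
  generalize ((d * b : ℕ) : ℝ) ^ η = z at *
  have h5 : (Nat.log 2 (d * b) : ℝ) ≤ 1 / (η * Real.log 2) * z := by
    rw [one_div, ← div_eq_inv_mul, le_div_iff₀ (by positivity)]
    have h6 := h2.trans h3
    rw [le_div_iff₀ hη] at h6
    linarith
  linarith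

lemma numX (t a b s S m M E : ℝ) (ht : 0 < t) (ha : 1 ≤ a) (hb : 1 ≤ b) (hs : 1 ≤ s) (hS : 0 ≤ S)
    (hm0 : 0 ≤ m) (hM0 : 0 ≤ M) (hE0 : 0 ≤ E)
    (hm : m ≤ 3 * t * s ^ 2) (hM : M ≤ 9 * (t ^ 2 * a ^ 2 * b ^ 2)) (hE : E ≤ 3 * t * a ^ 2 * S) :
    m ^ (2/3 : ℝ) * (M ^ (1/3 : ℝ) * E ^ (1/3 : ℝ)) ≤ 9 * (t ^ ((5:ℝ)/3) * a ^ ((4:ℝ)/3) * b ^ ((2:ℝ)/3) * s ^ ((4:ℝ)/3) * S ^ ((1:ℝ)/3)) := by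
  have h1 : m ^ (2/3 : ℝ) * (M ^ (1/3 : ℝ) * E ^ (1/3 : ℝ)) ≤
      (3 * t * s ^ 2) ^ (2/3 : ℝ) * ((9 * (t ^ 2 * a ^ 2 * b ^ 2)) ^ (1/3 : ℝ) * (3 * t * a ^ 2 * S) ^ (1/3 : ℝ)) := by
    gcongr
  refine h1.trans ?_
  rw [Real.mul_rpow (x := 3 * t * a ^ 2) (by positivity) hS]
  have hSp : 0 ≤ S ^ (1/3 : ℝ) := by positivity
  generalize S ^ (1/3 : ℝ) = S' at *
  obtain ⟨τ, rfl⟩ : ∃ x, t = Real.exp x := ⟨Real.log t, (Real.exp_log (by linarith)).symm⟩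
  obtain ⟨a, rfl⟩ : ∃ x, a = Real.exp x := ⟨Real.log a, (Real.exp_log (by linarith)).symm⟩
  obtain ⟨b, rfl⟩ : ∃ x, b = Real.exp x := ⟨Real.log b, (Real.exp_log (by linarith)).symm⟩
  obtain ⟨s, rfl⟩ : ∃ x, s = Real.exp x := ⟨Real.log s, (Real.exp_log (by linarith)).symm⟩
  obtain ⟨k, hk⟩ : ∃ x, (3:ℝ) = Real.exp x := ⟨Real.log 3, (Real.exp_log (by norm_num)).symm⟩
  have hk0 : 0 ≤ k := by
    rw [← Real.one_le_exp_iff, ← hk]; norm_num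
  have h9 : (9:ℝ) = Real.exp (2 * k) := by
    rw [two_mul, Real.exp_add, ← hk]; norm_num
  rw [show ∀ x y z : ℝ, x * (y * (z * S')) = (x * (y * z)) * S' by intros; ring, ← mul_assoc 9 _ S']
  refine mul_le_mul_of_nonneg_right ?_ hSp
  rw [h9]
  have e3 : ∀ y : ℝ, (3 : ℝ) * y = Real.exp k * y := fun y => by rw [← hk]
  simp only [e3]
  simp only [← Real.exp_nat_mul, ← Real.exp_mul, ← Real.exp_add]
  apply Real.exp_le_exp.2
  push_cast
  linarith

lemma numY (η : ℝ) (hη : 0 < η) (t a b s S m M E : ℝ) (ht : 0 < t) (ht1 : t ≤ 1) (ha : 1 ≤ a) (hb : 1 ≤ b) (hs : 1 ≤ s) (hS : 0 ≤ S)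
    (hm0 : 0 ≤ m) (hM0 : 0 ≤ M) (hE0 : 0 ≤ E)
    (hm : m ≤ 3 * t * s ^ 2) (hM : M ≤ 9 * (t ^ 2 * a ^ 2 * b ^ 2)) (hE : E ≤ 3 * t * a ^ 2 * S) :
    m ^ (6/11 : ℝ) * (M ^ (7/11 : ℝ) * E ^ (2/11 : ℝ) * M ^ η) ≤ (9:ℝ) ^ (1 + η) *
      (t ^ 2 * a ^ ((18:ℝ)/11 + 2 * η) * b ^ ((14:ℝ)/11 + 2 * η) * s ^ ((12:ℝ)/11) * S ^ ((2:ℝ)/11)) := by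
  have hM2 : M ≤ 9 * (a ^ 2 * b ^ 2) := by
    refine hM.trans ?_
    have : t ^ 2 ≤ 1 := pow_le_one₀ ht.le ht1
    have h2 : 0 ≤ a ^ 2 * b ^ 2 := by positivity
    nlinarith
  have h1 : m ^ (6/11 : ℝ) * (M ^ (7/11 : ℝ) * E ^ (2/11 : ℝ) * M ^ η) ≤
      (3 * t * s ^ 2) ^ (6/11 : ℝ) * ((9 * (t ^ 2 * a ^ 2 * b ^ 2)) ^ (7/11 : ℝ) * (3 * t * a ^ 2 * S) ^ (2/11 : ℝ) * (9 * (a ^ 2 * b ^ 2)) ^ η) := by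
    gcongr
  refine h1.trans ?_
  rw [Real.mul_rpow (x := 3 * t * a ^ 2) (by positivity) hS]
  have hSp : 0 ≤ S ^ (2/11 : ℝ) := by positivity
  generalize S ^ (2/11 : ℝ) = S' at *
  obtain ⟨τ, rfl⟩ : ∃ x, t = Real.exp x := ⟨Real.log t, (Real.exp_log (by linarith)).symm⟩
  obtain ⟨a, rfl⟩ : ∃ x, a = Real.exp x := ⟨Real.log a, (Real.exp_log (by linarith)).symm⟩
  obtain ⟨b, rfl⟩ : ∃ x, b = Real.exp x := ⟨Real.log b, (Real.exp_log (by linarith)).symm⟩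
  obtain ⟨s, rfl⟩ : ∃ x, s = Real.exp x := ⟨Real.log s, (Real.exp_log (by linarith)).symm⟩
  obtain ⟨k, hk⟩ : ∃ x, (3:ℝ) = Real.exp x := ⟨Real.log 3, (Real.exp_log (by norm_num)).symm⟩
  have h9 : (9:ℝ) = Real.exp (2 * k) := by
    rw [two_mul, Real.exp_add, ← hk]; norm_num
  have e3 : ∀ y : ℝ, (3 : ℝ) * y = Real.exp k * y := fun y => by rw [← hk]
  rw [h9]
  simp only [e3]
  rw [show ∀ x y z w : ℝ, x * (y * (z * S') * w) = (x * (y * z * w)) * S' by intros; ring, ← mul_assoc (Real.exp (2 * k) ^ (1 + η)) _ S']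
  refine mul_le_mul_of_nonneg_right ?_ hSp
  simp only [← Real.exp_nat_mul, ← Real.exp_mul, ← Real.exp_add]
  apply Real.exp_le_exp.2
  push_cast
  apply le_of_eq
  ring

theorem Stset_finite (g h : ℝ[X]) (B : Finset ℝ) (t : ℝ) : (Stset g h B t).Finite := by
  apply Set.Finite.subset (B ×ˢ B ×ˢ B ×ˢ B).finite_toSet
  rintro s ⟨b1, b2, c1, c2, rfl, h1, h2, h3, h4, _⟩
  simp only [Finset.coe_product, Set.mem_prod, Finset.mem_coe]
  exact ⟨h1, h2, h3, h4⟩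

noncomputable def phiQ (p h : ℝ[X]) (q : (ℝ × ℝ) × (ℝ × ℝ)) : Par :=
  (q.1.1 - p.eval q.2.1, q.1.2 - p.eval q.2.2, h.eval q.2.1 - h.eval q.2.2)

open Classical in
noncomputable def QA (A : Finset ℝ) (t : ℝ) : Finset (ℝ × ℝ) := (A ×ˢ A).filter (fun q => tClose A t q.1 q.2)

open Classical in
noncomputable def QB (g h : ℝ[X]) (B : Finset ℝ) (t : ℝ) : Finset (ℝ × ℝ) := (QA B t).filter (fun q => ¬ Bad g h q.1 q.2)

open Classical in
lemma energy_le (g p h : ℝ[X]) (A B : Finset ℝ) (t : ℝ) :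
    (((QA A t ×ˢ QB g h B t) ×ˢ (QA A t ×ˢ QB g h B t)).filter (fun x => phiQ p h x.1 = phiQ p h x.2)).card ≤
      (QA A t).card * (Stset g h B t).ncard := by
  rw [Set.ncard_eq_toFinset_card _ (Stset_finite g h B t), ← Finset.card_product]
  apply Finset.card_le_card_of_injOn (fun x => (x.1.1, (x.1.2.1, x.1.2.2, x.2.2.2, x.2.2.1)))
  · rintro ⟨⟨⟨a1, a2⟩, ⟨b1, b2⟩⟩, ⟨⟨a3, a4⟩, ⟨c1, c2⟩⟩⟩ hx
    have hx := Finset.mem_filter.1 hx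
    obtain ⟨hx1, hx2⟩ := hx
    have hx3 := Finset.mem_product.1 hx1
    have hx4 := Finset.mem_product.1 hx3.1
    have hx5 := Finset.mem_product.1 hx3.2
    have hb := Finset.mem_filter.1 hx4.2
    have hc := Finset.mem_filter.1 hx5.2
    have hb1 := Finset.mem_filter.1 hb.1
    have hc1 := Finset.mem_filter.1 hc.1
    have hb2 := Finset.mem_product.1 hb1.1
    have hc2 := Finset.mem_product.1 hc1.1
    apply Finset.mem_coe.2
    refine Finset.mem_product.2 ⟨hx4.1, ?_⟩
    rw [Set.Finite.mem_toFinset]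
    refine ⟨b1, b2, c2, c1, rfl, hb2.1, hb2.2, hc2.2, hc2.1, ?_, hb1.2, tClose_symm _ _ _ _ hc1.2, hb.2, fun hh => hc.2 (Bad_symm _ _ _ _ hh)⟩
    simp only [phiQ, Prod.mk.injEq] at hx2
    linarith [hx2.2.2]
  · rintro ⟨⟨⟨a1, a2⟩, ⟨b1, b2⟩⟩, ⟨⟨a3, a4⟩, ⟨c1, c2⟩⟩⟩ hx ⟨⟨⟨a1', a2'⟩, ⟨b1', b2'⟩⟩, ⟨⟨a3', a4'⟩, ⟨c1', c2'⟩⟩⟩ hy hxy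
    have hx := (Finset.mem_filter.1 hx).2
    have hy := (Finset.mem_filter.1 hy).2
    simp only [phiQ, Prod.mk.injEq] at hx hy hxy
    obtain ⟨⟨rfl, rfl⟩, rfl, rfl, rfl, rfl⟩ := hxy
    have e1 : a3 = a3' := by linarith [hx.1, hy.1]
    have e2 : a4 = a4' := by linarith [hx.2.1, hy.2.1]
    rw [e1, e2]

open Classical in
lemma fiber_le (g p h : ℝ[X]) (d : ℕ) (hd : h.natDegree ≤ d) (hh : 1 ≤ h.natDegree) (A B : Finset ℝ) (t : ℝ) (q : (ℝ × ℝ) × (ℝ × ℝ)) :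
    ((QA A t ×ˢ QB g h B t).filter (fun q' => phiQ p h q' = phiQ p h q)).card ≤ d * B.card := by
  apply Finset.card_le_mul_card_image_of_maps_to (f := fun q => q.2.1)
  · rintro ⟨⟨a1, a2⟩, ⟨b1, b2⟩⟩ hx
    have hx := (Finset.mem_product.1 (Finset.mem_filter.1 hx).1).2
    exact (Finset.mem_product.1 (Finset.mem_filter.1 (Finset.mem_filter.1 hx).1).1).1
  · intro b hb
    set c := h.eval b - (phiQ p h q).2.2 with hc
    have hne : h - C c ≠ 0 := by
      intro h0
      have : h = C c := sub_eq_zero.1 h0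
      rw [this, natDegree_C] at hh
      omega
    calc _ ≤ (h - C c).roots.toFinset.card := by
          apply Finset.card_le_card_of_injOn (fun q => q.2.2)
          · rintro ⟨⟨a1, a2⟩, ⟨b1, b2⟩⟩ hx
            have hx := Finset.mem_filter.1 hx
            have hx1 := (Finset.mem_filter.1 hx.1).2
            have hx2 : b1 = b := hx.2
            subst hx2
            apply Finset.mem_coe.2
            rw [Multiset.mem_toFinset, mem_roots hne, IsRoot, eval_sub, eval_C, hc, ← hx1]
            simp [phiQ]
          · rintro ⟨⟨a1, a2⟩, ⟨b1, b2⟩⟩ hx ⟨⟨a1', a2'⟩, ⟨b1', b2'⟩⟩ hy hxy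
            have hx := Finset.mem_filter.1 hx
            have hx1 := (Finset.mem_filter.1 hx.1).2
            have hx2 : b1 = b := hx.2
            have hy := Finset.mem_filter.1 hy
            have hy1 := (Finset.mem_filter.1 hy.1).2
            have hy2 : b1' = b := hy.2
            have hxy : b2 = b2' := hxy
            subst hx2; subst hy2; subst hxy
            rw [← hy1] at hx1
            simp only [phiQ, Prod.mk.injEq] at hx1
            have e1 : a1 = a1' := by linarith [hx1.1]
            have e2 : a2 = a2' := by linarith [hx1.2.1]
            rw [e1, e2]
      _ ≤ (h - C c).roots.card := Multiset.toFinset_card_le _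
      _ ≤ (h - C c).natDegree := card_roots' _
      _ = h.natDegree := natDegree_sub_C
      _ ≤ d := hd

open Classical in
lemma Rt_le (g p h : ℝ[X]) (A B : Finset ℝ) (t : ℝ) :
    (Rtset g p h A B t).ncard ≤ (((QA A t ×ˢ QB g h B t) ×ˢ QA (A + A) t).filter (fun x => On g (phiQ p h x.1) x.2)).card := by
  set F := ((QA A t ×ˢ QB g h B t) ×ˢ QA (A + A) t).filter (fun x => On g (phiQ p h x.1) x.2) with hF
  let ψ : ((ℝ × ℝ) × (ℝ × ℝ)) × (ℝ × ℝ) → ℝ × ℝ × ℝ × ℝ × ℝ × ℝ := fun x => (x.2.1, x.2.2, x.1.1.1, x.1.1.2, x.1.2.1, x.1.2.2)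
  have hsub : Rtset g p h A B t ⊆ ((F.image ψ : Finset _) : Set (ℝ × ℝ × ℝ × ℝ × ℝ × ℝ)) := by
    rintro r ⟨α1, α2, a1, a2, b1, b2, rfl, h1, h2, h3, h4, h5, h6, heq, c1, c2, c3, hb⟩
    apply Finset.mem_coe.2
    refine Finset.mem_image.2 ⟨(((a1, a2), (b1, b2)), (α1, α2)), ?_, rfl⟩
    refine Finset.mem_filter.2 ⟨Finset.mem_product.2 ⟨Finset.mem_product.2 ⟨?_, ?_⟩, ?_⟩, ?_⟩
    · exact Finset.mem_filter.2 ⟨Finset.mem_product.2 ⟨h3, h4⟩, c2⟩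
    · exact Finset.mem_filter.2 ⟨Finset.mem_filter.2 ⟨Finset.mem_product.2 ⟨h5, h6⟩, c3⟩, hb⟩
    · exact Finset.mem_filter.2 ⟨Finset.mem_product.2 ⟨h1, h2⟩, c1⟩
    · unfold On
      rw [pa_eval, pb_eval]
      simp only [phiQ]
      unfold fval at heq
      rw [show α1 - (a1 - p.eval b1) = α1 - a1 + p.eval b1 by ring, show α2 - (a2 - p.eval b2) = α2 - a2 + p.eval b2 by ring]
      linarith
  calc _ ≤ ((F.image ψ : Finset _) : Set (ℝ × ℝ × ℝ × ℝ × ℝ × ℝ)).ncard := Set.ncard_le_ncard hsub (Finset.finite_toSet _)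
    _ = (F.image ψ).card := Set.ncard_coe_finset _
    _ ≤ _ := Finset.card_image_le

set_option maxHeartbeats 1000000

theorem stmt9 (d : ℕ) (η : ℝ) (hη : 0 < η) :
    ∃ C : ℝ, 0 < C ∧
      ∀ g p h : Polynomial ℝ,
        g.natDegree ≤ d → p.natDegree ≤ d → h.natDegree ≤ d →
        2 ≤ g.natDegree → 1 ≤ h.natDegree →
        ∀ (A B : Finset ℝ) (t : ℝ), 0 < t → t ≤ 1 →
          1 ≤ t * (A.card : ℝ) → 1 ≤ t * (B.card : ℝ) →
          ((Rtset g p h A B t).ncard : ℝ) ≤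
            C * (t ^ 2 * (A.card : ℝ) ^ ((18:ℝ)/11 + 2*η) * (B.card : ℝ) ^ ((14:ℝ)/11 + 3*η)
                  * ((A + A).card : ℝ) ^ ((12:ℝ)/11) * ((Stset g h B t).ncard : ℝ) ^ ((2:ℝ)/11)
              + t ^ ((5:ℝ)/3) * (A.card : ℝ) ^ ((4:ℝ)/3) * (B.card : ℝ) ^ ((2:ℝ)/3 + η)
                  * ((A + A).card : ℝ) ^ ((4:ℝ)/3) * ((Stset g h B t).ncard : ℝ) ^ ((1:ℝ)/3)
              + t * ((A + A).card : ℝ) ^ 2 * (B.card : ℝ)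
              + t ^ 2 * (A.card : ℝ) ^ 2 * (B.card : ℝ) ^ 2) := by
  classical
  obtain ⟨C, hC, hw⟩ := weighted_inc (κ := (ℝ × ℝ) × (ℝ × ℝ)) d η hη
  set K1 : ℝ := (1 / (η * Real.log 2) + 1) * (d : ℝ) ^ η with hK1
  have hl2 : 0 < Real.log 2 := Real.log_pos (by norm_num)
  have hK1p : 0 ≤ K1 := by positivity
  have h9p : (0:ℝ) < (9:ℝ) ^ (1 + η) := by positivity
  set K : ℝ := 9 * K1 + (9:ℝ) ^ (1 + η) * K1 + 3 * d + 9 with hK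
  refine ⟨C * K, by positivity, ?_⟩
  intro g p h hgd hpd hhd hg hh A B t ht ht1 hA hB
  have hd1 : 1 ≤ d := hh.trans hhd
  have hA0 : 1 ≤ A.card := by
    rcases Nat.eq_zero_or_pos A.card with h0 | h0
    · rw [h0] at hA; norm_num at hA
    · exact h0
  have hB0 : 1 ≤ B.card := by
    rcases Nat.eq_zero_or_pos B.card with h0 | h0
    · rw [h0] at hB; norm_num at hB
    · exact h0
  have hAA : A.card ≤ (A + A).card := Finset.card_le_card_add_left (Finset.card_pos.1 hA0)
  have hAAt : 1 ≤ t * ((A + A).card : ℝ) := by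
    refine hA.trans (mul_le_mul_of_nonneg_left (by exact_mod_cast hAA) ht.le)
  have hP := close_pairs (A + A) t hAAt
  have hQA := close_pairs A t hA
  have hQB0 := close_pairs B t hB
  have hQB : ((QB g h B t).card : ℝ) ≤ 3 * t * (B.card : ℝ) ^ 2 := by
    refine le_trans ?_ hQB0
    exact_mod_cast Finset.card_le_card (Finset.filter_subset _ _)
  have main := hw g hg hgd (QA (A + A) t) (QA A t ×ˢ QB g h B t) (phiQ p h)
    (fun q hq => HH_irreducible g h hg _ _ (Finset.mem_filter.1 (Finset.mem_product.1 hq).2).2 _ _) (d * B.card)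
    (Nat.mul_pos hd1 hB0) (fun q _ => fiber_le g p h d hhd hh A B t q)
  have hR : ((Rtset g p h A B t).ncard : ℝ) ≤ _ := (Nat.cast_le.2 (Rt_le g p h A B t)).trans main
  refine hR.trans ?_
  rw [mul_assoc C K]
  refine mul_le_mul_of_nonneg_left ?_ hC.le
  have hlog := log_bound η hη d B.card hd1 hB0
  rw [← hK1] at hlog
  have hE := energy_le g p h A B t
  have hE' : (((((QA A t ×ˢ QB g h B t) ×ˢ (QA A t ×ˢ QB g h B t)).filter (fun x => phiQ p h x.1 = phiQ p h x.2)).card : ℕ) : ℝ) ≤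
      3 * t * (A.card : ℝ) ^ 2 * ((Stset g h B t).ncard : ℝ) := by
    refine le_trans (Nat.cast_le.2 hE) ?_
    push_cast
    exact mul_le_mul_of_nonneg_right hQA (by positivity)
  have hM' : (((QA A t ×ˢ QB g h B t).card : ℕ) : ℝ) ≤ 9 * (t ^ 2 * (A.card : ℝ) ^ 2 * (B.card : ℝ) ^ 2) := by
    rw [Finset.card_product]
    push_cast
    calc _ ≤ (3 * t * (A.card : ℝ) ^ 2) * (3 * t * (B.card : ℝ) ^ 2) :=
          mul_le_mul hQA hQB (by positivity) (by positivity)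
      _ = _ := by ring
  have hm' : (((QA (A + A) t).card : ℕ) : ℝ) ≤ 3 * t * ((A + A).card : ℝ) ^ 2 := hP
  have ha1 : (1:ℝ) ≤ A.card := by exact_mod_cast hA0
  have hb1 : (1:ℝ) ≤ B.card := by exact_mod_cast hB0
  have hs1 : (1:ℝ) ≤ (A + A).card := by exact_mod_cast hA0.trans hAA
  have hX := numX t A.card B.card (A + A).card (Stset g h B t).ncard _ _ _ ht ha1 hb1 hs1 (Nat.cast_nonneg _)
    (Nat.cast_nonneg _) (Nat.cast_nonneg _) (Nat.cast_nonneg _) hm' hM' hE'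
  have hY := numY η hη t A.card B.card (A + A).card (Stset g h B t).ncard _ _ _ ht ht1 ha1 hb1 hs1 (Nat.cast_nonneg _)
    (Nat.cast_nonneg _) (Nat.cast_nonneg _) (Nat.cast_nonneg _) hm' hM' hE'
  have hbp : (0:ℝ) < B.card := by linarith
  rw [show (14:ℝ)/11 + 3 * η = ((14:ℝ)/11 + 2 * η) + η by ring, Real.rpow_add hbp _ η, Real.rpow_add hbp _ η]
  have hXY := add_le_add hX hY
  have hXY0 := mul_le_mul hlog hXY (by positivity) (by positivity)
  refine (add_le_add (add_le_add hXY0 le_rfl) le_rfl).trans ?_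
  clear hXY0 hXY hX hY main hR
  push_cast
  have hdd : (0:ℝ) ≤ d := by positivity
  have hmm := mul_le_mul_of_nonneg_left hm' (show (0:ℝ) ≤ (d:ℝ) * B.card by positivity)
  refine (add_le_add (add_le_add le_rfl hmm) hM').trans ?_
  have p1 : 0 ≤ (t ^ 2 * (A.card : ℝ) ^ ((18:ℝ)/11 + 2*η) * (B.card : ℝ) ^ ((14:ℝ)/11 + 2*η)
                  * ((A + A).card : ℝ) ^ ((12:ℝ)/11) * ((Stset g h B t).ncard : ℝ) ^ ((2:ℝ)/11)) * (B.card : ℝ) ^ η := by positivity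
  have p2 : 0 ≤ (t ^ ((5:ℝ)/3) * (A.card : ℝ) ^ ((4:ℝ)/3) * (B.card : ℝ) ^ ((2:ℝ)/3)
                  * ((A + A).card : ℝ) ^ ((4:ℝ)/3) * ((Stset g h B t).ncard : ℝ) ^ ((1:ℝ)/3)) * (B.card : ℝ) ^ η := by positivity
  have p3 : 0 ≤ t * ((A + A).card : ℝ) ^ 2 * (B.card : ℝ) := by positivity
  have p4 : 0 ≤ t ^ 2 * (A.card : ℝ) ^ 2 * (B.card : ℝ) ^ 2 := by positivity
  have n1 : 0 ≤ (9:ℝ) ^ (1 + η) * K1 := mul_nonneg h9p.le hK1p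
  have i1 : K1 * (9:ℝ) ^ (1 + η) ≤ K := by rw [hK, mul_comm K1]; linarith only [n1, hK1p, hdd]
  have i2 : K1 * 9 ≤ K := by rw [hK]; linarith only [n1, hK1p, hdd]
  have i3 : (d:ℝ) * 3 ≤ K := by rw [hK]; linarith only [n1, hK1p, hdd]
  have i4 : 9 ≤ K := by rw [hK]; linarith only [n1, hK1p, hdd]
  have q1 := mul_le_mul_of_nonneg_right i1 p1
  have q2 := mul_le_mul_of_nonneg_right i2 p2
  have q3 := mul_le_mul_of_nonneg_right i3 p3
  have q4 := mul_le_mul_of_nonneg_right i4 p4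
  have := add_le_add (add_le_add q1 q2) (add_le_add q3 q4)
  refine le_trans (le_of_eq ?_) (this.trans (le_of_eq ?_))
  · ring
  · ring
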